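/- Let K be a normal 4-pseudomanifold with exactly two singular vertices, both contained in its vertex set, and suppose K is g_2- and g_3-optimal with respect to one singular vertex. Then g_2(K) = 6m + 10n for some natural numbers m ≥ 1 and n ≥ 0. -/

import Mathlib

open scoped Classical

noncomputable section

variable {V : Type*} [Fintype V] [DecidableEq V]

/-- A (finite abstract) simplicial complex: a family of nonempty finite sets closed
under passing to nonempty subsets. -/
def IsComplex (K : Finset (Finset V)) : Prop :=
  ∀ σ ∈ K, ∀ τ ⊆ σ, τ.Nonempty → τ ∈ K

/-- `K` is pure of dimension `d`. -/
def IsPure (d : ℕ) (K : Finset (Finset V)) : Prop :=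
  ∀ σ ∈ K, ∃ τ ∈ K, σ ⊆ τ ∧ τ.card = d + 1

/-- The set of `i`-dimensional faces of `K`. -/
def facesOfDim (i : ℕ) (K : Finset (Finset V)) : Finset (Finset V) :=
  K.filter (fun σ => σ.card = i + 1)

/-- The `i`-th face number of `K`, as an integer. -/
def fNum (i : ℕ) (K : Finset (Finset V)) : ℤ := ((facesOfDim i K).card : ℤ)

/-- `g_2` of a `d`-dimensional complex. -/
def g2 (d : ℕ) (K : Finset (Finset V)) : ℤ :=
  fNum 1 K - (d + 1) * fNum 0 K + (Nat.choose (d + 2) 2 : ℤ)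

/-- `g_3` of a `d`-dimensional complex. -/
def g3 (d : ℕ) (K : Finset (Finset V)) : ℤ :=
  fNum 2 K - d * fNum 1 K + (Nat.choose (d + 1) 2 : ℤ) * fNum 0 K
    - (Nat.choose (d + 2) 3 : ℤ)

/-- The link of a face `σ` in `K`. -/
def faceLink (σ : Finset V) (K : Finset (Finset V)) : Finset (Finset V) :=
  K.filter (fun γ => γ ∩ σ = ∅ ∧ γ ∪ σ ∈ K)

/-- The link of a vertex `t` in `K`. -/
def vertexLink (t : V) (K : Finset (Finset V)) : Finset (Finset V) :=
  K.filter (fun γ => t ∉ γ ∧ insert t γ ∈ K)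

/-- Connectedness of a complex: it is nonempty and any two of its vertices are joined
by a path of edges of the complex. -/
def ComplexConnected (K : Finset (Finset V)) : Prop :=
  K.Nonempty ∧ ∀ u v : V, {u} ∈ K → {v} ∈ K →
    Relation.ReflTransGen (fun a b => ({a, b} : Finset V) ∈ K) u v

/-- Strong connectedness of a pure `d`-complex: any two facets are joined by a chain of
facets in which consecutive facets share a `(d-1)`-face. -/
def StronglyConnected (d : ℕ) (K : Finset (Finset V)) : Prop :=
  ∀ σ ∈ K, ∀ τ ∈ K, σ.card = d + 1 → τ.card = d + 1 →
    Relation.ReflTransGen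
      (fun α β => α ∈ K ∧ β ∈ K ∧ α.card = d + 1 ∧ β.card = d + 1 ∧ (α ∩ β).card = d)
      σ τ

/-- A normal `d`-pseudomanifold: a strongly connected pure `d`-complex in which every
`(d-1)`-face lies in exactly two facets, and links of faces of dimension ≤ d-2 are
connected. -/
def IsNormalPseudomanifold (d : ℕ) (K : Finset (Finset V)) : Prop :=
  IsComplex K ∧ IsPure d K ∧ StronglyConnected d K ∧
    (∀ σ ∈ K, σ.card = d →
      (K.filter (fun τ => σ ⊆ τ ∧ τ.card = d + 1)).card = 2) ∧
    (∀ σ ∈ K, σ.card ≤ d - 1 → ComplexConnected (faceLink σ K))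

/-- The geometric realization of `K` inside `V → ℝ`. -/
def realization (K : Finset (Finset V)) : Set (V → ℝ) :=
  {x | (∃ σ ∈ K, ∀ v, x v ≠ 0 → v ∈ σ) ∧ (∀ v, 0 ≤ x v) ∧ (∑ v, x v) = 1}

/-- `K` is a triangulated `n`-sphere: its geometric realization is homeomorphic to the
unit `n`-sphere. -/
def IsTriangulatedSphere (n : ℕ) (K : Finset (Finset V)) : Prop :=
  Nonempty (realization K ≃ₜ Metric.sphere (0 : EuclideanSpace ℝ (Fin (n + 1))) 1)

/-- A singular vertex of a normal 4-pseudomanifold: its link is not a triangulated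
3-sphere. -/
def IsSingular (t : V) (K : Finset (Finset V)) : Prop :=
  {t} ∈ K ∧ ¬ IsTriangulatedSphere 3 (vertexLink t K)

/-! ### Rigidity: rows of the rigidity matrix in dimension four -/

/-- The row of the rigidity matrix attached to an edge `e` (a two element set). -/
def rgRow (p : V → Fin 4 → ℝ) (e : Finset V) : V → Fin 4 → ℝ :=
  fun w => if w ∈ e then ∑ z ∈ e, (p w - p z) else 0

theorem rgRow_pair (p : V → Fin 4 → ℝ) (x y : V) :
    rgRow p {x, y} = Pi.single x (p x - p y) + Pi.single y (p y - p x) := by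
  funext w
  by_cases hxy : x = y
  · subst hxy
    have h2 : ∀ w ∈ ({x} : Finset V), p w - p x = 0 := by
      intro w hw
      rw [Finset.mem_singleton.1 hw, sub_self]
    simp only [rgRow, Finset.pair_eq_singleton, Finset.sum_singleton, sub_self, Pi.single_zero,
      add_zero, Pi.zero_apply]
    split_ifs with h
    · exact h2 w h
    · rfl
  · simp only [rgRow, Finset.mem_insert, Finset.mem_singleton, Finset.sum_pair hxy, Pi.add_apply,
      Pi.single_apply]
    by_cases h1 : w = x
    · subst h1
      simp [hxy]
    · by_cases h2 : w = y
      · subst h2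
        simp [h1]
      · simp [h1, h2]

theorem rgRow_self (p : V → Fin 4 → ℝ) (x : V) : rgRow p {x, x} = 0 := by
  rw [rgRow_pair]; simp

/-- Span of the rows of an edge set. -/
def rgSp (p : V → Fin 4 → ℝ) (E : Set (Finset V)) : Submodule ℝ (V → Fin 4 → ℝ) :=
  Submodule.span ℝ (rgRow p '' E)

theorem rgSp_mono (p : V → Fin 4 → ℝ) {E F : Set (Finset V)} (h : E ⊆ F) :
    rgSp p E ≤ rgSp p F := Submodule.span_mono (Set.image_mono h)

theorem rgRow_mem (p : V → Fin 4 → ℝ) {E : Set (Finset V)} {e : Finset V} (h : e ∈ E) :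
    rgRow p e ∈ rgSp p E := Submodule.subset_span ⟨e, h, rfl⟩

/-- `E` spans all pairs in `S`. -/
def rgRig (p : V → Fin 4 → ℝ) (E : Set (Finset V)) (S : Finset V) : Prop :=
  ∀ x ∈ S, ∀ y ∈ S, rgRow p {x, y} ∈ rgSp p E

/-- General position: any five points are affinely independent. -/
def rgGP (p : V → Fin 4 → ℝ) : Prop :=
  ∀ S : Finset V, S.card ≤ 5 → ∀ w : V → ℝ, ∑ x ∈ S, w x = 0 → ∑ x ∈ S, w x • p x = 0 →
    ∀ x ∈ S, w x = 0

theorem rg_exists_dep (p : V → Fin 4 → ℝ) (S : Finset V) (hS : S.card = 6) :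
    ∃ w : V → ℝ, ∑ x ∈ S, w x = 0 ∧ ∑ x ∈ S, w x • p x = 0 ∧ ∃ x ∈ S, w x ≠ 0 := by
  let L : (S → ℝ) →ₗ[ℝ] ℝ × (Fin 4 → ℝ) :=
    LinearMap.prod (∑ x : S, LinearMap.proj x)
      (∑ x : S, (LinearMap.proj x : (S → ℝ) →ₗ[ℝ] ℝ).smulRight (p x))
  have hker : LinearMap.ker L ≠ ⊥ := by
    apply LinearMap.ker_ne_bot_of_finrank_lt
    simp [hS]
  obtain ⟨f, hf, hf0⟩ := Submodule.exists_mem_ne_zero_of_ne_bot hker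
  have hf' : (∑ x : S, f x = 0) ∧ (∑ x : S, f x • p x = 0) := by
    have := LinearMap.mem_ker.1 hf
    simpa [L, Prod.ext_iff, LinearMap.sum_apply] using this
  refine ⟨fun x => if h : x ∈ S then f ⟨x, h⟩ else 0, ?_, ?_, ?_⟩
  · rw [← Finset.sum_coe_sort S]
    rw [← hf'.1]
    exact Finset.sum_congr rfl (fun x _ => by simp)
  · rw [← Finset.sum_coe_sort S (fun x => (if h : x ∈ S then f ⟨x, h⟩ else 0) • p x)]
    rw [← hf'.2]
    exact Finset.sum_congr rfl (fun x _ => by simp)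
  · by_contra! hcon
    apply hf0
    funext x
    have := hcon x x.2
    simpa using this

theorem rg_K6 {p : V → Fin 4 → ℝ} (hp : rgGP p) (S : Finset V) (hS : S.card = 6)
    {a b : V} (ha : a ∈ S) (hb : b ∈ S) (hab : a ≠ b) (E : Set (Finset V))
    (hE : ∀ x ∈ S, ∀ y ∈ S, x ≠ y → ({x, y} : Finset V) ≠ {a, b} → rgRow p {x, y} ∈ rgSp p E) :
    rgRow p {a, b} ∈ rgSp p E := by
  obtain ⟨w, hw0, hw1, x0, hx0, hwx0⟩ := rg_exists_dep p S hS
  have hne : ∀ x ∈ S, w x ≠ 0 := by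
    intro x hx hwx
    have h1 : ∑ y ∈ S.erase x, w y = 0 := by
      rw [← hw0, ← Finset.add_sum_erase S w hx, hwx, zero_add]
    have h2 : ∑ y ∈ S.erase x, w y • p y = 0 := by
      rw [← hw1, ← Finset.add_sum_erase S (fun y => w y • p y) hx, hwx, zero_smul, zero_add]
    have h3 := hp (S.erase x) (by rw [Finset.card_erase_of_mem hx, hS]) w h1 h2
    by_cases hxx : x0 = x
    · exact hwx0 (hxx ▸ hwx)
    · exact hwx0 (h3 x0 (Finset.mem_erase.2 ⟨hxx, hx0⟩))
  have key : ∑ x ∈ S, ∑ y ∈ S, (w x * w y) • rgRow p {x, y} = 0 := by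
    have hz : ∀ z : V, ∑ y ∈ S, w y • (p z - p y) = 0 := by
      intro z
      simp only [smul_sub, Finset.sum_sub_distrib, hw1, sub_zero, ← Finset.sum_smul, hw0, zero_smul]
    simp only [rgRow_pair, smul_add, Finset.sum_add_distrib]
    have e1 : ∀ x ∈ S, ∑ y ∈ S, (w x * w y) • (Pi.single x (p x - p y) : V → Fin 4 → ℝ) = 0 := by
      intro x _
      have : ∑ y ∈ S, (w x * w y) • (Pi.single x (p x - p y) : V → Fin 4 → ℝ)
          = Pi.single x (w x • ∑ y ∈ S, w y • (p x - p y)) := by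
        rw [Finset.smul_sum]
        rw [show (Pi.single x (∑ y ∈ S, w x • w y • (p x - p y)) : V → Fin 4 → ℝ)
          = LinearMap.single ℝ (fun _ : V => Fin 4 → ℝ) x (∑ y ∈ S, w x • w y • (p x - p y))
          from rfl]
        rw [map_sum]
        refine Finset.sum_congr rfl (fun y _ => ?_)
        simp [mul_smul, Pi.single_smul]
      rw [this, hz, smul_zero, Pi.single_zero]
    rw [Finset.sum_eq_zero e1, zero_add, Finset.sum_comm]
    refine Finset.sum_eq_zero (fun x hx => ?_)
    rw [← e1 x hx]
    refine Finset.sum_congr rfl (fun y _ => by rw [mul_comm])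
  rw [← Finset.sum_product'] at key
  have hm1 : (a, b) ∈ S ×ˢ S := by simp [ha, hb]
  have hm2 : (b, a) ∈ (S ×ˢ S).erase (a, b) := by
    simp [ha, hb]; intro h; exact absurd h.symm hab
  rw [← Finset.add_sum_erase _ _ hm1, ← Finset.add_sum_erase _ _ hm2] at key
  have hrest : ∑ q ∈ ((S ×ˢ S).erase (a, b)).erase (b, a), (w q.1 * w q.2) • rgRow p {q.1, q.2}
      ∈ rgSp p E := by
    refine Submodule.sum_mem _ (fun q hq => ?_)
    simp only [Finset.mem_erase, Finset.mem_product] at hq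
    obtain ⟨q1, q2⟩ := q
    by_cases hqq : q1 = q2
    · subst hqq
      rw [rgRow_self, smul_zero]
      exact Submodule.zero_mem _
    · apply Submodule.smul_mem
      apply hE q1 hq.2.2.1 q2 hq.2.2.2 hqq
      intro h
      have h1 : q1 ∈ ({a, b} : Finset V) := h ▸ (by simp)
      have h2 : q2 ∈ ({a, b} : Finset V) := h ▸ (by simp)
      simp only [Finset.mem_insert, Finset.mem_singleton] at h1 h2
      rcases h1 with h1 | h1 <;> rcases h2 with h2 | h2 <;> subst h1 <;> subst h2 <;> simp_all
  simp only [Finset.pair_comm b a] at key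
  have : (w a * w b + w b * w a) • rgRow p {a, b} ∈ rgSp p E := by
    have h : (w a * w b + w b * w a) • rgRow p {a, b} =
        -(∑ q ∈ ((S ×ˢ S).erase (a, b)).erase (b, a), (w q.1 * w q.2) • rgRow p {q.1, q.2}) := by
      rw [add_smul, eq_neg_iff_add_eq_zero, add_assoc]
      exact key
    rw [h]
    exact Submodule.neg_mem _ hrest
  refine (Submodule.smul_mem_iff _ ?_).1 this
  have := mul_ne_zero (hne a ha) (hne b hb)
  rw [mul_comm (w b)]
  intro h
  apply this
  linarith

/-- Gluing lemma. -/
theorem rg_glue {p : V → Fin 4 → ℝ} (hp : rgGP p) {E : Set (Finset V)} {S T : Finset V}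
    (hS : rgRig p E S) (hT : rgRig p E T) (h4 : 4 ≤ (S ∩ T).card) : rgRig p E (S ∪ T) := by
  have main : ∀ a ∈ S, ∀ b ∈ T, rgRow p {a, b} ∈ rgSp p E := by
    intro a ha b hb
    by_cases haT : a ∈ T
    · exact hT a haT b hb
    by_cases hbS : b ∈ S
    · exact hS a ha b hbS
    obtain ⟨U, hU, hUc⟩ := Finset.exists_subset_card_eq h4
    have hab : a ≠ b := fun h => haT (h ▸ hb)
    have haU : a ∉ U := fun h => haT (Finset.mem_inter.1 (hU h)).2
    have hbU : b ∉ U := fun h => hbS (Finset.mem_inter.1 (hU h)).1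
    apply rg_K6 hp (insert a (insert b U)) (a := a) (b := b)
    · rw [Finset.card_insert_of_notMem (by simp [hab, haU]), Finset.card_insert_of_notMem hbU, hUc]
    · simp
    · simp
    · exact hab
    · intro x hx y hy hxy hne
      have hU1 : ∀ z ∈ U, z ∈ S ∧ z ∈ T := fun z hz => Finset.mem_inter.1 (hU hz)
      simp only [Finset.mem_insert] at hx hy
      rcases hx with rfl | rfl | hx <;> rcases hy with rfl | rfl | hy
      · exact absurd rfl hxy
      · exact absurd rfl hne
      · exact hS _ ha _ (hU1 _ hy).1
      · exact absurd (Finset.pair_comm _ _) hne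
      · exact absurd rfl hxy
      · exact hT _ hb _ (hU1 _ hy).2
      · exact hS _ (hU1 _ hx).1 _ ha
      · exact hT _ (hU1 _ hx).2 _ hb
      · exact hS _ (hU1 _ hx).1 _ (hU1 _ hy).1
  intro x hx y hy
  rcases Finset.mem_union.1 hx with hx | hx <;> rcases Finset.mem_union.1 hy with hy | hy
  · exact hS x hx y hy
  · exact main x hx y hy
  · rw [Finset.pair_comm]; exact main y hy x hx
  · exact hT x hx y hy

/-- Rank of an edge set. -/
def rgRk (p : V → Fin 4 → ℝ) (E : Set (Finset V)) : ℕ := Module.finrank ℝ (rgSp p E)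

theorem rgRk_mono (p : V → Fin 4 → ℝ) {E F : Set (Finset V)} (h : E ⊆ F) :
    rgRk p E ≤ rgRk p F := Submodule.finrank_mono (rgSp_mono p h)

theorem rgRk_le_card (p : V → Fin 4 → ℝ) (E : Finset (Finset V)) :
    rgRk p (E : Set (Finset V)) ≤ E.card := by
  unfold rgRk rgSp
  rw [← Finset.coe_image]
  exact (finrank_span_finset_le_card _).trans Finset.card_image_le

theorem rgSp_union (p : V → Fin 4 → ℝ) (E F : Set (Finset V)) :
    rgSp p (E ∪ F) = rgSp p E ⊔ rgSp p F := by
  unfold rgSp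
  rw [Set.image_union, Submodule.span_union]

theorem rgRk_union_le (p : V → Fin 4 → ℝ) (E : Set (Finset V)) (F : Finset (Finset V)) :
    rgRk p (E ∪ F) ≤ rgRk p E + F.card := by
  unfold rgRk
  rw [rgSp_union]
  exact (Submodule.finrank_add_le_finrank_add_finrank _ _).trans
    (Nat.add_le_add_left (rgRk_le_card p F) _)

theorem rg_disjoint_rank (A B : Submodule ℝ (V → Fin 4 → ℝ)) (v : V)
    (hA : ∀ f ∈ A, f v = 0) (hB : ∀ f ∈ B, f v = 0 → f = 0) :
    Module.finrank ℝ (A ⊔ B : Submodule ℝ (V → Fin 4 → ℝ)) =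
      Module.finrank ℝ A + Module.finrank ℝ B := by
  have h := Submodule.finrank_sup_add_finrank_inf_eq A B
  have h0 : A ⊓ B = ⊥ := by
    rw [eq_bot_iff]
    rintro f ⟨h1, h2⟩
    exact hB f h2 (hA f h1)
  rw [h0] at h
  simpa using h

theorem rgSp_vanish (p : V → Fin 4 → ℝ) (E : Set (Finset V)) (v : V)
    (h : ∀ e ∈ E, v ∉ e) : ∀ f ∈ rgSp p E, f v = 0 := by
  intro f hf
  unfold rgSp at hf
  induction hf using Submodule.span_induction with
  | mem x hx =>
    obtain ⟨e, he, rfl⟩ := hx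
    simp [rgRow, h e he]
  | zero => rfl
  | add x y _ _ hx hy => simp [hx, hy]
  | smul a x _ hx => simp [hx]

theorem rg_star_inj {p : V → Fin 4 → ℝ} (hp : rgGP p) (v : V) (T : Finset V) (hv : v ∉ T)
    (hT : T.card ≤ 4) (w : V → ℝ) (h : ∑ t ∈ T, w t • (p v - p t) = 0) : ∀ t ∈ T, w t = 0 := by
  intro t ht
  let w' : V → ℝ := fun x => if x = v then -∑ t ∈ T, w t else w x
  have hw' : ∀ x ∈ T, w' x = w x := by
    intro x hx
    have : x ≠ v := fun h => hv (h ▸ hx)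
    simp [w', this]
  have := hp (insert v T) (by rw [Finset.card_insert_of_notMem hv]; omega) w' ?_ ?_ t
    (Finset.mem_insert_of_mem ht)
  · rwa [hw' t ht] at this
  · rw [Finset.sum_insert hv, Finset.sum_congr rfl hw']
    simp [w']
  · rw [Finset.sum_insert hv, Finset.sum_congr rfl (fun x hx => by rw [hw' x hx])]
    simp only [smul_sub, Finset.sum_sub_distrib, ← Finset.sum_smul] at h
    simp only [w', if_true, neg_smul]
    rw [sub_eq_zero.1 h]
    simp

theorem rg_star {p : V → Fin 4 → ℝ} (hp : rgGP p) (v : V) (T : Finset V) (hv : v ∉ T)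
    (hT : T.card ≤ 4) :
    (∀ f ∈ rgSp p (T.image (fun t => ({v, t} : Finset V)) : Finset (Finset V)), f v = 0 → f = 0) ∧
    rgRk p (T.image (fun t => ({v, t} : Finset V)) : Finset (Finset V)) = T.card := by
  have hrep : ∀ f ∈ rgSp p (T.image (fun t => ({v, t} : Finset V)) : Finset (Finset V)),
      ∃ w : V → ℝ, f = ∑ t ∈ T, w t • rgRow p {v, t} := by
    intro f hf
    unfold rgSp at hf
    rw [Finset.coe_image, Set.image_image] at hf
    rw [Submodule.mem_span_image_finset_iff_exists_fun] at hf
    obtain ⟨c, hc⟩ := hf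
    refine ⟨fun x => if h : x ∈ T then c ⟨x, h⟩ else 0, ?_⟩
    rw [← hc, ← Finset.sum_coe_sort T
      (fun t => (if h : t ∈ T then c ⟨t, h⟩ else 0) • rgRow p {v, t})]
    exact Finset.sum_congr rfl (fun x _ => by simp)
  have hval : ∀ w : V → ℝ, (∑ t ∈ T, w t • rgRow p {v, t}) v = ∑ t ∈ T, w t • (p v - p t) := by
    intro w
    rw [Finset.sum_apply]
    refine Finset.sum_congr rfl (fun t ht => ?_)
    have : v ≠ t := fun h => hv (h ▸ ht)
    rw [rgRow_pair]
    simp [Pi.single_apply, this]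
  refine ⟨?_, ?_⟩
  · intro f hf hfv
    obtain ⟨w, rfl⟩ := hrep f hf
    rw [hval] at hfv
    have := rg_star_inj hp v T hv hT w hfv
    exact Finset.sum_eq_zero (fun t ht => by rw [this t ht, zero_smul])
  · unfold rgRk rgSp
    rw [Finset.coe_image, Set.image_image]
    have hli : LinearIndependent ℝ (fun t : T => rgRow p {v, (t : V)}) := by
      rw [Fintype.linearIndependent_iff]
      intro g hg i
      let w : V → ℝ := fun x => if h : x ∈ T then g ⟨x, h⟩ else 0
      have h1 : ∑ t ∈ T, w t • rgRow p {v, t} = 0 := by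
        rw [← Finset.sum_coe_sort T (fun t => w t • rgRow p {v, t}), ← hg]
        exact Finset.sum_congr rfl (fun x _ => by simp [w])
      have h2 := congrFun h1 v
      rw [hval] at h2
      have := rg_star_inj hp v T hv hT w h2 i i.2
      simpa [w] using this
    have := finrank_span_eq_card hli
    rw [Fintype.card_coe] at this
    rw [← this]
    have hset : ((fun x => rgRow p {v, x}) '' (T : Set V)) =
        Set.range (fun t : T => rgRow p {v, (t : V)}) := by
      ext f
      simp
    rw [hset]

theorem rgRk_insert {p : V → Fin 4 → ℝ} (hp : rgGP p) (S : Finset V) (v : V) (hv : v ∉ S) :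
    rgRk p ((insert v S).powersetCard 2 : Finset (Finset V)) =
      rgRk p (S.powersetCard 2 : Finset (Finset V)) + min S.card 4 := by
  obtain ⟨T, hTS, hTc⟩ := Finset.exists_subset_card_eq (s := S) (n := min S.card 4) (by simp)
  have hvT : v ∉ T := fun h => hv (hTS h)
  have h4 : T.card ≤ 4 := by rw [hTc]; simp
  obtain ⟨hs1, hs2⟩ := rg_star hp v T hvT h4
  rw [← hTc, ← hs2]
  unfold rgRk
  rw [← rg_disjoint_rank _ _ v (rgSp_vanish p _ v ?_) hs1, ← rgSp_union]
  · have hle : rgSp p ((insert v S).powersetCard 2 : Finset (Finset V)) =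
      rgSp p ((S.powersetCard 2 : Finset (Finset V)) ∪
        (T.image (fun t => ({v, t} : Finset V)) : Finset (Finset V))) := by
      apply le_antisymm
      · apply Submodule.span_le.2
        have hS1 : ∀ x ∈ S, ∀ y ∈ S, rgRow p {x, y} ∈ rgSp p ((S.powersetCard 2 : Finset (Finset V)) ∪
            (T.image (fun t => ({v, t} : Finset V)) : Finset (Finset V))) := by
          intro x hx y hy
          by_cases hxy : x = y
          · rw [hxy, rgRow_self]; exact Submodule.zero_mem _
          · apply rgRow_mem
            left
            simp [Finset.mem_powersetCard, Finset.card_pair hxy, Finset.insert_subset_iff, hx, hy]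
        have hT1 : ∀ x ∈ T, rgRow p {v, x} ∈ rgSp p ((S.powersetCard 2 : Finset (Finset V)) ∪
            (T.image (fun t => ({v, t} : Finset V)) : Finset (Finset V))) := by
          intro x hx
          apply rgRow_mem
          right
          simp only [Finset.coe_image, Set.mem_image, Finset.mem_coe]
          exact ⟨x, hx, rfl⟩
        have hS2 : ∀ x ∈ S, rgRow p {v, x} ∈ rgSp p ((S.powersetCard 2 : Finset (Finset V)) ∪
            (T.image (fun t => ({v, t} : Finset V)) : Finset (Finset V))) := by
          intro x hx
          by_cases hxT : x ∈ T
          · exact hT1 x hxT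
          · have hT4 : T.card = 4 := by
              rcases le_total S.card 4 with h | h
              · rw [min_eq_left h] at hTc
                exact absurd (Finset.eq_of_subset_of_card_le hTS hTc.ge ▸ hx) hxT
              · rw [hTc, min_eq_right h]
            have hvx : v ≠ x := fun h => hv (h ▸ hx)
            apply rg_K6 hp (insert v (insert x T)) (a := v) (b := x)
            · rw [Finset.card_insert_of_notMem (by simp [hvx, hvT]),
                Finset.card_insert_of_notMem hxT, hT4]
            · simp
            · simp
            · exact hvx
            · intro y hy z hz hyz hne
              simp only [Finset.mem_insert] at hy hz
              rcases hy with rfl | rfl | hy <;> rcases hz with rfl | rfl | hz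
              · exact absurd rfl hyz
              · exact absurd rfl hne
              · exact hT1 _ hz
              · exact absurd (Finset.pair_comm _ _) hne
              · exact absurd rfl hyz
              · exact hS1 _ hx _ (hTS hz)
              · rw [Finset.pair_comm]; exact hT1 _ hy
              · exact hS1 _ (hTS hy) _ hx
              · exact hS1 _ (hTS hy) _ (hTS hz)
        rintro _ ⟨e, he, rfl⟩
        rw [Finset.mem_coe, Finset.mem_powersetCard, Finset.card_eq_two] at he
        obtain ⟨hes, x, y, hxy, rfl⟩ := he
        have hx : x = v ∨ x ∈ S := Finset.mem_insert.1 (hes (by simp))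
        have hy : y = v ∨ y ∈ S := Finset.mem_insert.1 (hes (by simp))
        rcases hx with rfl | hx <;> rcases hy with rfl | hy
        · exact absurd rfl hxy
        · exact hS2 _ hy
        · rw [Finset.pair_comm]; exact hS2 _ hx
        · exact hS1 _ hx _ hy
      · apply rgSp_mono
        rintro e (he | he)
        · exact Finset.powersetCard_mono (Finset.subset_insert _ _) he
        · rw [Finset.mem_coe, Finset.mem_image] at he
          obtain ⟨t, ht, rfl⟩ := he
          have hvt : v ≠ t := fun h => hvT (h ▸ ht)
          simp [Finset.mem_powersetCard, Finset.card_pair hvt, Finset.insert_subset_iff, hTS ht]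
    rw [hle]
  · intro e he hve
    exact hv ((Finset.mem_powersetCard.1 he).1 hve)

theorem rgRk_complete {p : V → Fin 4 → ℝ} (hp : rgGP p) (S : Finset V) (hS : 4 ≤ S.card) :
    rgRk p (S.powersetCard 2 : Finset (Finset V)) + 10 = 4 * S.card := by
  have small : ∀ S : Finset V, (S.card ≤ 4 →
      rgRk p (S.powersetCard 2 : Finset (Finset V)) = S.card.choose 2) ∧ (4 ≤ S.card →
      rgRk p (S.powersetCard 2 : Finset (Finset V)) + 10 = 4 * S.card) := by
    intro S
    induction S using Finset.induction_on with
    | empty =>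
      have h0 : rgRk p (((∅ : Finset V).powersetCard 2 : Finset (Finset V)) : Set (Finset V)) = 0 := by
        have := rgRk_le_card p ((∅ : Finset V).powersetCard 2)
        rw [Finset.card_powersetCard, Finset.card_empty] at this
        exact Nat.le_zero.1 this
      rw [h0]
      simp
    | insert v S hv ih =>
      rw [rgRk_insert hp S v hv, Finset.card_insert_of_notMem hv]
      have h1 : S.card ≤ 3 → rgRk p (S.powersetCard 2 : Finset (Finset V)) + min S.card 4 =
          (S.card + 1).choose 2 := by
        intro h
        rw [ih.1 (by omega), min_eq_left (by omega)]
        generalize S.card = n at h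
        interval_cases n <;> rfl
      refine ⟨fun h => h1 (by omega), fun h => ?_⟩
      by_cases h3 : S.card = 3
      · rw [h1 (by omega), h3]; rfl
      · rw [min_eq_right (by omega)]
        have := ih.2 (by omega)
        omega
  exact (small S).2 hS

/-! ### Generic configurations -/

theorem rg_gram {ι κ : Type*} [Fintype ι] [DecidableEq ι] [Fintype κ] (B : Matrix ι κ ℝ) :
    LinearIndependent ℝ (fun i => B i) ↔ (B * B.transpose).det ≠ 0 := by
  have hsum : ∀ g : ι → ℝ, ∑ i, g i • B i = B.transpose.mulVec g := by
    intro g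
    funext k
    simp [Matrix.mulVec, dotProduct, Finset.sum_apply, mul_comm]
  rw [Fintype.linearIndependent_iff, Ne, ← Matrix.exists_mulVec_eq_zero_iff]
  push Not
  constructor
  · intro h v hv hz
    apply hv
    have h2 : B.transpose.mulVec v = 0 := by
      rw [← Matrix.mulVec_mulVec] at hz
      have h3 : v ⬝ᵥ (B.mulVec (B.transpose.mulVec v)) = 0 := by rw [hz]; simp
      rw [Matrix.dotProduct_mulVec, ← Matrix.mulVec_transpose] at h3
      exact dotProduct_self_eq_zero.1 h3
    funext i
    exact h v (by rw [hsum, h2]) i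
  · intro h g hg i
    by_contra hgi
    refine h g (fun h0 => hgi (by rw [h0]; rfl)) ?_
    rw [← Matrix.mulVec_mulVec, ← hsum, hg]
    simp

theorem rg_generic_family {ι κ σ : Type*} [Fintype ι] [DecidableEq ι] [Fintype κ]
    (A : Matrix ι κ (MvPolynomial σ ℝ)) :
    ∃ Q : MvPolynomial σ ℝ, Q ≠ 0 ∧ ∀ q p : σ → ℝ,
      LinearIndependent ℝ (fun i => fun k => MvPolynomial.eval q (A i k)) →
      MvPolynomial.eval p Q ≠ 0 →
      LinearIndependent ℝ (fun i => fun k => MvPolynomial.eval p (A i k)) := by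
  have hev : ∀ p : σ → ℝ, MvPolynomial.eval p ((A * A.transpose).det) =
      ((A.map (MvPolynomial.eval p)) * (A.map (MvPolynomial.eval p)).transpose).det := by
    intro p
    rw [RingHom.map_det, RingHom.mapMatrix_apply, Matrix.map_mul, Matrix.transpose_map]
  by_cases h0 : (A * A.transpose).det = 0
  · refine ⟨1, one_ne_zero, fun q p hq _ => ?_⟩
    exfalso
    have := (rg_gram (A.map (MvPolynomial.eval q))).1 hq
    rw [← hev, h0] at this
    simp at this
  · refine ⟨_, h0, fun q p _ hp => ?_⟩
    rw [hev] at hp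
    exact (rg_gram (A.map (MvPolynomial.eval p))).2 hp

/-- A generic configuration: general position and all ranks are maximal. -/
def rgGen (p : V → Fin 4 → ℝ) : Prop :=
  rgGP p ∧ ∀ (E : Finset (Finset V)) (q : V → Fin 4 → ℝ),
    rgRk q (E : Set (Finset V)) ≤ rgRk p (E : Set (Finset V))

/-- Polynomial version of the rows. -/
def rgRowPoly (e : Finset V) (k : V × Fin 4) : MvPolynomial (V × Fin 4) ℝ :=
  if k.1 ∈ e then ∑ z ∈ e, (MvPolynomial.X (k.1, k.2) - MvPolynomial.X (z, k.2)) else 0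

theorem rgRowPoly_eval (p : V → Fin 4 → ℝ) (e : Finset V) (k : V × Fin 4) :
    MvPolynomial.eval (fun s : V × Fin 4 => p s.1 s.2) (rgRowPoly e k) = rgRow p e k.1 k.2 := by
  unfold rgRowPoly rgRow
  split_ifs with h
  · simp [map_sum, Finset.sum_apply]
  · simp

theorem rgRow_li_iff (p : V → Fin 4 → ℝ) (E : Finset (Finset V)) :
    LinearIndependent ℝ (fun e : E => rgRow p e) ↔
    LinearIndependent ℝ (fun (e : E) => fun k : V × Fin 4 =>
      MvPolynomial.eval (fun s : V × Fin 4 => p s.1 s.2) (rgRowPoly (e : Finset V) k)) := by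
  let L : (V → Fin 4 → ℝ) →ₗ[ℝ] (V × Fin 4 → ℝ) :=
    { toFun := fun f k => f k.1 k.2
      map_add' := fun f g => rfl
      map_smul' := fun c f => rfl }
  have hL : LinearMap.ker L = ⊥ := by
    rw [LinearMap.ker_eq_bot']
    intro f hf
    funext a i
    exact congrFun hf (a, i)
  have h : (fun (e : E) => fun k : V × Fin 4 =>
      MvPolynomial.eval (fun s : V × Fin 4 => p s.1 s.2) (rgRowPoly (e : Finset V) k)) =
      L ∘ (fun e : E => rgRow p e) := by
    funext e k
    rw [rgRowPoly_eval]
    rfl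
  rw [h]
  exact (LinearMap.linearIndependent_iff L hL).symm

theorem rg_indep_subset {α M : Type*} [AddCommGroup M] [Module ℝ M] (f : α → M) (E : Finset α) :
    ∃ I : Finset α, I ⊆ E ∧ LinearIndependent ℝ (fun x : I => f x) ∧
      Submodule.span ℝ (f '' (I : Set α)) = Submodule.span ℝ (f '' (E : Set α)) := by
  obtain ⟨b, hbE, -, hsp, hli⟩ := exists_linearIndepOn_extension (K := ℝ) (v := f)
    (linearIndepOn_empty ℝ f) (Set.empty_subset (E : Set α))
  have hbf : b.Finite := E.finite_toSet.subset hbE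
  refine ⟨hbf.toFinset, ?_, ?_, ?_⟩
  · intro x hx
    exact hbE (hbf.mem_toFinset.1 hx)
  · have h2 : LinearIndepOn ℝ f (hbf.toFinset : Set α) := by
      rw [hbf.coe_toFinset]; exact hli
    exact h2
  · rw [hbf.coe_toFinset]
    exact le_antisymm (Submodule.span_mono (Set.image_mono hbE)) (Submodule.span_le.2 hsp)

theorem rgRk_of_li (p : V → Fin 4 → ℝ) (I : Finset (Finset V))
    (h : LinearIndependent ℝ (fun x : I => rgRow p x)) :
    rgRk p (I : Set (Finset V)) = I.card := by
  have := finrank_span_eq_card h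
  rw [Fintype.card_coe] at this
  rw [← this]
  unfold rgRk rgSp
  have hset : (rgRow p '' (I : Set (Finset V))) =
      Set.range (fun t : I => rgRow p (t : Finset V)) := by
    ext f
    simp
  rw [hset]

theorem rg_exists_generic : ∃ p : V → Fin 4 → ℝ, rgGen p := by
  -- polynomials for rows
  have h1 : ∀ E : Finset (Finset V), ∃ Q : MvPolynomial (V × Fin 4) ℝ, Q ≠ 0 ∧
      ∀ q p : V → Fin 4 → ℝ, LinearIndependent ℝ (fun e : E => rgRow q e) →
      MvPolynomial.eval (fun s : V × Fin 4 => p s.1 s.2) Q ≠ 0 →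
      LinearIndependent ℝ (fun e : E => rgRow p e) := by
    intro E
    obtain ⟨Q, hQ, h⟩ := rg_generic_family (fun (e : E) (k : V × Fin 4) => rgRowPoly (e : Finset V) k)
    refine ⟨Q, hQ, fun q p hq hp => ?_⟩
    rw [rgRow_li_iff] at hq ⊢
    exact h _ _ hq hp
  have h2 : ∀ S : Finset V, ∃ Q : MvPolynomial (V × Fin 4) ℝ, Q ≠ 0 ∧
      ∀ p : V → Fin 4 → ℝ, S.card ≤ 5 →
      MvPolynomial.eval (fun s : V × Fin 4 => p s.1 s.2) Q ≠ 0 →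
      ∀ w : V → ℝ, ∑ x ∈ S, w x = 0 → ∑ x ∈ S, w x • p x = 0 → ∀ x ∈ S, w x = 0 := by
    intro S
    obtain ⟨Q, hQ, h⟩ := rg_generic_family (σ := V × Fin 4) (fun (x : S) (k : Option (Fin 4)) =>
      match k with
      | none => 1
      | some i => MvPolynomial.X ((x : V), i))
    refine ⟨Q, hQ, fun p hS hp w hw0 hw1 x hx => ?_⟩
    have hcard : Fintype.card S ≤ Fintype.card (Option (Fin 4)) := by simpa using hS
    obtain ⟨φ⟩ := Function.Embedding.nonempty_of_card_le hcard
    have hq : LinearIndependent ℝ (fun (x : S) (k : Option (Fin 4)) =>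
        MvPolynomial.eval (fun s : V × Fin 4 =>
          if h : s.1 ∈ S then (if φ ⟨s.1, h⟩ = some s.2 then (1 : ℝ) else 0) else 0)
          ((match k with
            | none => 1
            | some i => MvPolynomial.X ((x : V), i)) : MvPolynomial (V × Fin 4) ℝ)) := by
      rw [Fintype.linearIndependent_iff]
      intro g hg
      have hsome : ∀ y : S, φ y ≠ none → g y = 0 := by
        intro y hy
        obtain ⟨i, hi⟩ := Option.ne_none_iff_exists'.1 hy
        have := congrFun hg (some i)
        simp only [Finset.sum_apply, Pi.smul_apply, MvPolynomial.eval_X, smul_eq_mul,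
          Pi.zero_apply] at this
        rw [Finset.sum_eq_single y] at this
        · simpa [hi] using this
        · intro z _ hz
          have : φ z ≠ some i := fun h => hz (φ.injective (h.trans hi.symm))
          simp [this]
        · simp
      intro y
      by_cases hy : φ y = none
      · have := congrFun hg none
        simp only [Finset.sum_apply, Pi.smul_apply, smul_eq_mul,
          Pi.zero_apply, map_one, mul_one] at this
        rw [Finset.sum_eq_single y] at this
        · exact this
        · intro z _ hz
          exact hsome z (fun h => hz (φ.injective (h.trans hy.symm)))
        · simp
      · exact hsome y hy
    have hli := h _ _ hq hp
    rw [Fintype.linearIndependent_iff] at hli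
    refine hli (fun y => w y) ?_ ⟨x, hx⟩
    funext k
    rw [Finset.sum_apply]
    cases k with
    | none =>
      simp only [Pi.smul_apply, map_one, smul_eq_mul, mul_one, Pi.zero_apply]
      rw [← hw0]
      exact Finset.sum_coe_sort S w
    | some i =>
      simp only [Pi.smul_apply, MvPolynomial.eval_X, smul_eq_mul, Pi.zero_apply]
      have := congrFun hw1 i
      rw [Finset.sum_apply] at this
      rw [Finset.sum_coe_sort S (fun x => w x * p x i)]
      simpa using this
  choose Q1 hQ1 hQ1' using h1
  choose Q2 hQ2 hQ2' using h2
  have hprod : (∏ E : Finset (Finset V), Q1 E) * (∏ S : Finset V, Q2 S) ≠ 0 :=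
    mul_ne_zero (Finset.prod_ne_zero_iff.2 (fun E _ => hQ1 E))
      (Finset.prod_ne_zero_iff.2 (fun S _ => hQ2 S))
  obtain ⟨P, hP⟩ : ∃ P : V × Fin 4 → ℝ, MvPolynomial.eval P
      ((∏ E : Finset (Finset V), Q1 E) * (∏ S : Finset V, Q2 S)) ≠ 0 := by
    by_contra! hcon
    exact hprod (MvPolynomial.funext (fun x => by rw [hcon x, map_zero]))
  rw [map_mul, map_prod, map_prod] at hP
  have hP1 := fun E => Finset.prod_ne_zero_iff.1 (left_ne_zero_of_mul hP) E (Finset.mem_univ _)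
  have hP2 := fun S => Finset.prod_ne_zero_iff.1 (right_ne_zero_of_mul hP) S (Finset.mem_univ _)
  refine ⟨fun v i => P (v, i), fun S hS => hQ2' S _ hS (hP2 S), fun E q => ?_⟩
  obtain ⟨I, hIE, hli, hsp⟩ := rg_indep_subset (rgRow q) E
  have hli2 := hQ1' I q (fun v i => P (v, i)) hli (hP1 I)
  have hc : rgRk q (E : Set (Finset V)) = I.card := by
    rw [← rgRk_of_li q I hli]
    unfold rgRk rgSp
    rw [hsp]
  rw [hc, ← rgRk_of_li _ I hli2]
  exact rgRk_mono _ hIE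

/-! ### Rigidity versus rank, vertex splitting -/

theorem rgRig_mono {p : V → Fin 4 → ℝ} {E F : Set (Finset V)} {S T : Finset V}
    (h : rgRig p E S) (hEF : E ⊆ F) (hTS : T ⊆ S) : rgRig p F T :=
  fun x hx y hy => rgSp_mono p hEF (h x (hTS hx) y (hTS hy))

theorem rgSp_complete_le {p : V → Fin 4 → ℝ} {E : Set (Finset V)} {S : Finset V}
    (h : rgRig p E S) : rgSp p (S.powersetCard 2 : Finset (Finset V)) ≤ rgSp p E := by
  unfold rgSp
  rw [Submodule.span_le]
  rintro _ ⟨e, he, rfl⟩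
  obtain ⟨heS, hc⟩ := Finset.mem_powersetCard.1 (Finset.mem_coe.1 he)
  obtain ⟨x, y, hxy, rfl⟩ := Finset.card_eq_two.1 hc
  exact h x (heS (by simp)) y (heS (by simp))

theorem rgRk_of_rig {p : V → Fin 4 → ℝ} (hp : rgGP p) {E : Set (Finset V)} {S : Finset V}
    (hS : 4 ≤ S.card) (h : rgRig p E S) : 4 * S.card ≤ rgRk p E + 10 := by
  rw [← rgRk_complete hp S hS]
  have := Submodule.finrank_mono (rgSp_complete_le h)
  unfold rgRk
  omega

theorem rgRig_of_rk {p : V → Fin 4 → ℝ} (hp : rgGP p) {E : Finset (Finset V)} {S : Finset V}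
    (hS : 4 ≤ S.card) (hE : E ⊆ S.powersetCard 2)
    (h : 4 * S.card ≤ rgRk p (E : Set (Finset V)) + 10) : rgRig p (E : Set (Finset V)) S := by
  rw [← rgRk_complete hp S hS] at h
  have hle : rgSp p (E : Set (Finset V)) ≤ rgSp p (S.powersetCard 2 : Finset (Finset V)) :=
    rgSp_mono p (Finset.coe_subset.2 hE)
  have heq := Submodule.eq_of_le_of_finrank_le hle (by unfold rgRk at h; omega)
  intro x hx y hy
  rw [heq]
  by_cases hxy : x = y
  · subst hxy
    rw [rgRow_self]; exact Submodule.zero_mem _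
  · apply rgRow_mem
    rw [Finset.mem_coe, Finset.mem_powersetCard]
    refine ⟨?_, Finset.card_pair hxy⟩
    intro w hw
    simp only [Finset.mem_insert, Finset.mem_singleton] at hw
    rcases hw with rfl | rfl <;> assumption

theorem rgRow_congr {p q : V → Fin 4 → ℝ} {e : Finset V} (h : ∀ x ∈ e, p x = q x) :
    rgRow p e = rgRow q e := by
  unfold rgRow
  funext w
  split_ifs with hw
  · exact Finset.sum_congr rfl (fun z hz => by rw [h w hw, h z hz])
  · rfl

/-- The displacement `y` at `v` and `-y` at `u`. -/
def rgD (u v : V) : (Fin 4 → ℝ) →ₗ[ℝ] (V → Fin 4 → ℝ) :=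
  LinearMap.single ℝ (fun _ : V => Fin 4 → ℝ) v - LinearMap.single ℝ (fun _ : V => Fin 4 → ℝ) u

theorem rgD_apply (u v : V) (y : Fin 4 → ℝ) :
    rgD u v y = Pi.single v y - Pi.single u y := rfl

theorem rgD_v {u v : V} (h : u ≠ v) (y : Fin 4 → ℝ) : rgD u v y v = y := by
  rw [rgD_apply]
  simp [Pi.single_apply, h, h.symm]

theorem rg_split {p : V → Fin 4 → ℝ} (hp : rgGen p) {S' : Finset V} {u v : V}
    (hu : u ∈ S') (hv : v ∉ S') (h5 : 5 ≤ S'.card) {E' E : Finset (Finset V)}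
    (hrig : rgRig p (E' : Set (Finset V)) S') (hE' : E' ⊆ S'.powersetCard 2)
    (hE : E ⊆ (insert v S').powersetCard 2) (huv : ({u, v} : Finset V) ∈ E)
    {T : Finset V} (hT : T.card = 3) (hTS : T ⊆ S') (huT : u ∉ T)
    (hTE : ∀ x ∈ T, ({u, x} : Finset V) ∈ E ∧ ({v, x} : Finset V) ∈ E)
    (htr : ∀ e ∈ E', e ∈ E ∨ ∃ x, e = {u, x} ∧ ({v, x} : Finset V) ∈ E) :
    rgRig p (E : Set (Finset V)) (insert v S') := by
  have huv' : u ≠ v := fun h => hv (h ▸ hu)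
  obtain ⟨d, hdS, hd⟩ : ∃ d ∈ S', d ∉ insert u T := by
    by_contra! hcon
    have := Finset.card_le_card (show S' ⊆ insert u T from hcon)
    have := Finset.card_insert_le u T
    omega
  rw [Finset.mem_insert, not_or] at hd
  set z : Fin 4 → ℝ := p u - p d with hz
  let q : ℝ → V → Fin 4 → ℝ := fun ε => Function.update p v (p u + ε • z)
  let R : ℝ → Finset V → V → Fin 4 → ℝ := fun ε e =>
    if e = {u, v} then rgD u v z else rgRow (q ε) e
  have hqv : ∀ ε, q ε v = p u + ε • z := fun ε => by simp [q]
  have hqn : ∀ ε x, x ≠ v → q ε x = p x := fun ε x hx => by simp [q, hx]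
  have hrowuv : ∀ ε, rgRow (q ε) {u, v} = ε • rgD u v z := by
    intro ε
    rw [rgRow_pair, hqv, hqn ε u huv', rgD_apply]
    have h1 : p u - (p u + ε • z) = - (ε • z) := by abel
    have h2 : (p u + ε • z) - p u = ε • z := by abel
    rw [h1, h2, Pi.single_neg, Pi.single_smul, Pi.single_smul, smul_sub]
    abel
  -- span at 0
  set W := Submodule.span ℝ (R 0 '' (E : Set (Finset V))) with hW
  have hmemW : ∀ e ∈ E, R 0 e ∈ W := fun e he => Submodule.subset_span ⟨e, he, rfl⟩
  have hpairne : ∀ x, x ≠ v → ({u, x} : Finset V) ≠ {u, v} := by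
    intro x hx h
    have : v ∈ ({u, x} : Finset V) := by rw [h]; simp
    simp only [Finset.mem_insert, Finset.mem_singleton] at this
    rcases this with h | h
    · exact huv' h.symm
    · exact hx h.symm
  have hpairne2 : ∀ x, x ≠ u → ({v, x} : Finset V) ≠ {u, v} := by
    intro x hx h
    have : u ∈ ({v, x} : Finset V) := by rw [h]; simp
    simp only [Finset.mem_insert, Finset.mem_singleton] at this
    rcases this with h | h
    · exact huv' h
    · exact hx h.symm
  have hq0 : q 0 v = p u := by rw [hqv]; simp
  -- rows at 0
  have hR0v : ∀ x, x ≠ u → x ≠ v → R 0 {v, x} = rgRow p {u, x} + rgD u v (p u - p x) := by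
    intro x hxu hxv
    simp only [R, if_neg (hpairne2 x hxu)]
    rw [rgRow_pair, rgRow_pair, hq0, hqn 0 x hxv, rgD_apply]
    abel
  have hR0 : ∀ e, v ∉ e → R 0 e = rgRow p e := by
    intro e he
    have : e ≠ {u, v} := fun h => he (by rw [h]; simp)
    simp only [R, if_neg this]
    exact rgRow_congr (fun x hx => hqn 0 x (fun h => he (h ▸ hx)))
  have hDx : ∀ x ∈ insert d T, rgD u v (p u - p x) ∈ W := by
    intro x hx
    rw [Finset.mem_insert] at hx
    rcases hx with rfl | hx
    · have := hmemW _ huv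
      simpa only [R, if_pos] using this
    · have hxu : x ≠ u := fun h => huT (h ▸ hx)
      have hxv : x ≠ v := fun h => hv (h ▸ hTS hx)
      have h1 := hmemW _ (hTE x hx).1
      have h2 := hmemW _ (hTE x hx).2
      rw [hR0v x hxu hxv] at h2
      rw [hR0 _ (by simp [hxv.symm, huv'.symm])] at h1
      have := Submodule.sub_mem _ h2 h1
      rwa [add_sub_cancel_left] at this
  have hD : LinearMap.range (rgD u v) ≤ W := by
    rw [LinearMap.range_le_iff_comap, eq_top_iff]
    have hli : LinearIndependent ℝ (fun x : (insert d T : Finset V) => p u - p x) := by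
      rw [Fintype.linearIndependent_iff]
      intro g hg x
      let w : V → ℝ := fun y => if h : y ∈ insert d T then g ⟨y, h⟩ else 0
      have hwg : ∀ y : (insert d T : Finset V), w y = g y := fun y => by
        simp only [w]; rw [dif_pos y.2]
      have hun : u ∉ insert d T := by
        rw [Finset.mem_insert, not_or]; exact ⟨fun h => hd.1 h.symm, huT⟩
      have hcard : (insert d T).card ≤ 4 := by
        rw [Finset.card_insert_of_notMem hd.2, hT]
      have := rg_star_inj hp.1 u (insert d T) hun hcard w (by
        rw [← hg, ← Finset.sum_coe_sort]
        exact Finset.sum_congr rfl (fun y _ => by rw [hwg])) x x.2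
      rw [← hwg]; exact this
    have hspan := hli.span_eq_top_of_card_eq_finrank' (by
      rw [Fintype.card_coe, Finset.card_insert_of_notMem hd.2, hT]; simp)
    rw [← hspan, Submodule.span_le]
    rintro _ ⟨x, rfl⟩
    exact hDx x x.2
  have hE'v : ∀ e ∈ E', v ∉ e := fun e he h =>
    hv ((Finset.mem_powersetCard.1 (hE' he)).1 h)
  have hE'W : rgSp p (E' : Set (Finset V)) ≤ W := by
    unfold rgSp
    rw [Submodule.span_le]
    rintro _ ⟨e, he, rfl⟩
    rcases htr e he with h | ⟨x, rfl, h⟩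
    · have := hmemW e h
      rwa [hR0 e (hE'v e he)] at this
    · have hxv : x ≠ v := fun h => hE'v _ he (by rw [h]; simp)
      have hxu : x ≠ u := by
        rintro rfl
        have := (Finset.mem_powersetCard.1 (hE' he)).2
        simp at this
      have h2 := hmemW _ h
      rw [hR0v x hxu hxv] at h2
      have := Submodule.sub_mem _ h2 (hD ⟨p u - p x, rfl⟩)
      rwa [add_sub_cancel_right] at this
  have hrank : 4 * S'.card ≤ Module.finrank ℝ W + 6 := by
    have h1 := rg_disjoint_rank (rgSp p (E' : Set (Finset V))) (LinearMap.range (rgD u v)) v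
      (rgSp_vanish p _ v hE'v) (by
        rintro _ ⟨y, rfl⟩ hy
        rw [rgD_v huv'] at hy
        rw [hy, map_zero])
    have h2 : Module.finrank ℝ (LinearMap.range (rgD u v)) = 4 := by
      rw [LinearMap.finrank_range_of_inj]
      · simp
      · intro y y' h
        have := congrFun h v
        rwa [rgD_v huv', rgD_v huv'] at this
    have h3 := Submodule.finrank_mono (sup_le hE'W hD)
    have h4 := rgRk_of_rig hp.1 (by omega) hrig
    unfold rgRk at h4
    omega
  obtain ⟨I, hIE, hli, hsp⟩ := rg_indep_subset (R 0) E
  have hcardI : Module.finrank ℝ W = I.card := by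
    have := finrank_span_eq_card hli
    rw [Fintype.card_coe] at this
    rw [← this, hW, ← hsp]
    have hset : (R 0 '' (I : Set (Finset V))) = Set.range (fun t : I => R 0 (t : Finset V)) := by
      ext f
      simp
    rw [hset]
  have hcont : Continuous (fun ε : ℝ => fun x : I => R ε x) := by
    refine continuous_pi (fun x => ?_)
    simp only [R]
    split_ifs
    · exact continuous_const
    · have hqc : ∀ w, Continuous (fun ε => q ε w) := by
        intro w
        by_cases hw : w = v
        · subst hw
          simp only [hqv]
          fun_prop
        · simp only [hqn _ w hw]
          exact continuous_const
      unfold rgRow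
      refine continuous_pi (fun w => ?_)
      split_ifs
      · exact continuous_finset_sum _ (fun z _ => (hqc w).sub (hqc z))
      · exact continuous_const
  have hopen : IsOpen {ε : ℝ | LinearIndependent ℝ (fun x : I => R ε x)} :=
    (isOpen_setOf_linearIndependent (𝕜 := ℝ) (ι := I) (E := V → Fin 4 → ℝ)).preimage hcont
  obtain ⟨δ, hδ, hball⟩ := Metric.isOpen_iff.1 hopen 0 hli
  have hli2 : LinearIndependent ℝ (fun x : I => R (δ / 2) x) := by
    apply hball
    rw [Metric.mem_ball, dist_zero_right, Real.norm_eq_abs, abs_of_pos (by positivity)]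
    linarith
  have hδ2 : δ / 2 ≠ 0 := by positivity
  have hcard2 := finrank_span_eq_card hli2
  rw [Fintype.card_coe] at hcard2
  have hle : Submodule.span ℝ (Set.range (fun x : I => R (δ / 2) x)) ≤
      rgSp (q (δ / 2)) (E : Set (Finset V)) := by
    rw [Submodule.span_le]
    rintro _ ⟨x, rfl⟩
    have hx := rgRow_mem (q (δ / 2)) (E := (E : Set (Finset V))) (hIE x.2)
    simp only [R]
    split_ifs with h
    · rw [h, hrowuv] at hx
      have := Submodule.smul_mem _ (δ / 2)⁻¹ hx
      rwa [inv_smul_smul₀ hδ2] at this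
    · exact hx
  have h6 := Submodule.finrank_mono hle
  have h7 := hp.2 E (q (δ / 2))
  unfold rgRk at h7
  apply rgRig_of_rk hp.1 _ hE
  · rw [Finset.card_insert_of_notMem hv]
    unfold rgRk
    omega
  · rw [Finset.card_insert_of_notMem hv]; omega

/-! ### Chains modulo two -/

theorem z2_ne {x : ZMod 2} (h : x ≠ 0) : x = 1 := by
  revert h; revert x; decide

theorem z2_add_self (x : ZMod 2) : x + x = 0 := by
  revert x; decide

theorem z2_add_self_fun (c : Finset V → ZMod 2) : c + c = 0 := by
  funext σ; exact z2_add_self _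

theorem z2_add_add (b c : Finset V → ZMod 2) : b + (c + b) = c := by
  rw [add_comm c b, ← add_assoc, z2_add_self_fun, zero_add]

/-- `b` is a subchain of `c`. -/
def chSub (b c : Finset V → ZMod 2) : Prop := ∀ σ, b σ ≠ 0 → c σ ≠ 0

theorem chSub.refl (c : Finset V → ZMod 2) : chSub c c := fun _ h => h

theorem chSub.trans {a b c : Finset V → ZMod 2} (h : chSub a b) (h' : chSub b c) : chSub a c :=
  fun σ hσ => h' σ (h σ hσ)

theorem chSub.add {a b c : Finset V → ZMod 2} (h : chSub a c) (h' : chSub b c) :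
    chSub (a + b) c := by
  intro σ hσ hc
  apply hσ
  have h1 : a σ = 0 := by by_contra h0; exact h σ h0 hc
  have h2 : b σ = 0 := by by_contra h0; exact h' σ h0 hc
  rw [Pi.add_apply, h1, h2, add_zero]

theorem chSub.compl {b c : Finset V → ZMod 2} (h : chSub b c) : chSub (c + b) c :=
  (chSub.refl c).add h

theorem chSub.eq_of {b c : Finset V → ZMod 2} (h : chSub b c) {σ} (hb : b σ ≠ 0) : b σ = c σ := by
  rw [z2_ne hb, z2_ne (h σ hb)]

/-- Support of a chain. -/
def chSupp (c : Finset V → ZMod 2) : Finset (Finset V) := Finset.univ.filter (fun σ => c σ ≠ 0)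

theorem mem_chSupp {c : Finset V → ZMod 2} {σ : Finset V} : σ ∈ chSupp c ↔ c σ ≠ 0 := by
  simp [chSupp]

theorem chSupp_subset {b c : Finset V → ZMod 2} : chSupp b ⊆ chSupp c ↔ chSub b c := by
  constructor
  · intro h σ hσ; exact mem_chSupp.1 (h (mem_chSupp.2 hσ))
  · intro h σ hσ; exact mem_chSupp.2 (h σ (mem_chSupp.1 hσ))

theorem chSub.antisymm {b c : Finset V → ZMod 2} (h : chSub b c) (h' : chSub c b) : b = c := by
  funext σ
  by_cases hb : b σ = 0
  · by_cases hc : c σ = 0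
    · rw [hb, hc]
    · exact absurd hb (h' σ hc)
  · exact h.eq_of hb

theorem chSupp_card_lt {b c : Finset V → ZMod 2} (h : chSub b c) (hne : b ≠ c) :
    (chSupp b).card < (chSupp c).card := by
  apply Finset.card_lt_card
  refine ⟨chSupp_subset.2 h, fun h' => hne (h.antisymm (chSupp_subset.1 h'))⟩

/-- Minimal nonzero elements of a class of chains. -/
def chMin (P : (Finset V → ZMod 2) → Prop) (b : Finset V → ZMod 2) : Prop :=
  P b ∧ b ≠ 0 ∧ ∀ b', P b' → b' ≠ 0 → chSub b' b → b' = b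

theorem ch_decomp {P Q : (Finset V → ZMod 2) → Prop}
    (hP : ∀ a b, P a → P b → P (a + b)) (hQ0 : Q 0) (hQ : ∀ a b, Q a → Q b → Q (a + b))
    (r : Finset V → ZMod 2) (hr : P r) (hmin : ∀ b, chMin P b → chSub b r → Q b) : Q r := by
  induction hn : (chSupp r).card using Nat.strong_induction_on generalizing r with
  | _ n ih =>
    by_cases h0 : r = 0
    · rw [h0]; exact hQ0
    by_cases hm : chMin P r
    · exact hmin r hm (chSub.refl r)
    have : ∃ b', P b' ∧ b' ≠ 0 ∧ chSub b' r ∧ b' ≠ r := by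
      by_contra! hcon
      exact hm ⟨hr, h0, hcon⟩
    obtain ⟨b, hb, hb0, hbr, hbne⟩ := this
    have hs2 : chSub (r + b) r := hbr.compl
    have hne2 : r + b ≠ r := fun h => hb0 (by simpa using h)
    have h1 := ih _ (hn ▸ chSupp_card_lt hbr hbne) b hb
      (fun a ha hab => hmin a ha (hab.trans hbr)) rfl
    have h2 := ih _ (hn ▸ chSupp_card_lt hs2 hne2) (r + b) (hP _ _ hr hb)
      (fun a ha hab => hmin a ha (hab.trans hs2)) rfl
    have := hQ _ _ h1 h2
    rwa [z2_add_add] at this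

theorem ch_exists_min {P : (Finset V → ZMod 2) → Prop} (hP : ∀ a b, P a → P b → P (a + b))
    (F : (Finset V → ZMod 2) → ZMod 2) (hF : ∀ a b, F (a + b) = F a + F b)
    (r : Finset V → ZMod 2) (hr : P r) (hFr : F r ≠ 0) :
    ∃ b, chMin P b ∧ chSub b r ∧ F b ≠ 0 := by
  by_contra! hcon
  refine hFr (ch_decomp (Q := fun b => F b = 0) hP ?_ ?_ r hr (fun b hb hbr => hcon b hb hbr))
  · have := hF 0 0
    rw [add_zero] at this
    simpa using this
  · intro a b ha hb
    rw [hF, ha, hb, add_zero]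

/-- Boundary of a chain. -/
def chBd (c : Finset V → ZMod 2) (τ : Finset V) : ZMod 2 :=
  ∑ x, if x ∈ τ then 0 else c (insert x τ)

theorem chBd_add (b c : Finset V → ZMod 2) (τ : Finset V) :
    chBd (b + c) τ = chBd b τ + chBd c τ := by
  unfold chBd
  rw [← Finset.sum_add_distrib]
  refine Finset.sum_congr rfl (fun x _ => ?_)
  split_ifs <;> simp

theorem chBd_chBd (c : Finset V → ZMod 2) (τ : Finset V) : chBd (chBd c) τ = 0 := by
  unfold chBd
  have h1 : ∀ x : V, (if x ∈ τ then (0 : ZMod 2) else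
      ∑ y, if y ∈ insert x τ then 0 else c (insert y (insert x τ))) =
      ∑ y, if x ∈ τ ∨ y ∈ τ ∨ x = y then 0 else c (insert y (insert x τ)) := by
    intro x
    split_ifs with hx
    · simp [hx]
    · refine Finset.sum_congr rfl (fun y _ => ?_)
      by_cases hyx : y = x
      · simp [hyx]
      · have : ¬ x = y := fun h => hyx h.symm
        simp [hx, hyx, this]
  rw [Finset.sum_congr rfl (fun x _ => h1 x), ← Finset.sum_product']
  refine Finset.sum_involution (fun z _ => (z.2, z.1)) ?_ ?_ ?_ ?_
  · rintro ⟨x, y⟩ _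
    simp only
    by_cases hx : x ∈ τ
    · simp [hx]
    by_cases hy : y ∈ τ
    · simp [hy]
    by_cases hxy : x = y
    · simp [hxy]
    have hyx : ¬ y = x := fun h => hxy h.symm
    simp only [hx, hy, hxy, hyx, or_self, if_false]
    rw [Finset.insert_comm]
    exact z2_add_self _
  · rintro ⟨x, y⟩ _ h heq
    apply h
    simp only [Prod.mk.injEq] at heq
    simp [heq.1]
  · intros; simp
  · intros; rfl

/-- 3-dimensional cycles mod two. -/
def chCyc (c : Finset V → ZMod 2) : Prop :=
  (∀ σ, c σ ≠ 0 → σ.card = 4) ∧ ∀ τ, chBd c τ = 0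

theorem chCyc.add {b c : Finset V → ZMod 2} (hb : chCyc b) (hc : chCyc c) : chCyc (b + c) := by
  refine ⟨fun σ hσ => ?_, fun τ => by rw [chBd_add, hb.2, hc.2, add_zero]⟩
  by_cases h : b σ = 0
  · apply hc.1
    intro h'
    apply hσ
    rw [Pi.add_apply, h, h', add_zero]
  · exact hb.1 σ h

/-- Vertices of a chain. -/
def chV (c : Finset V → ZMod 2) : Finset V := Finset.univ.filter (fun x => ∃ σ, c σ ≠ 0 ∧ x ∈ σ)

theorem mem_chV {c : Finset V → ZMod 2} {x : V} : x ∈ chV c ↔ ∃ σ, c σ ≠ 0 ∧ x ∈ σ := by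
  simp [chV]

/-- Edges of a chain. -/
def chE (c : Finset V → ZMod 2) : Finset (Finset V) :=
  Finset.univ.filter (fun e => e.card = 2 ∧ ∃ σ, c σ ≠ 0 ∧ e ⊆ σ)

theorem mem_chE {c : Finset V → ZMod 2} {e : Finset V} :
    e ∈ chE c ↔ e.card = 2 ∧ ∃ σ, c σ ≠ 0 ∧ e ⊆ σ := by
  simp [chE]

theorem pair_mem_chE {c : Finset V → ZMod 2} {x y : V} {σ : Finset V} (hσ : c σ ≠ 0)
    (hx : x ∈ σ) (hy : y ∈ σ) (hxy : x ≠ y) : ({x, y} : Finset V) ∈ chE c :=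
  mem_chE.2 ⟨Finset.card_pair hxy, σ, hσ, by
    intro z hz
    simp only [Finset.mem_insert, Finset.mem_singleton] at hz
    rcases hz with rfl | rfl <;> assumption⟩

theorem chE_subset (c : Finset V → ZMod 2) : chE c ⊆ (chV c).powersetCard 2 := by
  intro e he
  obtain ⟨h2, σ, hσ, heσ⟩ := mem_chE.1 he
  exact Finset.mem_powersetCard.2 ⟨fun x hx => mem_chV.2 ⟨σ, hσ, heσ hx⟩, h2⟩

theorem chV_subset_of {c : Finset V → ZMod 2} {σ : Finset V} (h : c σ ≠ 0) : σ ⊆ chV c :=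
  fun _ hx => mem_chV.2 ⟨σ, h, hx⟩

theorem chV_mono {b c : Finset V → ZMod 2} (h : chSub b c) : chV b ⊆ chV c := by
  intro x hx
  obtain ⟨σ, hσ, hxσ⟩ := mem_chV.1 hx
  exact mem_chV.2 ⟨σ, h σ hσ, hxσ⟩

theorem chE_mono {b c : Finset V → ZMod 2} (h : chSub b c) : chE b ⊆ chE c := by
  intro e he
  obtain ⟨h2, σ, hσ, hxσ⟩ := mem_chE.1 he
  exact mem_chE.2 ⟨h2, σ, h σ hσ, hxσ⟩

theorem chV_add (b c : Finset V → ZMod 2) : chV (b + c) ⊆ chV b ∪ chV c := by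
  intro x hx
  obtain ⟨σ, hσ, hxσ⟩ := mem_chV.1 hx
  rw [Finset.mem_union]
  by_cases h : b σ = 0
  · right
    refine mem_chV.2 ⟨σ, fun h' => hσ ?_, hxσ⟩
    rw [Pi.add_apply, h, h', add_zero]
  · exact Or.inl (mem_chV.2 ⟨σ, h, hxσ⟩)

theorem chE_add (b c : Finset V → ZMod 2) : chE (b + c) ⊆ chE b ∪ chE c := by
  intro e he
  obtain ⟨h2, σ, hσ, hxσ⟩ := mem_chE.1 he
  rw [Finset.mem_union]
  by_cases h : b σ = 0
  · right
    refine mem_chE.2 ⟨h2, σ, fun h' => hσ ?_, hxσ⟩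
    rw [Pi.add_apply, h, h', add_zero]
  · exact Or.inl (mem_chE.2 ⟨h2, σ, h, hxσ⟩)

/-- In a cycle, a facet has another facet across each ridge. -/
theorem chCyc.other {c : Finset V → ZMod 2} (hc : chCyc c) {τ : Finset V} {x : V} (hx : x ∉ τ)
    (h : c (insert x τ) ≠ 0) : ∃ y, y ≠ x ∧ y ∉ τ ∧ c (insert y τ) ≠ 0 := by
  by_contra! hcon
  have h1 := hc.2 τ
  unfold chBd at h1
  rw [Finset.sum_eq_single x] at h1
  · rw [if_neg hx] at h1; exact h h1
  · intro y _ hy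
    split_ifs with hyt
    · rfl
    · exact hcon y hy hyt
  · simp

theorem chCyc.five {c : Finset V → ZMod 2} (hc : chCyc c) (h0 : c ≠ 0) : 5 ≤ (chV c).card := by
  obtain ⟨σ, hσ⟩ : ∃ σ, c σ ≠ 0 := by
    by_contra! h; exact h0 (funext h)
  have h4 := hc.1 σ hσ
  obtain ⟨x, hx⟩ : σ.Nonempty := by rw [← Finset.card_pos]; omega
  obtain ⟨y, hyx, hyt, hy⟩ := hc.other (τ := σ.erase x) (x := x) (by simp)
    (by rwa [Finset.insert_erase hx])
  have hyσ : y ∉ σ := fun h => hyt (Finset.mem_erase.2 ⟨hyx, h⟩)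
  have : insert y σ ⊆ chV c := by
    rw [Finset.insert_subset_iff]
    exact ⟨chV_subset_of hy (by simp), chV_subset_of hσ⟩
  have := Finset.card_le_card this
  rw [Finset.card_insert_of_notMem hyσ] at this
  omega

theorem chV_nonempty {c : Finset V → ZMod 2} (hc : chCyc c) (h0 : c ≠ 0) :
    ∃ u v, u ≠ v ∧ ∃ σ, c σ ≠ 0 ∧ u ∈ σ ∧ v ∈ σ := by
  obtain ⟨σ, hσ⟩ : ∃ σ, c σ ≠ 0 := by
    by_contra! h; exact h0 (funext h)
  have h4 := hc.1 σ hσ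
  obtain ⟨u, hu, v, hv, huv⟩ := Finset.one_lt_card.1 (show 1 < σ.card by omega)
  exact ⟨u, v, huv, σ, hσ, hu, hv⟩

/-! ### Contraction of an edge -/

/-- Boundary of a simplex on five vertices. -/
def chSim (Δ : Finset V) (σ : Finset V) : ZMod 2 := if σ ⊆ Δ ∧ σ.card = 4 then 1 else 0

/-- No facet contains both `u` and `v`. -/
def chNd (u v : V) (b : Finset V → ZMod 2) : Prop := ∀ σ, u ∈ σ → v ∈ σ → b σ = 0

/-- The part of a chain not containing the edge. -/
def chNdPart (u v : V) (c : Finset V → ZMod 2) (σ : Finset V) : ZMod 2 :=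
  if u ∈ σ ∧ v ∈ σ then 0 else c σ

/-- Contraction of `v` to `u`. -/
def chCt (u v : V) (b : Finset V → ZMod 2) (σ : Finset V) : ZMod 2 :=
  if v ∈ σ then 0 else if u ∈ σ then b σ + b (insert v (σ.erase u)) else b σ

/-- Filling. -/
def chK (u v : V) (b : Finset V → ZMod 2) (σ : Finset V) : ZMod 2 :=
  if u ∈ σ ∧ v ∈ σ then chBd b (σ.erase v) else 0

/-- Completed chain. -/
def chPl (u v : V) (b : Finset V → ZMod 2) : Finset V → ZMod 2 := b + chK u v b

theorem chCt_add (u v : V) (a b : Finset V → ZMod 2) :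
    chCt u v (a + b) = chCt u v a + chCt u v b := by
  funext σ
  simp only [chCt, Pi.add_apply]
  split_ifs
  · simp
  · ring
  · rfl

theorem chPl_add (u v : V) (a b : Finset V → ZMod 2) :
    chPl u v (a + b) = chPl u v a + chPl u v b := by
  funext σ
  simp only [chPl, chK, Pi.add_apply]
  split_ifs
  · rw [chBd_add]; ring
  · ring

/-- Admissible chains. -/
def chAdm (u v : V) (b : Finset V → ZMod 2) : Prop :=
  chNd u v b ∧ (∀ σ, b σ ≠ 0 → σ.card = 4) ∧ chCyc (chCt u v b)

theorem chAdm.add {u v : V} {a b : Finset V → ZMod 2} (ha : chAdm u v a) (hb : chAdm u v b) :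
    chAdm u v (a + b) := by
  refine ⟨fun σ h1 h2 => ?_, fun σ hσ => ?_, ?_⟩
  · rw [Pi.add_apply, ha.1 σ h1 h2, hb.1 σ h1 h2, add_zero]
  · by_cases h : a σ = 0
    · apply hb.2.1
      intro h'
      apply hσ
      rw [Pi.add_apply, h, h', add_zero]
    · exact ha.2.1 σ h
  · rw [chCt_add]; exact ha.2.2.add hb.2.2

theorem chCt_bd1 {u v : V} (huv : u ≠ v) {b : Finset V → ZMod 2} (hnd : chNd u v b)
    {H : Finset V} (hu : u ∉ H) (hv : v ∉ H) :
    chBd (chCt u v b) (insert u H) = chBd b (insert u H) + chBd b (insert v H) := by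
  unfold chBd
  rw [← Finset.sum_add_distrib]
  refine Finset.sum_congr rfl (fun x _ => ?_)
  by_cases hxH : x ∈ H
  · simp [hxH]
  by_cases hxu : x = u
  · subst hxu
    have : b (insert x (insert v H)) = 0 := hnd _ (by simp) (by simp)
    simp [this]
  by_cases hxv : x = v
  · subst hxv
    have : b (insert x (insert u H)) = 0 := hnd _ (by simp) (by simp)
    simp [this, chCt]
  have h1 : x ∉ insert u H := by simp [hxu, hxH]
  have h2 : x ∉ insert v H := by simp [hxv, hxH]
  rw [if_neg h1, if_neg h1, if_neg h2]
  unfold chCt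
  have h3 : v ∉ insert x (insert u H) := by
    simp only [Finset.mem_insert, not_or]
    exact ⟨fun h => hxv h.symm, huv.symm, hv⟩
  rw [if_neg h3, if_pos (by simp)]
  congr 2
  rw [Finset.insert_comm x u, Finset.erase_insert, Finset.insert_comm]
  simp only [Finset.mem_insert, not_or]
  exact ⟨fun h => hxu h.symm, hu⟩

theorem chCt_bd2 {u v : V} (huv : u ≠ v) (b : Finset V → ZMod 2)
    {τ : Finset V} (hu : u ∉ τ) (hv : v ∉ τ) :
    chBd (chCt u v b) τ = chBd b τ := by
  have key : chBd (chCt u v b) τ + chBd b τ = 0 := by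
    unfold chBd
    rw [← Finset.sum_add_distrib, Finset.sum_eq_add u v huv]
    · have h1 : v ∉ insert u τ := by
        simp only [Finset.mem_insert, not_or]; exact ⟨huv.symm, hv⟩
      simp only [hu, hv, if_false, chCt, h1, Finset.mem_insert_self, if_true,
        Finset.erase_insert hu]
      have := z2_add_self (b (insert u τ))
      have := z2_add_self (b (insert v τ))
      linear_combination z2_add_self (b (insert u τ)) + z2_add_self (b (insert v τ))
    · rintro x _ ⟨hxu, hxv⟩
      by_cases hx : x ∈ τ
      · simp [hx]
      · have h1 : v ∉ insert x τ := by
          simp only [Finset.mem_insert, not_or]; exact ⟨fun h => hxv h.symm, hv⟩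
        have h2 : u ∉ insert x τ := by
          simp only [Finset.mem_insert, not_or]; exact ⟨fun h => hxu h.symm, hu⟩
        simp only [hx, if_false, chCt, h1, h2]
        exact z2_add_self _
    · simp
    · simp
  exact (eq_neg_of_add_eq_zero_left key).trans (by
    rw [neg_eq_iff_add_eq_zero]; exact z2_add_self _)

theorem chK_ne {u v : V} {b : Finset V → ZMod 2} {σ : Finset V} (h : chK u v b σ ≠ 0) :
    u ∈ σ ∧ v ∈ σ ∧ chBd b (σ.erase v) ≠ 0 := by
  unfold chK at h
  split_ifs at h with h1
  · exact ⟨h1.1, h1.2, h⟩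
  · exact absurd rfl h

theorem chBd_ne {b : Finset V → ZMod 2} {τ : Finset V} (h : chBd b τ ≠ 0) :
    ∃ x, x ∉ τ ∧ b (insert x τ) ≠ 0 := by
  by_contra! hcon
  apply h
  unfold chBd
  refine Finset.sum_eq_zero (fun x _ => ?_)
  split_ifs with hx
  · rfl
  · exact hcon x hx

theorem chBd_zero_of {b : Finset V → ZMod 2} {τ : Finset V}
    (h : ∀ x, x ∉ τ → b (insert x τ) = 0) : chBd b τ = 0 := by
  by_contra hne
  obtain ⟨x, hx, hb⟩ := chBd_ne hne
  exact hb (h x hx)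

theorem chBd_single {b : Finset V → ZMod 2} {τ : Finset V} {y : V} (hy : y ∉ τ)
    (h : ∀ x, x ∉ τ → x ≠ y → b (insert x τ) = 0) : chBd b τ = b (insert y τ) := by
  unfold chBd
  rw [Finset.sum_eq_single y]
  · rw [if_neg hy]
  · intro x _ hx
    split_ifs with hxt
    · rfl
    · exact h x hxt hx
  · simp

theorem chPl_cyc {u v : V} (huv : u ≠ v) {b : Finset V → ZMod 2} (hb : chAdm u v b) :
    chCyc (chPl u v b) := by
  obtain ⟨hnd, h4, hct⟩ := hb
  constructor
  · intro σ hσ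
    by_cases h : b σ = 0
    · have hk : chK u v b σ ≠ 0 := by
        intro h'; apply hσ; unfold chPl; rw [Pi.add_apply, h, h', add_zero]
      obtain ⟨hu, hv, hne⟩ := chK_ne hk
      obtain ⟨x, hx, hbx⟩ := chBd_ne hne
      have := h4 _ hbx
      rw [Finset.card_insert_of_notMem hx, Finset.card_erase_of_mem hv] at this
      have : 0 < σ.card := Finset.card_pos.2 ⟨v, hv⟩
      omega
    · exact h4 σ h
  · intro τ
    unfold chPl
    rw [chBd_add]
    by_cases hu : u ∈ τ <;> by_cases hv : v ∈ τ
    · have h1 : chBd b τ = 0 := chBd_zero_of (fun x _ => hnd _ (by simp [hu]) (by simp [hv]))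
      rw [h1, zero_add, ← chBd_chBd b (τ.erase v)]
      unfold chBd
      refine Finset.sum_congr rfl (fun x _ => ?_)
      change _ = if x ∈ τ.erase v then 0 else chBd b (insert x (τ.erase v))
      change (if x ∈ τ then 0 else chK u v b (insert x τ)) = _
      by_cases hxv : x = v
      · subst hxv
        simp only [hv, if_true, Finset.notMem_erase, if_false, Finset.insert_erase hv, h1]
      · by_cases hx : x ∈ τ
        · simp [hx, hxv]
        · have h2 : x ∉ τ.erase v := fun h => hx (Finset.mem_of_mem_erase h)
          rw [if_neg hx, if_neg h2]
          unfold chK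
          rw [if_pos ⟨by simp [hu], by simp [hv]⟩]
          congr 1
          rw [Finset.erase_insert_of_ne hxv]
    · rw [chBd_single hv (b := chK u v b)]
      · unfold chK
        rw [if_pos ⟨by simp [hu], by simp⟩, Finset.erase_insert hv]
        exact z2_add_self _
      · intro x hx hxv
        unfold chK
        rw [if_neg]
        rintro ⟨_, h⟩
        simp only [Finset.mem_insert] at h
        rcases h with h | h
        · exact hxv h.symm
        · exact hv h
    · rw [chBd_single hu (b := chK u v b)]
      · unfold chK
        rw [if_pos ⟨by simp, by simp [hv]⟩, Finset.erase_insert_of_ne huv]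
        have h1 : u ∉ τ.erase v := fun h => hu (Finset.mem_of_mem_erase h)
        have := chCt_bd1 huv hnd h1 (Finset.notMem_erase v τ)
        rw [hct.2, Finset.insert_erase hv] at this
        rw [this, add_comm]
      · intro x hx hxu
        unfold chK
        rw [if_neg]
        rintro ⟨h, _⟩
        simp only [Finset.mem_insert] at h
        rcases h with h | h
        · exact hxu h.symm
        · exact hu h
    · rw [← chCt_bd2 huv b hu hv, hct.2, zero_add]
      apply chBd_zero_of
      intro x hx
      unfold chK
      rw [if_neg]
      rintro ⟨h1, h2⟩
      simp only [Finset.mem_insert] at h1 h2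
      rcases h1 with h1 | h1
      · rcases h2 with h2 | h2
        · exact huv (h1.trans h2.symm)
        · exact hv h2
      · exact hu h1

theorem ch_uvzero {u v : V} {c : Finset V → ZMod 2} (hc : chCyc c)
    (h : ∀ σ, c σ ≠ 0 → v ∈ σ) : c = 0 := by
  funext σ
  by_contra hσ
  have hσ' : c σ ≠ 0 := hσ
  have hv := h σ hσ'
  obtain ⟨y, hyv, hyt, hy⟩ := hc.other (τ := σ.erase v) (x := v) (by simp)
    (by rwa [Finset.insert_erase hv])
  have := h _ hy
  simp only [Finset.mem_insert, Finset.notMem_erase, or_false] at this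
  exact hyv this.symm

theorem chPl_nd {u v : V} {b : Finset V → ZMod 2} {σ : Finset V} (h : ¬ (u ∈ σ ∧ v ∈ σ)) :
    chPl u v b σ = b σ := by
  unfold chPl chK
  rw [Pi.add_apply, if_neg h, add_zero]

theorem chPl_unique {u v : V} (huv : u ≠ v) {b c : Finset V → ZMod 2} (hb : chAdm u v b)
    (hc : chCyc c) (h : ∀ σ, ¬ (u ∈ σ ∧ v ∈ σ) → c σ = b σ) : chPl u v b = c := by
  have h0 : chPl u v b + c = 0 := by
    apply ch_uvzero (u := u) (v := v) ((chPl_cyc huv hb).add hc)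
    intro σ hσ
    by_contra hv
    apply hσ
    have : ¬ (u ∈ σ ∧ v ∈ σ) := fun h => hv h.2
    rw [Pi.add_apply, chPl_nd this, h σ this]
    exact z2_add_self _
  have := z2_add_add c (chPl u v b)
  rw [h0, add_zero] at this
  exact this.symm

theorem chCt_card {u v : V} {b : Finset V → ZMod 2} (h4 : ∀ σ, b σ ≠ 0 → σ.card = 4)
    (σ : Finset V) (hσ : chCt u v b σ ≠ 0) : σ.card = 4 := by
  unfold chCt at hσ
  split_ifs at hσ with h1 h2
  · exact absurd rfl hσ
  · by_cases h : b σ = 0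
    · rw [h, zero_add] at hσ
      have := h4 _ hσ
      rw [Finset.card_insert_of_notMem (fun h => h1 (Finset.mem_of_mem_erase h)),
        Finset.card_erase_of_mem h2] at this
      have : 0 < σ.card := Finset.card_pos.2 ⟨u, h2⟩
      omega
    · exact h4 σ h
  · exact h4 σ hσ

theorem chNdPart_adm {u v : V} (huv : u ≠ v) {c : Finset V → ZMod 2} (hc : chCyc c) :
    chAdm u v (chNdPart u v c) := by
  have hnd : chNd u v (chNdPart u v c) := fun σ h1 h2 => by
    unfold chNdPart; rw [if_pos ⟨h1, h2⟩]
  have h4 : ∀ σ, chNdPart u v c σ ≠ 0 → σ.card = 4 := by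
    intro σ hσ
    unfold chNdPart at hσ
    split_ifs at hσ
    · exact absurd rfl hσ
    · exact hc.1 σ hσ
  have hbd : ∀ H : Finset V, ∀ a b : V, a ≠ b → ((a = u ∧ b = v) ∨ (a = v ∧ b = u)) → u ∉ H → v ∉ H →
      chBd (chNdPart u v c) (insert a H) = c (insert b (insert a H)) := by
    intro H a b hab hor hu hv
    have ha : a ∉ H := by rcases hor with ⟨rfl, rfl⟩ | ⟨rfl, rfl⟩ <;> assumption
    have hb : b ∉ H := by rcases hor with ⟨rfl, rfl⟩ | ⟨rfl, rfl⟩ <;> assumption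
    have h1 : chBd (chNdPart u v c + c) (insert a H) = (chNdPart u v c + c) (insert b (insert a H)) := by
      apply chBd_single
      · simp [hab.symm, hb]
      · intro x hx hxb
        have : ¬ (u ∈ insert x (insert a H) ∧ v ∈ insert x (insert a H)) := by
          rintro ⟨h1, h2⟩
          have : b ∈ insert x (insert a H) := by
            rcases hor with ⟨rfl, rfl⟩ | ⟨rfl, rfl⟩ <;> assumption
          simp only [Finset.mem_insert] at this
          rcases this with h | h | h
          · exact hxb h.symm
          · exact hab h.symm
          · exact hb h
        rw [Pi.add_apply]
        unfold chNdPart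
        rw [if_neg this]
        exact z2_add_self _
    rw [chBd_add, hc.2, add_zero] at h1
    rw [h1, Pi.add_apply]
    unfold chNdPart
    rw [if_pos, zero_add]
    rcases hor with ⟨rfl, rfl⟩ | ⟨rfl, rfl⟩ <;> simp
  refine ⟨hnd, h4, chCt_card h4, fun τ => ?_⟩
  by_cases hv : v ∈ τ
  · apply chBd_zero_of
    intro x _
    unfold chCt
    rw [if_pos (by simp [hv])]
  by_cases hu : u ∈ τ
  · have h1 : v ∉ τ.erase u := fun h => hv (Finset.mem_of_mem_erase h)
    have := chCt_bd1 huv hnd (Finset.notMem_erase u τ) h1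
    rw [Finset.insert_erase hu] at this
    rw [this]
    have e1 := hbd (τ.erase u) u v huv (Or.inl ⟨rfl, rfl⟩) (Finset.notMem_erase u τ) h1
    have e2 := hbd (τ.erase u) v u huv.symm (Or.inr ⟨rfl, rfl⟩) (Finset.notMem_erase u τ) h1
    rw [Finset.insert_erase hu] at e1
    rw [e1, e2, Finset.insert_comm u v, Finset.insert_erase hu]
    exact z2_add_self _
  · rw [chCt_bd2 huv _ hu hv, ← hc.2 τ]
    unfold chBd
    refine Finset.sum_congr rfl (fun x _ => ?_)
    split_ifs with hx
    · rfl
    · unfold chNdPart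
      rw [if_neg]
      rintro ⟨h1, h2⟩
      simp only [Finset.mem_insert] at h1 h2
      rcases h1 with h1 | h1
      · rcases h2 with h2 | h2
        · exact huv (h1.trans h2.symm)
        · exact hv h2
      · exact hu h1

theorem chPl_ndPart {u v : V} (huv : u ≠ v) {c : Finset V → ZMod 2} (hc : chCyc c) :
    chPl u v (chNdPart u v c) = c :=
  chPl_unique huv (chNdPart_adm huv hc) hc (fun σ h => by unfold chNdPart; rw [if_neg h])

theorem chNdPart_sub (u v : V) (c : Finset V → ZMod 2) : chSub (chNdPart u v c) c := by
  intro σ hσ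
  unfold chNdPart at hσ
  split_ifs at hσ
  · exact absurd rfl hσ
  · exact hσ

theorem chSim_cyc {Δ : Finset V} (hΔ : Δ.card = 5) : chCyc (chSim Δ) := by
  constructor
  · intro σ hσ
    unfold chSim at hσ
    split_ifs at hσ with h
    · exact h.2
    · exact absurd rfl hσ
  · intro τ
    by_cases h : τ ⊆ Δ ∧ τ.card = 3
    · have hc : (Δ \ τ).card = 2 := by
        rw [Finset.card_sdiff_of_subset h.1]; omega
      have h1 : chBd (chSim Δ) τ = ∑ x, if x ∈ Δ \ τ then (1 : ZMod 2) else 0 := by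
        unfold chBd
        refine Finset.sum_congr rfl (fun x _ => ?_)
        by_cases hx : x ∈ τ
        · simp [hx]
        · simp only [hx, if_false, Finset.mem_sdiff, not_false_eq_true, and_true, chSim,
            Finset.insert_subset_iff, h.1, Finset.card_insert_of_notMem hx, h.2]
      rw [h1, ← Finset.sum_filter, Finset.filter_mem_eq_inter, Finset.univ_inter, Finset.sum_const,
        hc]
      rfl
    · apply chBd_zero_of
      intro x hx
      unfold chSim
      rw [if_neg]
      rintro ⟨h1, h2⟩
      rw [Finset.card_insert_of_notMem hx] at h2
      exact h ⟨(Finset.subset_insert x τ).trans h1, by omega⟩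

/-! ### Minimal admissible chains -/

/-- Contraction on faces. -/
def chPi (u v : V) (σ : Finset V) : Finset V := if v ∈ σ then insert u (σ.erase v) else σ

theorem chPi_v {u v : V} (huv : u ≠ v) (σ : Finset V) : v ∉ chPi u v σ := by
  unfold chPi
  split_ifs with h
  · simp [huv.symm]
  · exact h

/-- No cancelled pair. -/
def chNoCancel (u v : V) (b : Finset V → ZMod 2) : Prop :=
  ∀ τ, u ∉ τ → v ∉ τ → b (insert u τ) ≠ 0 → b (insert v τ) ≠ 0 → False

theorem chCt_pi {u v : V} (huv : u ≠ v) {b : Finset V → ZMod 2} (hnd : chNd u v b)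
    (hnc : chNoCancel u v b) {σ : Finset V} (hσ : b σ ≠ 0) : chCt u v b (chPi u v σ) ≠ 0 := by
  unfold chCt
  rw [if_neg (chPi_v huv σ)]
  unfold chPi
  by_cases hv : v ∈ σ
  · have hu : u ∉ σ := fun hu => hσ (hnd σ hu hv)
    have hu' : u ∉ σ.erase v := fun h => hu (Finset.mem_of_mem_erase h)
    rw [if_pos hv, if_pos (by simp), Finset.erase_insert hu', Finset.insert_erase hv]
    have : b (insert u (σ.erase v)) = 0 := by
      by_contra h
      exact hnc (σ.erase v) hu' (Finset.notMem_erase v σ) h (by rwa [Finset.insert_erase hv])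
    rwa [this, zero_add]
  · rw [if_neg hv]
    split_ifs with hu
    · have hv' : v ∉ σ.erase u := fun h => hv (Finset.mem_of_mem_erase h)
      have : b (insert v (σ.erase u)) = 0 := by
        by_contra h
        exact hnc (σ.erase u) (Finset.notMem_erase u σ) hv' (by rwa [Finset.insert_erase hu]) h
      rwa [this, add_zero]
    · exact hσ

theorem chCt_ne {u v : V} {b : Finset V → ZMod 2} {σ : Finset V} (h : chCt u v b σ ≠ 0) :
    v ∉ σ ∧ (b σ ≠ 0 ∨ (u ∈ σ ∧ b (insert v (σ.erase u)) ≠ 0)) := by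
  unfold chCt at h
  split_ifs at h with h1 h2
  · exact absurd rfl h
  · refine ⟨h1, ?_⟩
    by_cases hb : b σ = 0
    · rw [hb, zero_add] at h
      exact Or.inr ⟨h2, h⟩
    · exact Or.inl hb
  · exact ⟨h1, Or.inl h⟩

theorem chMin_ct {u v : V} (huv : u ≠ v) {b : Finset V → ZMod 2} (hb : chMin (chAdm u v) b)
    (hnc : chNoCancel u v b) : chMin chCyc (chCt u v b) := by
  obtain ⟨hadm, h0, hmin⟩ := hb
  refine ⟨hadm.2.2, ?_, ?_⟩
  · intro h
    obtain ⟨σ, hσ⟩ : ∃ σ, b σ ≠ 0 := by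
      by_contra! h'; exact h0 (funext h')
    exact chCt_pi huv hadm.1 hnc hσ (by rw [h]; rfl)
  · intro z hz hz0 hzs
    let b' : Finset V → ZMod 2 := fun σ => b σ * z (chPi u v σ)
    have hct : chCt u v b' = z := by
      funext σ
      have h1 : chCt u v b' σ = chCt u v b σ * z σ := by
        unfold chCt
        by_cases hv : v ∈ σ
        · simp [hv]
        · rw [if_neg hv, if_neg hv]
          split_ifs with hu
          · have e1 : chPi u v σ = σ := by unfold chPi; rw [if_neg hv]
            have hv' : v ∉ σ.erase u := fun h => hv (Finset.mem_of_mem_erase h)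
            have e2 : chPi u v (insert v (σ.erase u)) = σ := by
              unfold chPi
              rw [if_pos (by simp), Finset.erase_insert hv', Finset.insert_erase hu]
            simp only [b', e1, e2]
            ring
          · have e1 : chPi u v σ = σ := by unfold chPi; rw [if_neg hv]
            simp only [b', e1]
      rw [h1]
      by_cases hzσ : z σ = 0
      · rw [hzσ, mul_zero]
      · rw [z2_ne (hzs σ hzσ), one_mul]
    have hsub : chSub b' b := fun σ h h' => h (by simp [b', h'])
    have hadm' : chAdm u v b' := by
      refine ⟨fun σ h1 h2 => ?_, fun σ hσ => hadm.2.1 σ (hsub σ hσ), by rw [hct]; exact hz⟩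
      simp [b', hadm.1 σ h1 h2]
    have hne : b' ≠ 0 := by
      intro h
      apply hz0
      rw [← hct, h]
      funext σ
      simp [chCt]
    rw [← hct, hmin b' hadm' hne hsub]

theorem chMin_cancel {u v : V} (huv : u ≠ v) {b : Finset V → ZMod 2} (hb : chMin (chAdm u v) b)
    (hnc : ¬ chNoCancel u v b) : ∃ Δ : Finset V, Δ.card = 5 ∧ chPl u v b = chSim Δ := by
  obtain ⟨hadm, h0, hmin⟩ := hb
  unfold chNoCancel at hnc
  push Not at hnc
  obtain ⟨τ, hu, hv, h1, h2, -⟩ := hnc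
  have hτ : τ.card = 3 := by
    have := hadm.2.1 _ h1
    rw [Finset.card_insert_of_notMem hu] at this
    omega
  let b' : Finset V → ZMod 2 := fun σ => if σ = insert u τ ∨ σ = insert v τ then 1 else 0
  have hvu : v ∉ insert u τ := by simp [huv.symm, hv]
  have huv2 : u ∉ insert v τ := by simp [huv, hu]
  have hct : chCt u v b' = 0 := by
    funext σ
    unfold chCt
    by_cases hvσ : v ∈ σ
    · simp [hvσ]
    · rw [if_neg hvσ]
      have hne : σ ≠ insert v τ := fun h => hvσ (by rw [h]; simp)
      split_ifs with huσ
      · have hne2 : insert v (σ.erase u) ≠ insert u τ := fun h => hvu (by rw [← h]; simp)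
        have hv' : v ∉ σ.erase u := fun h => hvσ (Finset.mem_of_mem_erase h)
        by_cases he : σ = insert u τ
        · simp only [b', he, true_or, if_true, Finset.erase_insert hu, or_true]
          exact z2_add_self _
        · have : insert v (σ.erase u) ≠ insert v τ := by
            intro h
            apply he
            have := congrArg (fun s => s.erase v) h
            simp only [Finset.erase_insert hv', Finset.erase_insert hv] at this
            rw [← this, Finset.insert_erase huσ]
          simp [b', he, hne, hne2, this]
      · have he : σ ≠ insert u τ := fun h => huσ (by rw [h]; simp)
        simp [b', he, hne]
  have hadm' : chAdm u v b' := by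
    refine ⟨fun σ h1 h2 => ?_, fun σ hσ => ?_, ?_⟩
    · simp only [b']
      rw [if_neg]
      rintro (rfl | rfl)
      · exact hvu h2
      · exact huv2 h1
    · simp only [b'] at hσ
      split_ifs at hσ with h
      · rcases h with rfl | rfl
        · rw [Finset.card_insert_of_notMem hu, hτ]
        · rw [Finset.card_insert_of_notMem hv, hτ]
      · exact absurd rfl hσ
    · rw [hct]
      exact ⟨fun σ h => absurd rfl h, fun τ => by simp [chBd]⟩
  have hbb : b' = b := by
    apply hmin b' hadm'
    · intro h
      have := congrFun h (insert u τ)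
      simp [b'] at this
    · intro σ hσ
      simp only [b'] at hσ
      split_ifs at hσ with h
      · rcases h with rfl | rfl <;> assumption
      · exact absurd rfl hσ
  have hΔ : (insert u (insert v τ)).card = 5 := by
    rw [Finset.card_insert_of_notMem huv2, Finset.card_insert_of_notMem hv, hτ]
  refine ⟨insert u (insert v τ), hΔ, chPl_unique huv hadm (chSim_cyc hΔ) ?_⟩
  intro σ hσ
  rw [← hbb]
  simp only [b', chSim]
  congr 1
  apply propext
  constructor
  · rintro ⟨hs, hc⟩
    by_cases huσ : u ∈ σ
    · left
      have hvσ : v ∉ σ := fun h => hσ ⟨huσ, h⟩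
      apply Finset.eq_of_subset_of_card_le
      · intro x hx
        have := hs hx
        simp only [Finset.mem_insert] at this ⊢
        rcases this with h | h | h
        · exact Or.inl h
        · exact absurd (h ▸ hx) hvσ
        · exact Or.inr h
      · rw [Finset.card_insert_of_notMem hu, hτ, hc]
    · right
      apply Finset.eq_of_subset_of_card_le
      · intro x hx
        have := hs hx
        simp only [Finset.mem_insert] at this ⊢
        rcases this with h | h | h
        · exact absurd (h ▸ hx) huσ
        · exact Or.inl h
        · exact Or.inr h
      · rw [Finset.card_insert_of_notMem hv, hτ, hc]
  · rintro (rfl | rfl)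
    · exact ⟨Finset.insert_subset_insert _ (Finset.subset_insert _ _), by
        rw [Finset.card_insert_of_notMem hu, hτ]⟩
    · exact ⟨Finset.subset_insert _ _, by rw [Finset.card_insert_of_notMem hv, hτ]⟩

theorem chSim_E {Δ : Finset V} (hΔ : Δ.card = 5) {x y : V} (hx : x ∈ Δ) (hy : y ∈ Δ)
    (hxy : x ≠ y) : ({x, y} : Finset V) ∈ chE (chSim Δ) := by
  have hs : ({x, y} : Finset V) ⊆ Δ := by
    intro z hz
    simp only [Finset.mem_insert, Finset.mem_singleton] at hz
    rcases hz with rfl | rfl <;> assumption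
  obtain ⟨σ, h1, h2, h3⟩ := Finset.exists_subsuperset_card_eq (n := 4) hs
    (by rw [Finset.card_pair hxy]; omega) (by omega)
  refine mem_chE.2 ⟨Finset.card_pair hxy, σ, ?_, h1⟩
  unfold chSim
  rw [if_pos ⟨h2, h3⟩]
  exact one_ne_zero

theorem chSim_V {Δ : Finset V} : chV (chSim Δ) ⊆ Δ := by
  intro x hx
  obtain ⟨σ, hσ, hxσ⟩ := mem_chV.1 hx
  unfold chSim at hσ
  split_ifs at hσ with h
  · exact h.1 hxσ
  · exact absurd rfl hσ

theorem chPl_ne {u v : V} (huv : u ≠ v) {b : Finset V → ZMod 2} (hb : chAdm u v b)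
    {σ : Finset V} (h : chPl u v b σ ≠ 0) :
    b σ ≠ 0 ∨ (u ∈ σ ∧ v ∈ σ ∧ (∃ x, x ∉ σ ∧ b (insert x (σ.erase v)) ≠ 0) ∧
      (∃ x, x ∉ σ ∧ b (insert x (σ.erase u)) ≠ 0)) := by
  by_cases hbσ : b σ = 0
  · right
    have hk : chK u v b σ ≠ 0 := by
      intro h'; apply h; unfold chPl; rw [Pi.add_apply, hbσ, h', add_zero]
    obtain ⟨hu, hv, hne⟩ := chK_ne hk
    refine ⟨hu, hv, ?_, ?_⟩
    · obtain ⟨x, hx, hbx⟩ := chBd_ne hne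
      refine ⟨x, fun hxσ => hbx (hb.1 _ ?_ ?_), hbx⟩
      · simp [hu, huv]
      · have : x = v := by by_contra hh; exact hx (Finset.mem_erase.2 ⟨hh, hxσ⟩)
        simp [this]
    · have e1 : u ∉ (σ.erase v).erase u := Finset.notMem_erase _ _
      have e2 : v ∉ (σ.erase v).erase u := fun h => Finset.notMem_erase v σ (Finset.mem_of_mem_erase h)
      have hu' : u ∈ σ.erase v := Finset.mem_erase.2 ⟨huv, hu⟩
      have hv' : v ∈ σ.erase u := Finset.mem_erase.2 ⟨huv.symm, hv⟩
      have h1 := chCt_bd1 huv hb.1 e1 e2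
      rw [hb.2.2.2, Finset.insert_erase hu', Finset.erase_right_comm, Finset.insert_erase hv'] at h1
      have hne2 : chBd b (σ.erase u) ≠ 0 := by
        intro h0
        rw [h0, add_zero] at h1
        exact hne h1.symm
      obtain ⟨x, hx, hbx⟩ := chBd_ne hne2
      refine ⟨x, fun hxσ => hbx (hb.1 _ ?_ ?_), hbx⟩
      · have : x = u := by by_contra hh; exact hx (Finset.mem_erase.2 ⟨hh, hxσ⟩)
        simp [this]
      · simp [hv, huv.symm]
  · exact Or.inl hbσ

theorem chPl_E {u v : V} (huv : u ≠ v) {b c : Finset V → ZMod 2} (hb : chAdm u v b)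
    (hbc : chSub b c) (he : ({u, v} : Finset V) ∈ chE c) : chE (chPl u v b) ⊆ chE c := by
  intro e hemem
  obtain ⟨h2, σ, hσ, heσ⟩ := mem_chE.1 hemem
  rcases chPl_ne huv hb hσ with h | ⟨hu, hv, ⟨x, hx, hbx⟩, ⟨y, hy, hby⟩⟩
  · exact mem_chE.2 ⟨h2, σ, hbc σ h, heσ⟩
  · by_cases hve : v ∈ e
    · by_cases hue : u ∈ e
      · have : e = {u, v} := by
          symm
          apply Finset.eq_of_subset_of_card_le
          · intro z hz
            simp only [Finset.mem_insert, Finset.mem_singleton] at hz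
            rcases hz with rfl | rfl <;> assumption
          · rw [Finset.card_pair huv, h2]
        rw [this]; exact he
      · refine mem_chE.2 ⟨h2, _, hbc _ hby, fun z hz => ?_⟩
        have hzu : z ≠ u := fun h => hue (h ▸ hz)
        simp [hzu, heσ hz]
    · refine mem_chE.2 ⟨h2, _, hbc _ hbx, fun z hz => ?_⟩
      have hzu : z ≠ v := fun h => hve (h ▸ hz)
      simp [hzu, heσ hz]

theorem chE_V {b c : Finset V → ZMod 2} (hb : chCyc b) (h : chE b ⊆ chE c) : chV b ⊆ chV c := by
  intro x hx
  obtain ⟨σ, hσ, hxσ⟩ := mem_chV.1 hx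
  have h4 := hb.1 σ hσ
  obtain ⟨y, hy, hyx⟩ : ∃ y ∈ σ, y ≠ x := by
    by_contra! hcon
    have : σ ⊆ {x} := fun y hy => by simpa using hcon y hy
    have := Finset.card_le_card this
    simp at this
    omega
  obtain ⟨h2, σ', hσ', hs⟩ := mem_chE.1 (h (pair_mem_chE hσ hxσ hy hyx.symm))
  exact mem_chV.2 ⟨σ', hσ', hs (by simp)⟩

/-- Vertices of the contraction. -/
theorem chCt_V {u v : V} (huv : u ≠ v) {b : Finset V → ZMod 2} (hb : chAdm u v b)
    (hnc : chNoCancel u v b) {σ₀ : Finset V} (hσ₀ : chPl u v b σ₀ ≠ 0) (hu : u ∈ σ₀)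
    (hv : v ∈ σ₀) :
    u ∈ chV (chCt u v b) ∧ v ∉ chV (chCt u v b) ∧
      chV (chPl u v b) = insert v (chV (chCt u v b)) := by
  have hbsub : ∀ σ, b σ ≠ 0 → chPl u v b σ ≠ 0 := by
    intro σ hσ
    rwa [chPl_nd (fun h => hσ (hb.1 σ h.1 h.2))]
  have hb_sub : ∀ σ x, b σ ≠ 0 → x ∈ σ → x ≠ v → x ∈ chV (chCt u v b) := by
    intro σ x hσ hx hxv
    refine mem_chV.2 ⟨_, chCt_pi huv hb.1 hnc hσ, ?_⟩
    unfold chPi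
    split_ifs
    · simp [hx, hxv]
    · exact hx
  have hsub1 : ∀ x, x ∈ chV (chPl u v b) → x ≠ v → x ∈ chV (chCt u v b) := by
    intro x hx hxv
    obtain ⟨σ, hσ, hxσ⟩ := mem_chV.1 hx
    rcases chPl_ne huv hb hσ with h | ⟨_, _, ⟨y, hy, hby⟩, _⟩
    · exact hb_sub σ x h hxσ hxv
    · exact hb_sub _ x hby (by simp [hxσ, hxv]) hxv
  have huct := hsub1 u (mem_chV.2 ⟨_, hσ₀, hu⟩) huv
  refine ⟨huct, ?_, ?_⟩
  · intro h
    obtain ⟨σ, hσ, hvσ⟩ := mem_chV.1 h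
    exact (chCt_ne hσ).1 hvσ
  · ext x
    rw [Finset.mem_insert]
    constructor
    · intro hx
      by_cases hxv : x = v
      · exact Or.inl hxv
      · exact Or.inr (hsub1 x hx hxv)
    · rintro (rfl | hx)
      · exact mem_chV.2 ⟨_, hσ₀, hv⟩
      · obtain ⟨σ, hσ, hxσ⟩ := mem_chV.1 hx
        rcases (chCt_ne hσ).2 with h | ⟨huσ, h⟩
        · exact mem_chV.2 ⟨_, hbsub _ h, hxσ⟩
        · by_cases hxu : x = u
          · rw [hxu]; exact mem_chV.2 ⟨_, hσ₀, hu⟩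
          · exact mem_chV.2 ⟨_, hbsub _ h, by simp [hxσ, hxu]⟩

/-- Edges of the contraction. -/
theorem chCt_E {u v : V} {b : Finset V → ZMod 2} (hb : chAdm u v b) {e : Finset V}
    (he : e ∈ chE (chCt u v b)) :
    e ∈ chE (chPl u v b) ∨ ∃ x, e = {u, x} ∧ ({v, x} : Finset V) ∈ chE (chPl u v b) := by
  have hbsub : ∀ σ, b σ ≠ 0 → chPl u v b σ ≠ 0 := by
    intro σ hσ
    rwa [chPl_nd (fun h => hσ (hb.1 σ h.1 h.2))]
  obtain ⟨h2, σ, hσ, heσ⟩ := mem_chE.1 he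
  obtain ⟨hvσ, h | ⟨huσ, h⟩⟩ := chCt_ne hσ
  · exact Or.inl (mem_chE.2 ⟨h2, σ, hbsub σ h, heσ⟩)
  · by_cases hue : u ∈ e
    · right
      obtain ⟨x, hx⟩ := Finset.card_eq_one.1 (show (e.erase u).card = 1 by
        rw [Finset.card_erase_of_mem hue, h2])
      have hxe : x ∈ e.erase u := by rw [hx]; simp
      refine ⟨x, by rw [← hx, Finset.insert_erase hue], ?_⟩
      apply pair_mem_chE (hbsub _ h)
      · simp
      · simp [heσ (Finset.mem_of_mem_erase hxe), Finset.ne_of_mem_erase hxe]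
      · intro hvx
        exact hvσ (hvx ▸ heσ (Finset.mem_of_mem_erase hxe))
    · left
      refine mem_chE.2 ⟨h2, _, hbsub _ h, fun z hz => ?_⟩
      have : z ≠ u := fun h => hue (h ▸ hz)
      simp [heσ hz, this]

/-- Three common neighbours. -/
theorem chCyc.three {u v : V} (huv : u ≠ v) {c : Finset V → ZMod 2} (hc : chCyc c) {σ : Finset V}
    (hσ : c σ ≠ 0) (hu : u ∈ σ) (hv : v ∈ σ) :
    ∃ h₁ h₂ h₃, h₁ ≠ h₂ ∧ h₁ ≠ h₃ ∧ h₂ ≠ h₃ ∧ u ∉ ({h₁, h₂, h₃} : Finset V) ∧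
      v ∉ ({h₁, h₂, h₃} : Finset V) ∧ c {u, v, h₁, h₂} ≠ 0 ∧ c {u, v, h₁, h₃} ≠ 0 := by
  have h4 := hc.1 σ hσ
  have hv' : v ∈ σ.erase u := Finset.mem_erase.2 ⟨huv.symm, hv⟩
  have hcard : ((σ.erase u).erase v).card = 2 := by
    rw [Finset.card_erase_of_mem hv', Finset.card_erase_of_mem hu]; omega
  obtain ⟨h₁, h₂, h12, hH⟩ := Finset.card_eq_two.1 hcard
  have hσeq : σ = {u, v, h₁, h₂} := by
    rw [← hH, Finset.insert_erase hv', Finset.insert_erase hu]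
  have huH : u ∉ ({h₁, h₂} : Finset V) := by
    rw [← hH]; simp
  have hvH : v ∉ ({h₁, h₂} : Finset V) := by
    rw [← hH]; simp
  simp only [Finset.mem_insert, Finset.mem_singleton, not_or] at huH hvH
  have hre : ({u, v, h₁, h₂} : Finset V) = insert h₂ {u, v, h₁} := by
    ext z; simp only [Finset.mem_insert, Finset.mem_singleton]; tauto
  obtain ⟨h₃, h32, h3n, h3⟩ := hc.other (τ := {u, v, h₁}) (x := h₂) (by
    simp only [Finset.mem_insert, Finset.mem_singleton, not_or]
    exact ⟨fun h => huH.2 h.symm, fun h => hvH.2 h.symm, fun h => h12 h.symm⟩)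
    (by rw [← hre, ← hσeq]; exact hσ)
  simp only [Finset.mem_insert, Finset.mem_singleton, not_or] at h3n
  refine ⟨h₁, h₂, h₃, h12, fun h => h3n.2.2 h.symm, fun h => h32 h.symm, ?_, ?_,
    by rw [← hσeq]; exact hσ, ?_⟩
  · simp only [Finset.mem_insert, Finset.mem_singleton, not_or]
    exact ⟨huH.1, huH.2, fun h => h3n.1 h.symm⟩
  · simp only [Finset.mem_insert, Finset.mem_singleton, not_or]
    exact ⟨hvH.1, hvH.2, fun h => h3n.2.1 h.symm⟩
  · have : insert h₃ ({u, v, h₁} : Finset V) = {u, v, h₁, h₃} := by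
      ext z; simp only [Finset.mem_insert, Finset.mem_singleton]; tauto
    rwa [this] at h3

theorem chMin_hasuv {u v : V} (huv : u ≠ v) {b c : Finset V → ZMod 2} (hc : chMin chCyc c)
    (hb : chMin (chAdm u v) b) (hbc : chSub b c) {σ : Finset V} (hσ : c σ ≠ 0) (hu : u ∈ σ)
    (hv : v ∈ σ) : ∃ σ₀, chPl u v b σ₀ ≠ 0 ∧ u ∈ σ₀ ∧ v ∈ σ₀ := by
  by_contra! hcon
  have hpl : chPl u v b = b := by
    funext τ
    by_cases h : u ∈ τ ∧ v ∈ τ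
    · rw [hb.1.1 τ h.1 h.2]
      by_contra h'
      exact hcon τ h' h.1 h.2
    · exact chPl_nd h
  have hcyc := chPl_cyc huv hb.1
  rw [hpl] at hcyc
  have := hc.2.2 b hcyc hb.2.1 hbc
  rw [← this] at hσ
  exact hσ (hb.1.1 σ hu hv)

theorem rgRig_chSim (p : V → Fin 4 → ℝ) {Δ : Finset V} (hΔ : Δ.card = 5) :
    rgRig p (chE (chSim Δ) : Set (Finset V)) Δ := by
  intro x hx y hy
  by_cases hxy : x = y
  · subst hxy; rw [rgRow_self]; exact Submodule.zero_mem _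
  · exact rgRow_mem p (chSim_E hΔ hx hy hxy)

/-- Fogelsanger's theorem for mod two 3-cycles. -/
theorem rg_fogelsanger {p : V → Fin 4 → ℝ} (hp : rgGen p) (c : Finset V → ZMod 2)
    (hc : chMin chCyc c) : rgRig p (chE c : Set (Finset V)) (chV c) := by
  induction hn : (chV c).card using Nat.strong_induction_on generalizing c with
  | _ n ih =>
    obtain ⟨u, v, huv, σ, hσ, hu, hv⟩ := chV_nonempty hc.1 hc.2.1
    have huvE := pair_mem_chE hσ hu hv huv
    -- minimal admissible chains are rigid
    have hgood : ∀ b, chMin (chAdm u v) b → chSub b (chNdPart u v c) →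
        rgRig p (chE c : Set (Finset V)) (chV (chPl u v b)) := by
      intro b hb hbc'
      have hbc := hbc'.trans (chNdPart_sub u v c)
      have hEsub := chPl_E huv hb.1 hbc huvE
      have hcyc := chPl_cyc huv hb.1
      by_cases hnc : chNoCancel u v b
      · obtain ⟨σ₀, hσ₀, hu₀, hv₀⟩ := chMin_hasuv huv hc hb hbc hσ hu hv
        obtain ⟨huV, hvV, hV⟩ := chCt_V huv hb.1 hnc hσ₀ hu₀ hv₀
        have hctm := chMin_ct huv hb hnc
        have hlt : (chV (chCt u v b)).card < n := by
          rw [← hn]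
          have h1 := Finset.card_le_card (chE_V hcyc hEsub)
          rw [hV, Finset.card_insert_of_notMem hvV] at h1
          omega
        have hrig := ih _ hlt _ hctm rfl
        obtain ⟨h₁, h₂, h₃, n12, n13, n23, huH, hvH, hf1, hf2⟩ := hcyc.three huv hσ₀ hu₀ hv₀
        have hmem : ∀ x ∈ ({h₁, h₂, h₃} : Finset V), ∃ f, chPl u v b f ≠ 0 ∧ u ∈ f ∧ v ∈ f ∧ x ∈ f := by
          intro x hx
          simp only [Finset.mem_insert, Finset.mem_singleton] at hx
          rcases hx with rfl | rfl | rfl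
          · exact ⟨_, hf1, by simp, by simp, by simp⟩
          · exact ⟨_, hf1, by simp, by simp, by simp⟩
          · exact ⟨_, hf2, by simp, by simp, by simp⟩
        have hsplit := rg_split hp (E := chE (chPl u v b)) huV hvV (hctm.1.five hctm.2.1) hrig
          (chE_subset _) (by rw [← hV]; exact chE_subset _)
          (pair_mem_chE hσ₀ hu₀ hv₀ huv) (T := {h₁, h₂, h₃})
          (by rw [Finset.card_insert_of_notMem (by simp [n12, n13]), Finset.card_pair n23])
          (by
            intro x hx
            obtain ⟨f, hf, huf, hvf, hxf⟩ := hmem x hx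
            have : x ∈ chV (chPl u v b) := mem_chV.2 ⟨f, hf, hxf⟩
            rw [hV, Finset.mem_insert] at this
            rcases this with h | h
            · exact absurd (h ▸ hx) hvH
            · exact h) huH
          (by
            intro x hx
            obtain ⟨f, hf, huf, hvf, hxf⟩ := hmem x hx
            exact ⟨pair_mem_chE hf huf hxf (fun h => huH (h ▸ hx)),
              pair_mem_chE hf hvf hxf (fun h => hvH (h ▸ hx))⟩)
          (fun e he => chCt_E hb.1 he)
        rw [← hV] at hsplit
        exact rgRig_mono hsplit (Finset.coe_subset.2 hEsub) (Finset.Subset.refl _)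
      · obtain ⟨Δ, hΔ, hpl⟩ := chMin_cancel huv hb hnc
        rw [hpl] at hEsub ⊢
        exact rgRig_mono (rgRig_chSim p hΔ) (Finset.coe_subset.2 hEsub) chSim_V
    -- maximal good chain
    let G : Finset (Finset V → ZMod 2) := Finset.univ.filter (fun b => chAdm u v b ∧ b ≠ 0 ∧
      chSub b (chNdPart u v c) ∧ rgRig p (chE c : Set (Finset V)) (chV (chPl u v b)))
    have hndadm := chNdPart_adm huv hc.1
    have hGne : G.Nonempty := by
      have hne : chNdPart u v c ≠ 0 := by
        intro h0
        apply hc.2.1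
        rw [← chPl_ndPart huv hc.1, h0]
        funext τ
        simp [chPl, chK, chBd]
      obtain ⟨τ, hτ⟩ : ∃ τ, chNdPart u v c τ ≠ 0 := by
        by_contra! h; exact hne (funext h)
      obtain ⟨b, hb, hbs, -⟩ := ch_exists_min (P := chAdm u v) (fun a b ha hb => ha.add hb)
        (fun a => a τ) (fun a b => rfl) _ hndadm hτ
      exact ⟨b, Finset.mem_filter.2 ⟨Finset.mem_univ _, hb.1, hb.2.1, hbs, hgood b hb hbs⟩⟩
    obtain ⟨b, hbG, hbmax⟩ := Finset.exists_max_image G (fun b => (chSupp b).card) hGne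
    obtain ⟨-, hbadm, hb0, hbs, hbrig⟩ := Finset.mem_filter.1 hbG
    by_cases hbeq : b = chNdPart u v c
    · rw [hbeq, chPl_ndPart huv hc.1] at hbrig
      exact hbrig
    · exfalso
      set r := chNdPart u v c + b with hr
      have hradm : chAdm u v r := hndadm.add hbadm
      have hrs : chSub r (chNdPart u v c) := hbs.compl
      have hsum : chPl u v b + chPl u v r = c := by
        rw [← chPl_add, hr, z2_add_add, chPl_ndPart huv hc.1]
      have hplb0 : chPl u v b ≠ 0 := by
        intro h
        apply hb0
        funext τ
        by_cases hτ : u ∈ τ ∧ v ∈ τ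
        · exact hbadm.1 τ hτ.1 hτ.2
        · rw [← chPl_nd (b := b) hτ, h]
      have hplr0 : chPl u v r ≠ 0 := by
        intro h
        apply hbeq
        have hr0 : r = 0 := by
          funext τ
          by_cases hτ : u ∈ τ ∧ v ∈ τ
          · exact hradm.1 τ hτ.1 hτ.2
          · rw [← chPl_nd (b := r) hτ, h]
        have := z2_add_add b (chNdPart u v c)
        rw [← hr, hr0, add_zero] at this
        exact this
      obtain ⟨F, hF1, hF2⟩ : ∃ F, chPl u v b F ≠ 0 ∧ chPl u v r F ≠ 0 := by
        by_contra! hcon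
        have hs : chSub (chPl u v b) c := by
          intro τ hτ
          rw [← hsum, Pi.add_apply, hcon τ hτ, add_zero]
          exact hτ
        have := hc.2.2 _ (chPl_cyc huv hbadm) hplb0 hs
        rw [this] at hsum
        apply hplr0
        simpa using hsum
      obtain ⟨d, hd, hds, hdF⟩ := ch_exists_min (P := chAdm u v) (fun a b ha hb => ha.add hb)
        (fun a => chPl u v a F) (fun a b => by rw [chPl_add]; rfl) r hradm hF2
      have hdrig := hgood d hd (hds.trans hrs)
      have hF4 : F.card = 4 := (chPl_cyc huv hbadm).1 F hF1
      have hglue := rg_glue hp.1 hbrig hdrig (by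
        rw [← hF4]
        exact Finset.card_le_card (Finset.subset_inter (chV_subset_of hF1) (chV_subset_of hdF)))
      have hdb : ∀ τ, d τ ≠ 0 → b τ = 0 := by
        intro τ hτ
        by_contra hbτ
        apply hds τ hτ
        rw [hr, Pi.add_apply, ← hbs.eq_of hbτ]
        exact z2_add_self _
      have hsub2 : chSub b (b + d) := by
        intro τ hτ
        have : d τ = 0 := by by_contra h; exact hτ (hdb τ h)
        rw [Pi.add_apply, this, add_zero]
        exact hτ
      have hne2 : b ≠ b + d := by
        intro h
        apply hd.2.1
        have : b + d = b + 0 := by rw [← h, add_zero]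
        exact add_left_cancel this
      have hmem : b + d ∈ G := by
        refine Finset.mem_filter.2 ⟨Finset.mem_univ _, hbadm.add hd.1, ?_,
          hbs.add (hds.trans hrs), ?_⟩
        · intro h
          obtain ⟨τ, hτ⟩ : ∃ τ, b τ ≠ 0 := by
            by_contra! h; exact hb0 (funext h)
          exact hsub2 τ hτ (by rw [h]; rfl)
        · rw [chPl_add]
          exact rgRig_mono hglue (Set.Subset.refl _) (chV_add _ _)
      have := hbmax _ hmem
      have := chSupp_card_lt hsub2 hne2
      omega

theorem rg_lower {c : Finset V → ZMod 2} (hc : chMin chCyc c) :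
    4 * (chV c).card ≤ (chE c).card + 10 := by
  obtain ⟨p, hp⟩ := rg_exists_generic (V := V)
  have h1 := rgRk_of_rig hp.1 (by have := hc.1.five hc.2.1; omega) (rg_fogelsanger hp c hc)
  have := rgRk_le_card p (chE c)
  omega

/-! ### Cycles with independent edge sets -/

theorem rgRk_sub_ind {p : V → Fin 4 → ℝ} {E F : Finset (Finset V)}
    (hE : rgRk p (E : Set (Finset V)) = E.card) (h : F ⊆ E) :
    rgRk p (F : Set (Finset V)) = F.card := by
  apply le_antisymm (rgRk_le_card p F)
  have h1 := rgRk_union_le p (F : Set (Finset V)) (E \ F)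
  rw [← Finset.coe_union, Finset.union_sdiff_of_subset h, hE, Finset.card_sdiff_of_subset h] at h1
  have := Finset.card_le_card h
  omega

theorem rg_not_mem_of_ind {p : V → Fin 4 → ℝ} {E F : Finset (Finset V)}
    (hE : rgRk p (E : Set (Finset V)) = E.card) (h : F ⊆ E) {e : Finset V} (he : e ∈ E)
    (heF : e ∉ F) : rgRow p e ∉ rgSp p (F : Set (Finset V)) := by
  intro hmem
  have h1 := rgRk_sub_ind hE (Finset.insert_subset_iff.2 ⟨he, h⟩)
  have h2 := rgRk_sub_ind hE h
  have h3 : rgSp p ((insert e F : Finset (Finset V)) : Set (Finset V)) = rgSp p (F : Set (Finset V)) := by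
    apply le_antisymm
    · unfold rgSp
      rw [Submodule.span_le]
      rintro _ ⟨f, hf, rfl⟩
      rw [Finset.mem_coe, Finset.mem_insert] at hf
      rcases hf with rfl | hf
      · exact hmem
      · exact rgRow_mem p hf
    · exact rgSp_mono p (by simp)
  unfold rgRk at h1 h2
  rw [h3, h2, Finset.card_insert_of_notMem heF] at h1
  omega

/-- Span of the boundaries of 5-cliques. -/
def chCl (E : Finset (Finset V)) : Submodule (ZMod 2) (Finset V → ZMod 2) :=
  Submodule.span (ZMod 2) (chSim '' {Δ | Δ.card = 5 ∧ ∀ x ∈ Δ, ∀ y ∈ Δ, x ≠ y → ({x, y} : Finset V) ∈ E})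

theorem chCt_E_card {u v : V} (huv : u ≠ v) {b : Finset V → ZMod 2} (hb : chAdm u v b)
    (huvE : ({u, v} : Finset V) ∈ chE (chPl u v b)) :
    (chE (chCt u v b)).card + 1 + (Finset.univ.filter (fun x =>
      ({u, x} : Finset V) ∈ chE (chPl u v b) ∧ ({v, x} : Finset V) ∈ chE (chPl u v b))).card ≤
      (chE (chPl u v b)).card := by
  set D := chE (chPl u v b) with hD
  set N := Finset.univ.filter (fun x => ({u, x} : Finset V) ∈ D ∧ ({v, x} : Finset V) ∈ D) with hN
  have hNmem : ∀ x, x ∈ N ↔ ({u, x} : Finset V) ∈ D ∧ ({v, x} : Finset V) ∈ D := by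
    intro x; simp [hN]
  have hDc : ∀ e ∈ D, e.card = 2 := fun e he => (mem_chE.1 he).1
  have hNu : ∀ x ∈ N, x ≠ u ∧ x ≠ v := by
    intro x hx
    obtain ⟨h1, h2⟩ := (hNmem x).1 hx
    have h1 := hDc _ h1
    have h2 := hDc _ h2
    refine ⟨?_, ?_⟩
    · rintro rfl; simp at h1
    · rintro rfl; simp at h2
  let R : Finset (Finset V) := insert {u, v} (N.image (fun x => ({v, x} : Finset V)))
  have hRD : R ⊆ D := by
    intro e he
    rw [Finset.mem_insert] at he
    rcases he with rfl | he
    · exact huvE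
    · obtain ⟨x, hx, rfl⟩ := Finset.mem_image.1 he
      exact ((hNmem x).1 hx).2
  have hpair : ∀ x y : V, x ≠ v → y ≠ v → ({v, x} : Finset V) = {v, y} → x = y := by
    intro x y hx hy h
    have : x ∈ ({v, y} : Finset V) := by rw [← h]; simp
    simp only [Finset.mem_insert, Finset.mem_singleton] at this
    rcases this with h | h
    · exact absurd h hx
    · exact h
  have hRcard : R.card = N.card + 1 := by
    rw [Finset.card_insert_of_notMem, Finset.card_image_of_injOn]
    · intro x hx y hy h
      exact hpair x y (hNu x hx).2 (hNu y hy).2 h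
    · intro h
      obtain ⟨x, hx, hxe⟩ := Finset.mem_image.1 h
      rw [Finset.pair_comm u v] at hxe
      exact (hNu x hx).1 (hpair x u (hNu x hx).2 huv hxe)
  let φ : Finset V → Finset V := fun e => if e ∈ D then e else insert v (e.erase u)
  have hnov : ∀ e ∈ chE (chCt u v b), v ∉ e := by
    intro e he hve
    obtain ⟨-, σ, hσ, hs⟩ := mem_chE.1 he
    exact (chCt_ne hσ).1 (hs hve)
  have hform : ∀ e ∈ chE (chCt u v b), e ∉ D → ∃ x, x ≠ u ∧ x ≠ v ∧ e = {u, x} ∧ ({v, x} : Finset V) ∈ D ∧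
      φ e = {v, x} := by
    intro e he heD
    rcases chCt_E hb he with h | ⟨x, hx, hvx⟩
    · exact absurd h heD
    · have hxu : x ≠ u := by
        rintro rfl
        have := (mem_chE.1 he).1
        rw [hx] at this
        simp at this
      refine ⟨x, hxu, ?_, hx, hvx, ?_⟩
      · rintro rfl
        exact hnov e he (by rw [hx]; simp)
      · simp only [φ, if_neg heD]
        rw [hx, Finset.erase_insert]
        simp [hxu.symm]
  have himg : (chE (chCt u v b)).image φ ⊆ D \ R := by
    intro f hf
    obtain ⟨e, he, rfl⟩ := Finset.mem_image.1 hf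
    rw [Finset.mem_sdiff]
    by_cases heD : e ∈ D
    · have : φ e = e := by simp [φ, heD]
      rw [this]
      refine ⟨heD, fun heR => ?_⟩
      rw [Finset.mem_insert] at heR
      rcases heR with h | h
      · exact hnov e he (by rw [h]; simp)
      · obtain ⟨x, hx, hxe⟩ := Finset.mem_image.1 h
        exact hnov e he (by rw [← hxe]; simp)
    · obtain ⟨x, hxu, hxv, rfl, hvx, hφ⟩ := hform e he heD
      rw [hφ]
      refine ⟨hvx, fun heR => ?_⟩
      rw [Finset.mem_insert] at heR
      rcases heR with h | h
      · rw [Finset.pair_comm u v] at h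
        exact hxu (hpair x u hxv huv h)
      · obtain ⟨y, hy, hye⟩ := Finset.mem_image.1 h
        have := hpair y x (hNu y hy).2 hxv hye
        subst this
        exact heD ((hNmem y).1 hy).1
  have hinj : Set.InjOn φ (chE (chCt u v b) : Set (Finset V)) := by
    intro e he f hf hef
    rw [Finset.mem_coe] at he hf
    by_cases heD : e ∈ D <;> by_cases hfD : f ∈ D
    · simpa only [φ, if_pos heD, if_pos hfD] using hef
    · obtain ⟨x, hxu, hxv, hx, hvx, hφ⟩ := hform f hf hfD
      rw [hφ] at hef
      simp only [φ, if_pos heD] at hef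
      exact absurd (by rw [hef]; simp) (hnov e he)
    · obtain ⟨x, hxu, hxv, hx, hvx, hφ⟩ := hform e he heD
      rw [hφ] at hef
      simp only [φ, if_pos hfD] at hef
      exact absurd (by rw [← hef]; simp) (hnov f hf)
    · obtain ⟨x, hxu, hxv, hx, hvx, hφ⟩ := hform e he heD
      obtain ⟨y, hyu, hyv, hy, hvy, hφ'⟩ := hform f hf hfD
      rw [hφ, hφ'] at hef
      rw [hx, hy, hpair x y hxv hyv hef]
  have h1 := Finset.card_le_card himg
  rw [Finset.card_image_of_injOn hinj, Finset.card_sdiff_of_subset hRD, hRcard] at h1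
  have h2 := Finset.card_le_card hRD
  omega

theorem tr_ins1 (u v a b : V) : ({u, v, a, b} : Finset V) = insert a {u, v, b} := by
  ext z; simp only [Finset.mem_insert, Finset.mem_singleton]; tauto

theorem tr_ins2 (u v a b : V) : insert b ({u, v, a} : Finset V) = {u, v, a, b} := by
  ext z; simp only [Finset.mem_insert, Finset.mem_singleton]; tauto

theorem tr_five {u v a b c x y : V} (hx : x ∈ ({u, v, a, b, c} : Finset V))
    (hy : y ∈ ({u, v, a, b, c} : Finset V)) :
    (x ∈ ({u, v, a, b} : Finset V) ∧ y ∈ ({u, v, a, b} : Finset V)) ∨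
    (x ∈ ({u, v, a, c} : Finset V) ∧ y ∈ ({u, v, a, c} : Finset V)) ∨
    (x ∈ ({u, v, b, c} : Finset V) ∧ y ∈ ({u, v, b, c} : Finset V)) := by
  simp only [Finset.mem_insert, Finset.mem_singleton] at hx hy
  rcases hx with h | h | h | h | h <;> rcases hy with h' | h' | h' | h' | h' <;> simp [h, h']

theorem tr_miss {u v a b c : V} {f : Finset V} (hf : f ⊆ {u, v, a, b, c})
    (hΔ : ({u, v, a, b, c} : Finset V).card = 5) (h4 : f.card = 4) (hu : u ∈ f) (hv : v ∈ f) :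
    f = {u, v, a, b} ∨ f = {u, v, a, c} ∨ f = {u, v, b, c} := by
  have key : ∀ g : Finset V, g.card ≤ 4 → f ⊆ g → f = g := fun g hg h =>
    Finset.eq_of_subset_of_card_le h (by omega)
  by_cases hc : c ∈ f
  · by_cases hb : b ∈ f
    · have ha : a ∉ f := by
        intro ha
        have : ({u, v, a, b, c} : Finset V) ⊆ f := by
          intro z hz
          simp only [Finset.mem_insert, Finset.mem_singleton] at hz
          rcases hz with h | h | h | h | h <;> rw [h] <;> assumption
        have := Finset.card_le_card this
        omega
      right; right
      refine key _ Finset.card_le_four (fun z hz => ?_)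
      have := hf hz
      simp only [Finset.mem_insert, Finset.mem_singleton] at this ⊢
      rcases this with h | h | h | h | h
      · simp [h]
      · simp [h]
      · exact absurd (h ▸ hz) ha
      · simp [h]
      · simp [h]
    · right; left
      refine key _ Finset.card_le_four (fun z hz => ?_)
      have := hf hz
      simp only [Finset.mem_insert, Finset.mem_singleton] at this ⊢
      rcases this with h | h | h | h | h
      · simp [h]
      · simp [h]
      · simp [h]
      · exact absurd (h ▸ hz) hb
      · simp [h]
  · left
    refine key _ Finset.card_le_four (fun z hz => ?_)
    have := hf hz
    simp only [Finset.mem_insert, Finset.mem_singleton] at this ⊢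
    rcases this with h | h | h | h | h
    · simp [h]
    · simp [h]
    · simp [h]
    · simp [h]
    · exact absurd (h ▸ hz) hc

set_option maxHeartbeats 1000000 in
theorem ch_clique_span {p : V → Fin 4 → ℝ} (hp : rgGen p) {E : Finset (Finset V)}
    (hE : rgRk p (E : Set (Finset V)) = E.card) (c : Finset V → ZMod 2) (hc : chCyc c)
    (hcE : chE c ⊆ E) : c ∈ chCl E := by
  induction hn : (chV c).card using Nat.strong_induction_on generalizing c with
  | _ n ih =>
    refine ch_decomp (P := chCyc) (Q := fun a => a ∈ chCl E) (fun a b ha hb => ha.add hb)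
      (Submodule.zero_mem _) (fun a b ha hb => Submodule.add_mem _ ha hb) c hc ?_
    intro m hm hmc
    have hmE := (chE_mono hmc).trans hcE
    have hmV := Finset.card_le_card (chV_mono hmc)
    obtain ⟨u, v, huv, σ, hσ, hu, hv⟩ := chV_nonempty hm.1 hm.2.1
    have huvE := pair_mem_chE hσ hu hv huv
    have hgoal : chPl u v (chNdPart u v m) ∈ chCl E := by
      refine ch_decomp (P := chAdm u v) (Q := fun a => chPl u v a ∈ chCl E)
        (fun a b ha hb => ha.add hb) ?_ (fun a b ha hb => by
          rw [chPl_add]; exact Submodule.add_mem _ ha hb) _ (chNdPart_adm huv hm.1) ?_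
      · have : chPl u v (0 : Finset V → ZMod 2) = 0 := by
          funext τ; simp [chPl, chK, chBd]
        rw [this]; exact Submodule.zero_mem _
      intro b hb hbs
      have hbm := hbs.trans (chNdPart_sub u v m)
      have hEsub := chPl_E huv hb.1 hbm huvE
      have hcyc := chPl_cyc huv hb.1
      by_cases hnc : chNoCancel u v b
      swap
      · obtain ⟨Δ, hΔ, hpl⟩ := chMin_cancel huv hb hnc
        rw [hpl] at hEsub ⊢
        refine Submodule.subset_span ⟨Δ, ⟨hΔ, fun x hx y hy hxy => ?_⟩, rfl⟩
        exact hmE (hEsub (chSim_E hΔ hx hy hxy))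
      obtain ⟨σ₀, hσ₀, hu₀, hv₀⟩ := chMin_hasuv huv hm hb hbm hσ hu hv
      obtain ⟨huV, hvV, hV⟩ := chCt_V huv hb.1 hnc hσ₀ hu₀ hv₀
      have hctm := chMin_ct huv hb hnc
      obtain ⟨h₁, h₂, h₃, n12, n13, n23, huH, hvH, hf1, hf2⟩ := hcyc.three huv hσ₀ hu₀ hv₀
      have hcount := chCt_E_card huv hb.1 (pair_mem_chE hσ₀ hu₀ hv₀ huv)
      set N := Finset.univ.filter (fun x => ({u, x} : Finset V) ∈ chE (chPl u v b) ∧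
        ({v, x} : Finset V) ∈ chE (chPl u v b)) with hN
      have hlow := rg_lower hctm
      have hrk : (chE (chPl u v b)).card + 10 ≤ 4 * (chV (chPl u v b)).card := by
        have h5 := hctm.1.five hctm.2.1
        have h1 := rgRk_complete hp.1 (chV (chPl u v b)) (by
          rw [hV, Finset.card_insert_of_notMem hvV]; omega)
        have h2 := rgRk_mono p (Finset.coe_subset.2 (chE_subset (chPl u v b)))
        have h3 := rgRk_sub_ind hE (hEsub.trans hmE)
        omega
      rw [hV, Finset.card_insert_of_notMem hvV] at hrk
      have hN3 : N.card ≤ 3 := by omega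
      have hfN : ∀ f x, chPl u v b f ≠ 0 → u ∈ f → v ∈ f → x ∈ f → x ≠ u → x ≠ v → x ∈ N := by
        intro f x hf huf hvf hxf hxu hxv
        rw [hN, Finset.mem_filter]
        exact ⟨Finset.mem_univ _, pair_mem_chE hf huf hxf hxu.symm, pair_mem_chE hf hvf hxf hxv.symm⟩
      simp only [Finset.mem_insert, Finset.mem_singleton, not_or] at huH hvH
      have hT3 : ({h₁, h₂, h₃} : Finset V).card = 3 := by
        rw [Finset.card_insert_of_notMem (by simp [n12, n13]), Finset.card_pair n23]
      have hNeq : ({h₁, h₂, h₃} : Finset V) = N := by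
        apply Finset.eq_of_subset_of_card_le
        · intro x hx
          simp only [Finset.mem_insert, Finset.mem_singleton] at hx
          rcases hx with rfl | rfl | rfl
          · exact hfN _ x hf1 (by simp) (by simp) (by simp) (Ne.symm huH.1) (Ne.symm hvH.1)
          · exact hfN _ x hf1 (by simp) (by simp) (by simp) (Ne.symm huH.2.1) (Ne.symm hvH.2.1)
          · exact hfN _ x hf2 (by simp) (by simp) (by simp) (Ne.symm huH.2.2) (Ne.symm hvH.2.2)
        · rw [hT3]; exact hN3
      have hf3 : chPl u v b {u, v, h₂, h₃} ≠ 0 := by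
        have hre : ({u, v, h₁, h₂} : Finset V) = insert h₁ {u, v, h₂} := tr_ins1 _ _ _ _
        rw [hre] at hf1
        obtain ⟨y, hy1, hyn, hy⟩ := hcyc.other (by
          simp only [Finset.mem_insert, Finset.mem_singleton, not_or]
          exact ⟨Ne.symm huH.1, Ne.symm hvH.1, n12⟩) hf1
        simp only [Finset.mem_insert, Finset.mem_singleton, not_or] at hyn
        have hyN := hfN _ y hy (by simp) (by simp) (by simp) hyn.1 hyn.2.1
        rw [← hNeq] at hyN
        simp only [Finset.mem_insert, Finset.mem_singleton] at hyN
        have hy3 : y = h₃ := by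
          rcases hyN with h | h | h
          · exact absurd h hy1
          · exact absurd h hyn.2.2
          · exact h
        subst hy3
        have : insert y ({u, v, h₂} : Finset V) = {u, v, h₂, y} := tr_ins2 _ _ _ _
        rwa [this] at hy
      set Δ : Finset V := {u, v, h₁, h₂, h₃} with hΔdef
      have hΔ : Δ.card = 5 := by
        rw [hΔdef, Finset.card_insert_of_notMem, Finset.card_insert_of_notMem, hT3]
        · simp only [Finset.mem_insert, Finset.mem_singleton, not_or]
          exact hvH
        · simp only [Finset.mem_insert, Finset.mem_singleton, not_or]
          exact ⟨huv, huH⟩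
      have hΔE : ∀ x ∈ Δ, ∀ y ∈ Δ, x ≠ y → ({x, y} : Finset V) ∈ chE (chPl u v b) := by
        intro x hx y hy hxy
        have hxyf := tr_five hx hy
        rcases hxyf with h | h | h
        · exact pair_mem_chE hf1 h.1 h.2 hxy
        · exact pair_mem_chE hf2 h.1 h.2 hxy
        · exact pair_mem_chE hf3 h.1 h.2 hxy
      have hsimE : chE (chSim Δ) ⊆ chE (chPl u v b) := by
        intro e he
        obtain ⟨x, y, hxy, rfl⟩ := Finset.card_eq_two.1 (mem_chE.1 he).1
        obtain ⟨h2, τ, hτ, hs⟩ := mem_chE.1 he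
        have hτΔ := (chV_subset_of hτ).trans chSim_V
        exact hΔE x (hτΔ (hs (by simp))) y (hτΔ (hs (by simp))) hxy
      set d' := chPl u v b + chSim Δ with hd'
      have hsimmem : chSim Δ ∈ chCl E := Submodule.subset_span ⟨Δ, ⟨hΔ, fun x hx y hy hxy =>
        hmE (hEsub (hΔE x hx y hy hxy))⟩, rfl⟩
      have hd'E : chE d' ⊆ chE (chPl u v b) :=
        (chE_add _ _).trans (Finset.union_subset (Finset.Subset.refl _) hsimE)
      have hd'cyc : chCyc d' := hcyc.add (chSim_cyc hΔ)
      have hd'uv : ∀ f, u ∈ f → v ∈ f → d' f = 0 := by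
        intro f huf hvf
        rw [hd', Pi.add_apply]
        by_cases hf : chPl u v b f = 0
        · rw [hf, zero_add]
          unfold chSim
          rw [if_neg]
          rintro ⟨hfs, hf4⟩
          rcases tr_miss hfs hΔ hf4 huf hvf with h | h | h
          · exact hf1 (h ▸ hf)
          · exact hf2 (h ▸ hf)
          · exact hf3 (h ▸ hf)
        · have hsf : chSim Δ f ≠ 0 := by
            unfold chSim
            rw [if_pos]
            · exact one_ne_zero
            · refine ⟨fun x hx => ?_, hcyc.1 f hf⟩
              by_cases hxu : x = u
              · rw [hxu, hΔdef]; simp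
              by_cases hxv : x = v
              · rw [hxv, hΔdef]; simp
              have := hfN f x hf huf hvf hx hxu hxv
              rw [← hNeq] at this
              rw [hΔdef]
              exact Finset.mem_insert_of_mem (Finset.mem_insert_of_mem this)
          rw [z2_ne hf, z2_ne hsf]
          exact z2_add_self 1
      have hd'mem : d' ∈ chCl E := by
        refine ch_decomp (P := chCyc) (Q := fun a => a ∈ chCl E) (fun a b ha hb => ha.add hb)
          (Submodule.zero_mem _) (fun a b ha hb => Submodule.add_mem _ ha hb) d' hd'cyc ?_
        intro a ha had
        have haE : chE a ⊆ E := (chE_mono had).trans (hd'E.trans (hEsub.trans hmE))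
        have haV : chV a ⊆ chV (chPl u v b) := (chV_mono had).trans (chE_V hd'cyc hd'E)
        have hnot : ¬ (u ∈ chV a ∧ v ∈ chV a) := by
          rintro ⟨h1, h2⟩
          refine rg_not_mem_of_ind hE haE (hmE huvE) ?_ (rg_fogelsanger hp a ha u h1 v h2)
          intro h
          obtain ⟨-, f, hf, hs⟩ := mem_chE.1 h
          exact had f hf (hd'uv f (hs (by simp)) (hs (by simp)))
        have hssub : chV a ⊂ chV (chPl u v b) := by
          refine ⟨haV, fun h => hnot ⟨h ?_, h ?_⟩⟩
          · exact chV_subset_of hσ₀ hu₀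
          · exact chV_subset_of hσ₀ hv₀
        have hlt := Finset.card_lt_card hssub
        have hle := Finset.card_le_card (chE_V hcyc hEsub)
        exact ih _ (by omega) a ha.1 haE rfl
      have := Submodule.add_mem _ hsimmem hd'mem
      rwa [hd', z2_add_add] at this
    rwa [chPl_ndPart huv hm.1] at hgoal

/-! ### Tight minimal cycles are stacked -/

theorem chSim_ne {Δ σ : Finset V} : chSim Δ σ ≠ 0 ↔ σ ⊆ Δ ∧ σ.card = 4 := by
  unfold chSim
  split_ifs with h
  · simp [h]
  · simp [h]

theorem chCl_rep {E : Finset (Finset V)} {c : Finset V → ZMod 2} (hc : c ∈ chCl E) :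
    ∃ J : Finset (Finset V), (∀ Δ ∈ J, Δ.card = 5 ∧
      ∀ x ∈ Δ, ∀ y ∈ Δ, x ≠ y → ({x, y} : Finset V) ∈ E) ∧ c = ∑ Δ ∈ J, chSim Δ := by
  have : ∃ a : Finset V → ZMod 2, (∀ Δ, a Δ ≠ 0 → Δ.card = 5 ∧
      ∀ x ∈ Δ, ∀ y ∈ Δ, x ≠ y → ({x, y} : Finset V) ∈ E) ∧ c = ∑ Δ, a Δ • chSim Δ := by
    unfold chCl at hc
    induction hc using Submodule.span_induction with
    | mem x hx =>
      obtain ⟨Δ, hΔ, rfl⟩ := hx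
      refine ⟨Pi.single Δ 1, fun Δ' h => ?_, ?_⟩
      · have : Δ' = Δ := by
          by_contra hne
          exact h (Pi.single_eq_of_ne hne _)
        rw [this]; exact hΔ
      · rw [Finset.sum_eq_single Δ]
        · simp
        · intro b _ hb; rw [Pi.single_eq_of_ne hb, zero_smul]
        · simp
    | zero => exact ⟨0, by simp, by simp⟩
    | add x y _ _ hx hy =>
      obtain ⟨a, ha, rfl⟩ := hx
      obtain ⟨b, hb, rfl⟩ := hy
      refine ⟨a + b, fun Δ h => ?_, ?_⟩
      · by_cases h0 : a Δ = 0
        · apply hb; intro h1; apply h; simp [h0, h1]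
        · exact ha _ h0
      · simp only [Pi.add_apply, add_smul, Finset.sum_add_distrib]
    | smul r x _ hx =>
      obtain ⟨a, ha, rfl⟩ := hx
      refine ⟨r • a, fun Δ h => ha _ (fun h0 => h (by simp [h0])), ?_⟩
      simp only [Pi.smul_apply, smul_assoc, Finset.smul_sum]
  obtain ⟨a, ha, rfl⟩ := this
  refine ⟨Finset.univ.filter (fun Δ => a Δ ≠ 0), fun Δ h => ha Δ (Finset.mem_filter.1 h).2, ?_⟩
  rw [Finset.sum_filter]
  refine Finset.sum_congr rfl (fun Δ _ => ?_)
  split_ifs with h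
  · rw [z2_ne h, one_smul]
  · push Not at h; rw [h, zero_smul]

theorem ch_sum_ne {J : Finset (Finset V)} {F : Finset V} (h : (∑ Δ ∈ J, chSim Δ) F ≠ 0) :
    ∃ Δ ∈ J, F ⊆ Δ ∧ F.card = 4 := by
  rw [Finset.sum_apply] at h
  obtain ⟨Δ, hΔ, h'⟩ := Finset.exists_ne_zero_of_sum_ne_zero h
  exact ⟨Δ, hΔ, chSim_ne.1 h'⟩

theorem ch_sum_cyc {J : Finset (Finset V)} (h : ∀ Δ ∈ J, Δ.card = 5) :
    chCyc (∑ Δ ∈ J, chSim Δ) := by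
  induction J using Finset.induction_on with
  | empty =>
    refine ⟨fun σ h => absurd rfl h, fun τ => ?_⟩
    simp [chBd]
  | insert a s ha ih =>
    rw [Finset.sum_insert ha]
    exact (chSim_cyc (h a (by simp))).add (ih (fun Δ hΔ => h Δ (by simp [hΔ])))

theorem ch_deg4 {c : Finset V → ZMod 2} (hc : chMin chCyc c)
    (ht : (chE c).card + 10 = 4 * (chV c).card) :
    (∃ Δ : Finset V, Δ.card = 5 ∧ c = chSim Δ) ∨
    (6 ≤ (chV c).card ∧ ∃ (v : V) (T : Finset V), v ∈ chV c ∧ v ∉ T ∧ T.card = 4 ∧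
      ∀ y, ({v, y} : Finset V) ∈ chE c ↔ y ∈ T) := by
  obtain ⟨p, hp⟩ := rg_exists_generic (V := V)
  have hfive := hc.1.five hc.2.1
  have hrk : rgRk p (chE c : Set (Finset V)) = (chE c).card := by
    have h1 := rgRk_of_rig hp.1 (by omega) (rg_fogelsanger hp c hc)
    have := rgRk_le_card p (chE c)
    omega
  -- minimal representation
  let P : Finset (Finset V) → Prop := fun J => (∀ Δ ∈ J, Δ.card = 5 ∧
      ∀ x ∈ Δ, ∀ y ∈ Δ, x ≠ y → ({x, y} : Finset V) ∈ chE c) ∧ c = ∑ Δ ∈ J, chSim Δ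
  have hex : (Finset.univ.filter P).Nonempty := by
    obtain ⟨J, hJ⟩ := chCl_rep (ch_clique_span hp hrk c hc.1 (Finset.Subset.refl _))
    exact ⟨J, by simpa [P] using hJ⟩
  obtain ⟨J, hJP, hJmin⟩ := Finset.exists_min_image _ (fun J => J.card) hex
  obtain ⟨hJ, hJc⟩ := (Finset.mem_filter.1 hJP).2
  have hJne : ∀ J1 ⊆ J, J1.Nonempty → ∑ Δ ∈ J1, chSim Δ ≠ 0 := by
    intro J1 h1 hne h0
    have hP : P (J \ J1) := by
      refine ⟨fun Δ hΔ => hJ Δ (Finset.mem_sdiff.1 hΔ).1, ?_⟩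
      have := Finset.sum_sdiff (f := chSim) h1
      rw [h0, add_zero, ← hJc] at this
      exact this.symm
    have := hJmin _ (by simpa using hP)
    rw [Finset.card_sdiff_of_subset h1] at this
    have h2 := Finset.card_le_card h1
    have h3 := hne.card_pos
    omega
  have hJV : ∀ Δ ∈ J, Δ ⊆ chV c := by
    intro Δ hΔ x hx
    obtain ⟨y, hy, hyx⟩ := Finset.exists_mem_ne (by rw [(hJ Δ hΔ).1]; omega) x
    obtain ⟨-, σ, hσ, hs⟩ := mem_chE.1 ((hJ Δ hΔ).2 x hx y hy hyx.symm)
    exact chV_subset_of hσ (hs (by simp))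
  obtain ⟨Δ₀, hΔ₀⟩ : J.Nonempty := by
    rw [Finset.nonempty_iff_ne_empty]
    rintro rfl
    exact hc.2.1 (by simpa using hJc)
  rcases hfive.eq_or_lt with h5 | h6
  · left
    refine ⟨chV c, h5.symm, ?_⟩
    have hJe : J = {chV c} := by
      rw [Finset.eq_singleton_iff_nonempty_unique_mem]
      refine ⟨⟨Δ₀, hΔ₀⟩, fun Δ hΔ => Finset.eq_of_subset_of_card_le (hJV Δ hΔ) ?_⟩
      rw [(hJ Δ hΔ).1, h5]
    rw [hJe, Finset.sum_singleton] at hJc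
    exact hJc
  right
  refine ⟨h6, ?_⟩
  let EE : Finset V → Finset (Finset V) := fun W => (chE c).filter (fun e => e ⊆ W)
  have hup : ∀ W : Finset V, 4 ≤ W.card → (EE W).card + 10 ≤ 4 * W.card := by
    intro W hW
    have h1 := rgRk_complete hp.1 W hW
    have h2 : EE W ⊆ W.powersetCard 2 := by
      intro e he
      have := Finset.mem_filter.1 he
      exact Finset.mem_powersetCard.2 ⟨this.2, (mem_chE.1 this.1).1⟩
    have h2 := rgRk_mono p (Finset.coe_subset.2 h2)
    have h3 := rgRk_sub_ind hrk (Finset.filter_subset (fun e => e ⊆ W) (chE c))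
    have h3 : rgRk p (EE W : Set (Finset V)) = (EE W).card := h3
    omega
  let Q : Finset V → Prop := fun W => W ⊂ chV c ∧ (∃ Δ ∈ J, Δ ⊆ W) ∧ (EE W).card + 10 = 4 * W.card
  have hexQ : (Finset.univ.filter Q).Nonempty := by
    refine ⟨Δ₀, ?_⟩
    rw [Finset.mem_filter]
    have h5 := (hJ _ hΔ₀).1
    refine ⟨Finset.mem_univ _, ⟨hJV _ hΔ₀, fun h => ?_⟩, ⟨Δ₀, hΔ₀, Finset.Subset.refl _⟩, ?_⟩
    · have := Finset.card_le_card h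
      omega
    · have : EE Δ₀ = Δ₀.powersetCard 2 := by
        ext e
        simp only [EE, Finset.mem_filter, Finset.mem_powersetCard]
        constructor
        · rintro ⟨h1, h2⟩
          exact ⟨h2, (mem_chE.1 h1).1⟩
        · rintro ⟨h1, h2⟩
          refine ⟨?_, h1⟩
          obtain ⟨x, y, hxy, rfl⟩ := Finset.card_eq_two.1 h2
          exact (hJ _ hΔ₀).2 x (h1 (by simp)) y (h1 (by simp)) hxy
      rw [this, Finset.card_powersetCard, h5]
      rfl
  obtain ⟨W, hWQ, hWmax⟩ := Finset.exists_max_image _ (fun W => W.card) hexQ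
  obtain ⟨hWV, ⟨Δ₁, hΔ₁, hΔ₁W⟩, hWt⟩ := (Finset.mem_filter.1 hWQ).2
  set J1 := J.filter (fun Δ => Δ ⊆ W) with hJ1
  set J2 := J.filter (fun Δ => ¬ Δ ⊆ W) with hJ2
  have hsum : ∑ Δ ∈ J1, chSim Δ + ∑ Δ ∈ J2, chSim Δ = c := by
    rw [hJc]; exact Finset.sum_filter_add_sum_filter_not _ _ _
  have hc1 : ∑ Δ ∈ J1, chSim Δ ≠ 0 :=
    hJne _ (Finset.filter_subset _ _) ⟨Δ₁, Finset.mem_filter.2 ⟨hΔ₁, hΔ₁W⟩⟩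
  have hc1W : ∀ F, (∑ Δ ∈ J1, chSim Δ) F ≠ 0 → F ⊆ W ∧ F.card = 4 := by
    intro F hF
    obtain ⟨Δ, hΔ, hFΔ, h4⟩ := ch_sum_ne hF
    exact ⟨hFΔ.trans (Finset.mem_filter.1 hΔ).2, h4⟩
  obtain ⟨F, hF1, hF2⟩ : ∃ F, (∑ Δ ∈ J1, chSim Δ) F ≠ 0 ∧ (∑ Δ ∈ J2, chSim Δ) F ≠ 0 := by
    by_contra! hcon
    have hsub : chSub (∑ Δ ∈ J1, chSim Δ) c := by
      intro σ hσ
      rw [← hsum, Pi.add_apply, hcon σ hσ, add_zero]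
      exact hσ
    have heq := hc.2.2 _ (ch_sum_cyc (fun Δ hΔ => (hJ Δ (Finset.mem_filter.1 hΔ).1).1)) hc1 hsub
    apply hWV.2
    intro x hx
    obtain ⟨σ, hσ, hxσ⟩ := mem_chV.1 hx
    rw [← heq] at hσ
    exact (hc1W σ hσ).1 hxσ
  obtain ⟨hFW, hF4⟩ := hc1W F hF1
  obtain ⟨Δ, hΔJ2, hFΔ, -⟩ := ch_sum_ne hF2
  obtain ⟨hΔJ, hΔW⟩ := Finset.mem_filter.1 hΔJ2
  obtain ⟨x, hxΔ, hxW⟩ := Finset.not_subset.1 hΔW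
  have hxF : x ∉ F := fun h => hxW (hFW h)
  let S : Finset (Finset V) := F.image (fun y => ({x, y} : Finset V))
  have hS4 : S.card = 4 := by
    rw [Finset.card_image_of_injOn, hF4]
    intro a ha b hb h
    have : a ∈ ({x, b} : Finset V) := by
      have h : ({x, a} : Finset V) = {x, b} := h
      rw [← h]; simp
    simp only [Finset.mem_insert, Finset.mem_singleton] at this
    rcases this with h | h
    · exact absurd (h ▸ ha) hxF
    · exact h
  have hdisj : Disjoint (EE W) S := by
    rw [Finset.disjoint_left]
    intro e he heS
    obtain ⟨y, hy, rfl⟩ := Finset.mem_image.1 heS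
    exact hxW ((Finset.mem_filter.1 he).2 (by simp))
  have hsub : EE W ∪ S ⊆ EE (insert x W) := by
    apply Finset.union_subset
    · intro e he
      have := Finset.mem_filter.1 he
      exact Finset.mem_filter.2 ⟨this.1, this.2.trans (Finset.subset_insert _ _)⟩
    · intro e he
      obtain ⟨y, hy, rfl⟩ := Finset.mem_image.1 he
      refine Finset.mem_filter.2 ⟨(hJ Δ hΔJ).2 x hxΔ y (hFΔ hy) ?_, ?_⟩
      · rintro rfl; exact hxF hy
      · intro z hz
        simp only [Finset.mem_insert, Finset.mem_singleton] at hz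
        rcases hz with rfl | rfl
        · simp
        · exact Finset.mem_insert_of_mem (hFW hy)
  have hWc : 4 ≤ W.card := by rw [← hF4]; exact Finset.card_le_card hFW
  have hcardW' : (insert x W).card = W.card + 1 := Finset.card_insert_of_notMem hxW
  have hle := hup (insert x W) (by omega)
  have hge := Finset.card_le_card hsub
  rw [Finset.card_union_of_disjoint hdisj, hS4] at hge
  have hEeq : EE W ∪ S = EE (insert x W) := by
    apply Finset.eq_of_subset_of_card_le hsub
    rw [Finset.card_union_of_disjoint hdisj, hS4]
    omega
  have hxV : x ∈ chV c := hJV Δ hΔJ hxΔ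
  have hW'V : insert x W = chV c := by
    by_contra hne
    have hss : insert x W ⊂ chV c :=
      (Finset.insert_subset_iff.2 ⟨hxV, hWV.1⟩).ssubset_of_ne hne
    have := hWmax (insert x W) (by
      rw [Finset.mem_filter]
      refine ⟨Finset.mem_univ _, hss, ⟨Δ₁, hΔ₁, hΔ₁W.trans (Finset.subset_insert _ _)⟩, by omega⟩)
    omega
  refine ⟨x, F, hxV, hxF, hF4, fun y => ⟨fun hy => ?_, fun hy => ?_⟩⟩
  · have : ({x, y} : Finset V) ∈ EE W ∪ S := by
      rw [hEeq, hW'V]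
      exact Finset.mem_filter.2 ⟨hy, (Finset.mem_powersetCard.1 (chE_subset c hy)).1⟩
    rw [Finset.mem_union] at this
    rcases this with h | h
    · exact absurd ((Finset.mem_filter.1 h).2 (by simp)) hxW
    · obtain ⟨z, hz, hzy⟩ := Finset.mem_image.1 h
      have : z ∈ ({x, y} : Finset V) := by rw [← hzy]; simp
      simp only [Finset.mem_insert, Finset.mem_singleton] at this
      rcases this with h | h
      · exact absurd (h ▸ hz) hxF
      · exact h ▸ hz
  · exact (hJ Δ hΔJ).2 x hxΔ y (hFΔ hy) (by rintro rfl; exact hxF hy)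

theorem ch_step {c : Finset V → ZMod 2} (hc : chMin chCyc c) {v : V} {T : Finset V}
    (h6 : 6 ≤ (chV c).card) (hv : v ∈ chV c) (hvT : v ∉ T) (hT4 : T.card = 4)
    (hnb : ∀ y, ({v, y} : Finset V) ∈ chE c ↔ y ∈ T) :
    c T = 0 ∧ (∀ σ, v ∈ σ → (c σ ≠ 0 ↔ chSim (insert v T) σ ≠ 0)) ∧
    chMin chCyc (c + chSim (insert v T)) ∧
    chV (c + chSim (insert v T)) = (chV c).erase v ∧
    (chE (c + chSim (insert v T))).card + 4 = (chE c).card := by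
  have hΔ5 : (insert v T).card = 5 := by rw [Finset.card_insert_of_notMem hvT, hT4]
  have hsub : ∀ σ, c σ ≠ 0 → v ∈ σ → σ.erase v ⊆ T := by
    intro σ hσ hvσ y hy
    rw [Finset.mem_erase] at hy
    exact (hnb y).1 (pair_mem_chE hσ hvσ hy.2 hy.1.symm)
  have hform : ∀ σ, v ∈ σ → σ ⊆ insert v T → σ.card = 4 → ∃ a ∈ T, σ = insert v (T.erase a) := by
    intro σ hvσ hs h4
    have h1 : σ.erase v ⊆ T := by
      intro y hy
      rw [Finset.mem_erase] at hy
      rcases Finset.mem_insert.1 (hs hy.2) with h | h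
      · exact absurd h hy.1
      · exact h
    have h2 : (T \ σ.erase v).card = 1 := by
      rw [Finset.card_sdiff_of_subset h1, Finset.card_erase_of_mem hvσ]; omega
    obtain ⟨a, ha⟩ := Finset.card_eq_one.1 h2
    have haT : a ∈ T \ σ.erase v := by rw [ha]; simp
    refine ⟨a, (Finset.mem_sdiff.1 haT).1, ?_⟩
    rw [← Finset.sdiff_singleton_eq_erase a T, ← ha, Finset.sdiff_sdiff_eq_self h1,
      Finset.insert_erase hvσ]
  have hsub' : ∀ σ, c σ ≠ 0 → v ∈ σ → σ ⊆ insert v T := by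
    intro σ hσ hvσ y hy
    by_cases h : y = v
    · rw [h]; simp
    · exact Finset.mem_insert_of_mem (hsub σ hσ hvσ (Finset.mem_erase.2 ⟨h, hy⟩))
  have hall : ∀ b ∈ T, c (insert v (T.erase b)) ≠ 0 := by
    intro b hb
    obtain ⟨σ, hσ, hvσ⟩ := mem_chV.1 hv
    obtain ⟨a, ha, rfl⟩ := hform σ hvσ (hsub' σ hσ hvσ) (hc.1.1 σ hσ)
    by_cases hab : a = b
    · exact hab ▸ hσ
    have hbv : b ≠ v := by rintro rfl; exact hvT hb
    have hav : a ≠ v := by rintro rfl; exact hvT ha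
    have hre : insert v (T.erase a) = insert b (insert v ((T.erase a).erase b)) := by
      rw [Finset.insert_comm, Finset.insert_erase (Finset.mem_erase.2 ⟨Ne.symm hab, hb⟩)]
    rw [hre] at hσ
    obtain ⟨y, hyb, hyn, hy⟩ := hc.1.other (by simp [hbv]) hσ
    simp only [Finset.mem_insert, Finset.mem_erase, not_or, not_and] at hyn
    have hyT : y ∈ T := (hnb y).1 (pair_mem_chE hy (by simp) (by simp) (Ne.symm hyn.1))
    have hya : y = a := by
      by_contra hya
      exact hyn.2 hyb hya hyT
    subst hya
    have hre2 : insert y (insert v ((T.erase y).erase b)) = insert v (T.erase b) := by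
      rw [Finset.insert_comm, Finset.erase_right_comm,
        Finset.insert_erase (Finset.mem_erase.2 ⟨hyb, hyT⟩)]
    rwa [hre2] at hy
  have hiff : ∀ σ, v ∈ σ → (c σ ≠ 0 ↔ chSim (insert v T) σ ≠ 0) := by
    intro σ hvσ
    rw [chSim_ne]
    constructor
    · intro hσ
      exact ⟨hsub' σ hσ hvσ, hc.1.1 σ hσ⟩
    · rintro ⟨h1, h2⟩
      obtain ⟨a, ha, rfl⟩ := hform σ hvσ h1 h2
      exact hall a ha
  have hsimv : ∀ σ, v ∉ σ → chSim (insert v T) σ ≠ 0 → σ = T := by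
    intro σ hvσ h
    obtain ⟨h1, h2⟩ := chSim_ne.1 h
    apply Finset.eq_of_subset_of_card_le
    · intro y hy
      rcases Finset.mem_insert.1 (h1 hy) with h | h
      · exact absurd (h ▸ hy) hvσ
      · exact h
    · omega
  have hsimT : chSim (insert v T) T ≠ 0 := chSim_ne.2 ⟨Finset.subset_insert _ _, hT4⟩
  have hcT : c T = 0 := by
    by_contra hcT
    have hs : chSub (chSim (insert v T)) c := by
      intro σ hσ
      by_cases hvσ : v ∈ σ
      · exact (hiff σ hvσ).2 hσ
      · rw [hsimv σ hvσ hσ]; exact hcT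
    have heq := hc.2.2 _ (chSim_cyc hΔ5) (fun h => hsimT (by rw [h]; rfl)) hs
    have := Finset.card_le_card (chSim_V (Δ := insert v T))
    rw [heq, hΔ5] at this
    omega
  obtain ⟨a, haT⟩ : T.Nonempty := by rw [← Finset.card_pos]; omega
  have h'v : ∀ σ, v ∈ σ → (c + chSim (insert v T)) σ = 0 := by
    intro σ hvσ
    rw [Pi.add_apply]
    by_cases h : c σ = 0
    · have h2 : chSim (insert v T) σ = 0 := by
        by_contra h2; exact (hiff σ hvσ).2 h2 h
      rw [h, h2, add_zero]
    · rw [z2_ne h, z2_ne ((hiff σ hvσ).1 h)]; exact z2_add_self 1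
  have h'T : (c + chSim (insert v T)) T ≠ 0 := by
    rw [Pi.add_apply, hcT, zero_add]; exact hsimT
  have h'o : ∀ σ, v ∉ σ → σ ≠ T → (c + chSim (insert v T)) σ = c σ := by
    intro σ hvσ hσT
    rw [Pi.add_apply]
    have : chSim (insert v T) σ = 0 := by
      by_contra h; exact hσT (hsimv σ hvσ h)
    rw [this, add_zero]
  have h'cyc := hc.1.add (chSim_cyc hΔ5)
  set c' := c + chSim (insert v T) with hc'
  have h'ne : ∀ σ, c' σ ≠ 0 → v ∉ σ ∧ (σ = T ∨ c σ ≠ 0) := by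
    intro σ hσ
    have hvσ : v ∉ σ := fun h => hσ (h'v σ h)
    refine ⟨hvσ, ?_⟩
    by_cases h : σ = T
    · exact Or.inl h
    · right; rwa [h'o σ hvσ h] at hσ
  have h'of : ∀ σ, v ∉ σ → c σ ≠ 0 → c' σ ≠ 0 := by
    intro σ hvσ hσ
    by_cases h : σ = T
    · rw [h] at hσ; exact absurd hcT hσ
    · rwa [h'o σ hvσ h]
  refine ⟨hcT, hiff, ⟨h'cyc, fun h => h'T (by rw [h]; rfl), ?_⟩, ?_, ?_⟩
  · intro b' hb' hb0 hbs
    have hb'v : ∀ σ, b' σ ≠ 0 → v ∉ σ := fun σ hσ => (h'ne σ (hbs σ hσ)).1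
    by_cases hbT : b' T = 0
    · exfalso
      have hs : chSub b' c := by
        intro σ hσ
        rcases (h'ne σ (hbs σ hσ)).2 with h | h
        · rw [h] at hσ; exact absurd hbT hσ
        · exact h
      have heq := hc.2.2 _ hb' hb0 hs
      have := hall a haT
      rw [← heq] at this
      exact hb'v _ this (by simp)
    · have hs : chSub (b' + chSim (insert v T)) c := by
        intro σ hσ
        by_cases hvσ : v ∈ σ
        · apply (hiff σ hvσ).2
          have : b' σ = 0 := by by_contra h; exact hb'v σ h hvσ
          rwa [Pi.add_apply, this, zero_add] at hσ
        · by_cases hσT : σ = T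
          · exfalso
            apply hσ
            rw [hσT, Pi.add_apply, z2_ne hbT, z2_ne hsimT]; exact z2_add_self 1
          · have h2 : chSim (insert v T) σ = 0 := by
              by_contra h; exact hσT (hsimv σ hvσ h)
            rw [Pi.add_apply, h2, add_zero] at hσ
            exact ((h'ne σ (hbs σ hσ)).2).resolve_left hσT
      have hne : b' + chSim (insert v T) ≠ 0 := by
        intro h
        have h1 := congrFun h (insert v (T.erase a))
        have h2 : b' (insert v (T.erase a)) = 0 := by
          by_contra h; exact hb'v _ h (by simp)
        rw [Pi.add_apply, h2, zero_add] at h1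
        exact (hiff _ (by simp)).1 (hall a haT) h1
      have heq := hc.2.2 _ (hb'.add (chSim_cyc hΔ5)) hne hs
      rw [hc', ← heq, add_assoc, z2_add_self_fun, add_zero]
  · ext y
    rw [Finset.mem_erase, mem_chV, mem_chV]
    constructor
    · rintro ⟨σ, hσ, hy⟩
      obtain ⟨h1, h2⟩ := h'ne σ hσ
      refine ⟨by rintro rfl; exact h1 hy, ?_⟩
      rcases h2 with rfl | h2
      · obtain ⟨b, hb, hby⟩ := Finset.exists_mem_ne (s := σ) (by omega) y
        exact ⟨_, hall b hb, by simp [hy, hby.symm]⟩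
      · exact ⟨σ, h2, hy⟩
    · rintro ⟨hyv, σ, hσ, hy⟩
      by_cases hvσ : v ∈ σ
      · exact ⟨T, h'T, hsub σ hσ hvσ (Finset.mem_erase.2 ⟨hyv, hy⟩)⟩
      · exact ⟨σ, h'of σ hvσ hσ, hy⟩
  · have h1 : chE c' = (chE c).filter (fun e => ¬ v ∈ e) := by
      ext e
      rw [Finset.mem_filter, mem_chE, mem_chE]
      constructor
      · rintro ⟨he, σ, hσ, hes⟩
        obtain ⟨h1, h2⟩ := h'ne σ hσ
        refine ⟨⟨he, ?_⟩, fun h => h1 (hes h)⟩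
        rcases h2 with rfl | h2
        · obtain ⟨b, hb, hbe⟩ : ∃ b ∈ σ, b ∉ e := by
            by_contra! hcon
            have := Finset.card_le_card (show σ ⊆ e from hcon)
            omega
          refine ⟨_, hall b hb, fun z hz => Finset.mem_insert_of_mem (Finset.mem_erase.2 ⟨?_, hes hz⟩)⟩
          rintro rfl; exact hbe hz
        · exact ⟨σ, h2, hes⟩
      · rintro ⟨⟨he, σ, hσ, hes⟩, hve⟩
        refine ⟨he, ?_⟩
        by_cases hvσ : v ∈ σ
        · refine ⟨T, h'T, fun z hz => hsub σ hσ hvσ (Finset.mem_erase.2 ⟨?_, hes hz⟩)⟩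
          rintro rfl; exact hve hz
        · exact ⟨σ, h'of σ hvσ hσ, hes⟩
    have h2 : ((chE c).filter (fun e => v ∈ e)) = T.image (fun y => ({v, y} : Finset V)) := by
      ext e
      rw [Finset.mem_filter, Finset.mem_image]
      constructor
      · rintro ⟨he, hve⟩
        obtain ⟨y, hy⟩ : ∃ y, e = {v, y} := by
          have h2 := (mem_chE.1 he).1
          have : (e.erase v).card = 1 := by rw [Finset.card_erase_of_mem hve, h2]
          obtain ⟨y, hy⟩ := Finset.card_eq_one.1 this
          exact ⟨y, by rw [← Finset.insert_erase hve, hy]⟩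
        exact ⟨y, (hnb y).1 (hy ▸ he), hy.symm⟩
      · rintro ⟨y, hy, rfl⟩
        exact ⟨(hnb y).2 hy, by simp⟩
    have h3 : (T.image (fun y => ({v, y} : Finset V))).card = 4 := by
      rw [Finset.card_image_of_injOn, hT4]
      intro x hx y hy h
      have h : ({v, x} : Finset V) = {v, y} := h
      have : x ∈ ({v, y} : Finset V) := by rw [← h]; simp
      simp only [Finset.mem_insert, Finset.mem_singleton] at this
      rcases this with h | h
      · exact absurd (h ▸ hx) hvT
      · exact h
    rw [h1, ← Finset.card_filter_add_card_filter_not (s := chE c) (fun e => v ∈ e), h2, h3, add_comm]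

/-! ### Tight minimal cycles are spheres -/

/-- Geometric realization of a chain. -/
def chR (c : Finset V → ZMod 2) : Set (V → ℝ) :=
  {x | (∃ σ, c σ ≠ 0 ∧ ∀ v, x v ≠ 0 → v ∈ σ) ∧ (∀ v, 0 ≤ x v) ∧ (∑ v, x v) = 1}

def hmF (v : V) (T : Finset V) (x : V → ℝ) (w : V) : ℝ :=
  if w = v then 0 else x w + (if w ∈ T then x v / 4 else 0)

def hmM (T : Finset V) (hT : T.Nonempty) (y : V → ℝ) : ℝ := T.inf' hT (fun w => y w)

def hmG (v : V) (T : Finset V) (hT : T.Nonempty) (y : V → ℝ) (w : V) : ℝ :=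
  if w = v then 4 * hmM T hT y else y w - (if w ∈ T then hmM T hT y else 0)

theorem hmM_cont (T : Finset V) (hT : T.Nonempty) : Continuous (hmM T hT) := by
  unfold hmM
  exact Continuous.finset_inf'_apply hT (fun i _ => continuous_apply i)

theorem hmF_cont (v : V) (T : Finset V) : Continuous (hmF v T) := by
  refine continuous_pi (fun w => ?_)
  unfold hmF
  split_ifs <;> fun_prop

theorem hmG_cont (v : V) (T : Finset V) (hT : T.Nonempty) : Continuous (hmG v T hT) := by
  refine continuous_pi (fun w => ?_)
  have := hmM_cont T hT
  unfold hmG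
  split_ifs <;> fun_prop

theorem hmF_sum {v : V} {T : Finset V} (hvT : v ∉ T) (hT4 : T.card = 4) (x : V → ℝ) :
    ∑ w, hmF v T x w = ∑ w, x w := by
  have : ∀ w, hmF v T x w = x w + ((if w ∈ T then x v / 4 else 0) - (if w = v then x v else 0)) := by
    intro w
    unfold hmF
    by_cases h : w = v
    · subst h; simp [hvT]
    · simp [h]
  simp_rw [this]
  rw [Finset.sum_add_distrib, Finset.sum_sub_distrib, Finset.sum_ite_mem, Finset.sum_ite_eq' Finset.univ v]
  simp only [Finset.univ_inter, Finset.sum_const, hT4, Finset.mem_univ, if_true]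
  simp; ring

theorem hmG_sum {v : V} {T : Finset V} (hT : T.Nonempty) (hvT : v ∉ T) (hT4 : T.card = 4) (y : V → ℝ)
    (hy : y v = 0) : ∑ w, hmG v T hT y w = ∑ w, y w := by
  have : ∀ w, hmG v T hT y w = y w + ((if w = v then 4 * hmM T hT y else 0) -
      (if w ∈ T then hmM T hT y else 0)) := by
    intro w
    unfold hmG
    by_cases h : w = v
    · subst h; simp [hvT, hy]
    · simp [h]; ring
  simp_rw [this]
  rw [Finset.sum_add_distrib, Finset.sum_sub_distrib, Finset.sum_ite_mem, Finset.sum_ite_eq' Finset.univ v]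
  simp only [Finset.univ_inter, Finset.sum_const, hT4, Finset.mem_univ, if_true]
  simp

theorem hm_step {c c' : Finset V → ZMod 2} {v : V} {T : Finset V} (hvT : v ∉ T) (hT4 : T.card = 4)
    (hcard : ∀ σ, c σ ≠ 0 → σ.card = 4) (hcT : c T = 0)
    (hiff : ∀ σ, v ∈ σ → (c σ ≠ 0 ↔ σ ⊆ insert v T ∧ σ.card = 4))
    (h'T : c' T ≠ 0) (h'v : ∀ σ, v ∈ σ → c' σ = 0)
    (h'o : ∀ σ, v ∉ σ → σ ≠ T → c' σ = c σ) : Nonempty (chR c ≃ₜ chR c') := by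
  have hT : T.Nonempty := by rw [← Finset.card_pos]; omega
  have hmle : ∀ (y : V → ℝ) (a : V), a ∈ T → hmM T hT y ≤ y a := fun y a ha =>
    Finset.inf'_le _ ha
  have hmex : ∀ y : V → ℝ, ∃ a ∈ T, hmM T hT y = y a := fun y =>
    Finset.exists_mem_eq_inf' hT _
  have hmnn : ∀ y : V → ℝ, (∀ w, 0 ≤ y w) → 0 ≤ hmM T hT y := by
    intro y hy
    obtain ⟨a, -, h⟩ := hmex y
    rw [h]; exact hy a
  have hzero : ∀ σ : Finset V, v ∉ σ → σ.card = 4 → σ ≠ T → ∃ a ∈ T, a ∉ σ := by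
    intro σ _ h4 hne
    by_contra! h
    exact hne (Finset.eq_of_subset_of_card_le h (by omega)).symm
  have hxz : ∀ x ∈ chR c, ∃ a ∈ T, x a = 0 := by
    rintro x ⟨⟨σ, hσ, hs⟩, -, -⟩
    have : ∃ a ∈ T, a ∉ σ := by
      by_cases hvσ : v ∈ σ
      · by_contra! h
        have h1 : insert v T ⊆ σ := Finset.insert_subset_iff.2 ⟨hvσ, h⟩
        have h2 := Finset.card_le_card h1
        rw [Finset.card_insert_of_notMem hvT, hcard σ hσ] at h2
        omega
      · exact hzero σ hvσ (hcard σ hσ) (by rintro rfl; exact hσ hcT)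
    obtain ⟨a, ha, haσ⟩ := this
    exact ⟨a, ha, by by_contra h; exact haσ (hs a h)⟩
  have hyv : ∀ y ∈ chR c', y v = 0 := by
    rintro y ⟨⟨σ, hσ, hs⟩, -, -⟩
    by_contra h
    exact hσ (h'v σ (hs v h))
  have hFm : ∀ x ∈ chR c, hmF v T x ∈ chR c' := by
    rintro x ⟨⟨σ, hσ, hs⟩, hnn, hsum⟩
    refine ⟨?_, ?_, ?_⟩
    · by_cases hvσ : v ∈ σ
      · refine ⟨T, h'T, fun w hw => ?_⟩
        by_contra hwT
        apply hw
        unfold hmF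
        by_cases hwv : w = v
        · simp [hwv]
        · rw [if_neg hwv, if_neg hwT, add_zero]
          by_contra h
          have := ((hiff σ hvσ).1 hσ).1 (hs w h)
          rw [Finset.mem_insert] at this
          tauto
      · have hx0 : x v = 0 := by by_contra h; exact hvσ (hs v h)
        refine ⟨σ, ?_, fun w hw => ?_⟩
        · rw [h'o σ hvσ (by rintro rfl; exact hσ hcT)]; exact hσ
        · apply hs
          intro h
          apply hw
          unfold hmF
          simp [hx0, h]
    · intro w
      unfold hmF
      have := hnn w
      have := hnn v
      split_ifs <;> linarith
    · rw [hmF_sum hvT hT4, hsum]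
  have hGm : ∀ y ∈ chR c', hmG v T hT y ∈ chR c := by
    intro y hy
    have hyv0 := hyv y hy
    obtain ⟨⟨σ, hσ, hs⟩, hnn, hsum⟩ := hy
    have hvσ : v ∉ σ := fun h => hσ (h'v σ h)
    refine ⟨?_, ?_, ?_⟩
    · by_cases hσT : σ = T
      · obtain ⟨a, ha, hma⟩ := hmex y
        refine ⟨insert v (T.erase a), (hiff _ (by simp)).2 ⟨Finset.insert_subset_insert _ (Finset.erase_subset _ _), ?_⟩, ?_⟩
        · rw [Finset.card_insert_of_notMem (by simp [hvT]), Finset.card_erase_of_mem ha]; omega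
        · intro w hw
          rw [Finset.mem_insert, Finset.mem_erase]
          by_contra hcon
          push Not at hcon
          apply hw
          unfold hmG
          rw [if_neg hcon.1]
          by_cases hwa : w = a
          · rw [hwa, if_pos ha, hma, sub_self]
          · have hwT := hcon.2 hwa
            rw [if_neg hwT, sub_zero]
            by_contra h
            exact hwT (hσT ▸ hs w h)
      · have hσ2 := h'o σ hvσ hσT
        rw [hσ2] at hσ
        obtain ⟨a, haT, haσ⟩ := hzero σ hvσ (hcard σ hσ) hσT
        have hm0 : hmM T hT y = 0 := by
          apply le_antisymm _ (hmnn y hnn)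
          have : y a = 0 := by by_contra h; exact haσ (hs a h)
          rw [← this]; exact hmle y a haT
        refine ⟨σ, hσ, fun w hw => hs w (fun h => hw ?_)⟩
        unfold hmG
        rw [hm0, h]; simp
    · intro w
      unfold hmG
      have h1 := hmnn y hnn
      split_ifs with h2 h3
      · linarith
      · have := hmle y w h3; linarith
      · have := hnn w; linarith
    · rw [hmG_sum hT hvT hT4 y hyv0, hsum]
  have hGF : ∀ x ∈ chR c, hmG v T hT (hmF v T x) = x := by
    intro x hx
    have hm : hmM T hT (hmF v T x) = x v / 4 := by
      obtain ⟨a, ha, hxa⟩ := hxz x hx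
      have hval : ∀ b ∈ T, hmF v T x b = x b + x v / 4 := by
        intro b hb
        unfold hmF
        rw [if_neg (by rintro rfl; exact hvT hb), if_pos hb]
      apply le_antisymm
      · have := hmle (hmF v T x) a ha
        rw [hval a ha, hxa] at this
        linarith
      · obtain ⟨b, hb, h⟩ := hmex (hmF v T x)
        rw [h, hval b hb]
        have := hx.2.1 b
        linarith
    funext w
    unfold hmG
    rw [hm]
    by_cases hwv : w = v
    · rw [if_pos hwv, hwv]; ring
    · rw [if_neg hwv]
      unfold hmF
      rw [if_neg hwv]
      ring
  have hFG : ∀ y ∈ chR c', hmF v T (hmG v T hT y) = y := by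
    intro y hy
    funext w
    unfold hmF
    by_cases hwv : w = v
    · rw [if_pos hwv, hwv, hyv y hy]
    · rw [if_neg hwv]
      unfold hmG
      rw [if_neg hwv, if_pos rfl]
      split_ifs <;> ring
  exact ⟨{
    toFun := fun x => ⟨hmF v T x.1, hFm x.1 x.2⟩
    invFun := fun y => ⟨hmG v T hT y.1, hGm y.1 y.2⟩
    left_inv := fun x => Subtype.ext (hGF x.1 x.2)
    right_inv := fun y => Subtype.ext (hFG y.1 y.2)
    continuous_toFun := ((hmF_cont v T).comp continuous_subtype_val).subtype_mk _
    continuous_invFun := ((hmG_cont v T hT).comp continuous_subtype_val).subtype_mk _ }⟩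

/-- Boundary of the standard simplex. -/
def hmB : Set (Fin 5 → ℝ) := {x | (∃ i, x i = 0) ∧ (∀ i, 0 ≤ x i) ∧ ∑ i, x i = 1}

theorem hm_base1 {Δ : Finset V} (hΔ : Δ.card = 5) : Nonempty (chR (chSim Δ) ≃ₜ hmB) := by
  let e : Δ ≃ Fin 5 := Finset.equivFinOfCardEq hΔ
  let f : (V → ℝ) → (Fin 5 → ℝ) := fun x i => x (e.symm i).1
  let g : (Fin 5 → ℝ) → (V → ℝ) := fun y w => if h : w ∈ Δ then y (e ⟨w, h⟩) else 0
  have hf : Continuous f := by fun_prop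
  have hg : Continuous g := by
    refine continuous_pi (fun w => ?_)
    by_cases h : w ∈ Δ
    · simp only [g, dif_pos h]; fun_prop
    · simp only [g, dif_neg h]; fun_prop
  have hsup : ∀ x ∈ chR (chSim Δ), ∀ w, w ∉ Δ → x w = 0 := by
    rintro x ⟨⟨σ, hσ, hs⟩, -, -⟩ w hw
    by_contra h
    exact hw ((chSim_ne.1 hσ).1 (hs w h))
  have hsumf : ∀ x : V → ℝ, (∀ w, w ∉ Δ → x w = 0) → ∑ i, f x i = ∑ w, x w := by
    intro x hx
    rw [← Finset.sum_subset (Finset.subset_univ Δ) (fun w _ hw => hx w hw), ← Finset.sum_coe_sort Δ]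
    exact Equiv.sum_comp e.symm (fun w : Δ => x w.1)
  have hfg : ∀ y, f (g y) = y := by
    intro y
    funext i
    simp [f, g]
  have hgf : ∀ x ∈ chR (chSim Δ), g (f x) = x := by
    intro x hx
    funext w
    by_cases h : w ∈ Δ
    · simp [f, g, h]
    · simp [f, g, h, hsup x hx w h]
  have hgsup : ∀ y, ∀ w, w ∉ Δ → g y w = 0 := by
    intro y w hw; simp [g, hw]
  have hfm : ∀ x ∈ chR (chSim Δ), f x ∈ hmB := by
    intro x hx
    refine ⟨?_, fun i => hx.2.1 _, ?_⟩
    · obtain ⟨⟨σ, hσ, hs⟩, -, -⟩ := hx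
      obtain ⟨h1, h2⟩ := chSim_ne.1 hσ
      obtain ⟨a, ha, haσ⟩ : ∃ a ∈ Δ, a ∉ σ := by
        by_contra! h
        have := Finset.card_le_card (show Δ ⊆ σ from h)
        omega
      refine ⟨e ⟨a, ha⟩, ?_⟩
      simp only [f, Equiv.symm_apply_apply]
      by_contra h
      exact haσ (hs a h)
    · rw [hsumf x (hsup x hx), hx.2.2]
  have hgm : ∀ y ∈ hmB, g y ∈ chR (chSim Δ) := by
    rintro y ⟨⟨i, hi⟩, hnn, hsum⟩
    refine ⟨⟨Δ.erase (e.symm i).1, chSim_ne.2 ⟨Finset.erase_subset _ _, ?_⟩, ?_⟩, ?_, ?_⟩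
    · rw [Finset.card_erase_of_mem (e.symm i).2]; omega
    · intro w hw
      have hwΔ : w ∈ Δ := by by_contra h; exact hw (hgsup y w h)
      rw [Finset.mem_erase]
      refine ⟨?_, hwΔ⟩
      rintro rfl
      apply hw
      have := congrFun (hfg y) i
      simp only [f] at this
      rw [this, hi]
    · intro w
      by_cases h : w ∈ Δ
      · simp only [g, dif_pos h]; exact hnn _
      · rw [hgsup y w h]
    · rw [← hsumf _ (hgsup y), hfg, hsum]
  exact ⟨{
    toFun := fun x => ⟨f x.1, hfm x.1 x.2⟩
    invFun := fun y => ⟨g y.1, hgm y.1 y.2⟩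
    left_inv := fun x => Subtype.ext (hgf x.1 x.2)
    right_inv := fun y => Subtype.ext (hfg y.1)
    continuous_toFun := (hf.comp continuous_subtype_val).subtype_mk _
    continuous_invFun := (hg.comp continuous_subtype_val).subtype_mk _ }⟩

def hmP (x : Fin 5 → ℝ) : EuclideanSpace ℝ (Fin 4) :=
  WithLp.toLp 2 (fun i : Fin 4 => x i.castSucc - 1 / 5)

def hmU (z : EuclideanSpace ℝ (Fin 4)) : Fin 5 → ℝ :=
  Fin.snoc (α := fun _ => ℝ) (fun i : Fin 4 => z i) (- ∑ i, z i)

def hmN (z : EuclideanSpace ℝ (Fin 4)) : ℝ :=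
  - (Finset.univ : Finset (Fin 5)).inf' Finset.univ_nonempty (fun i => hmU z i)

theorem hmU_cont : Continuous hmU := by
  refine continuous_pi (fun i => ?_)
  refine Fin.lastCases ?_ (fun j => ?_) i
  · simp only [hmU, Fin.snoc_last]; fun_prop
  · simp only [hmU, Fin.snoc_castSucc]; fun_prop

theorem hmN_cont : Continuous hmN := by
  unfold hmN
  refine Continuous.neg ?_
  exact Continuous.finset_inf'_apply _ (fun i _ => (continuous_apply i).comp hmU_cont)

theorem hmP_cont : Continuous hmP := by
  unfold hmP
  fun_prop

theorem hmU_sum (z : EuclideanSpace ℝ (Fin 4)) : ∑ i, hmU z i = 0 := by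
  rw [Fin.sum_univ_castSucc]
  simp only [hmU, Fin.snoc_castSucc, Fin.snoc_last]
  ring

theorem hmN_le (z : EuclideanSpace ℝ (Fin 4)) (i : Fin 5) : - hmN z ≤ hmU z i := by
  unfold hmN
  rw [neg_neg]
  exact Finset.inf'_le _ (Finset.mem_univ i)

theorem hmN_ex (z : EuclideanSpace ℝ (Fin 4)) : ∃ i, hmU z i = - hmN z := by
  unfold hmN
  rw [neg_neg]
  obtain ⟨i, -, h⟩ := Finset.exists_mem_eq_inf' (Finset.univ_nonempty (α := Fin 5)) (fun i => hmU z i)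
  exact ⟨i, h.symm⟩

theorem hmN_pos {z : EuclideanSpace ℝ (Fin 4)} (hz : z ≠ 0) : 0 < hmN z := by
  by_contra hle
  push Not at hle
  have hnn : ∀ i ∈ Finset.univ, 0 ≤ hmU z i := fun i _ => by
    have := hmN_le z i; linarith
  have h0 := (Finset.sum_eq_zero_iff_of_nonneg hnn).1 (hmU_sum z)
  apply hz
  ext i
  have := h0 i.castSucc (Finset.mem_univ _)
  simpa [hmU] using this

theorem hm_base2 : Nonempty (hmB ≃ₜ Metric.sphere (0 : EuclideanSpace ℝ (Fin 4)) 1) := by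
  have hPne : ∀ x ∈ hmB, hmP x ≠ 0 := by
    rintro x ⟨⟨i, hi⟩, -, hsum⟩ h
    have h4 : ∀ j : Fin 4, x j.castSucc = 1 / 5 := by
      intro j
      have := congrArg (fun z : EuclideanSpace ℝ (Fin 4) => z j) h
      simp only [hmP, PiLp.zero_apply] at this
      linarith
    rw [Fin.sum_univ_castSucc] at hsum
    simp only [h4, Finset.sum_const, Finset.card_univ, Fintype.card_fin] at hsum
    have hl : x (Fin.last 4) = 1 / 5 := by norm_num at hsum ⊢; linarith
    revert hi
    refine Fin.lastCases ?_ (fun j => ?_) i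
    · rw [hl]; norm_num
    · rw [h4]; norm_num
  have hUP : ∀ x ∈ hmB, ∀ r : ℝ, ∀ i, hmU (r • hmP x) i = r * (x i - 1 / 5) := by
    rintro x ⟨-, -, hsum⟩ r i
    refine Fin.lastCases ?_ (fun j => ?_) i
    · simp only [hmU, Fin.snoc_last, PiLp.smul_apply, hmP, smul_eq_mul]
      rw [← Finset.mul_sum, Finset.sum_sub_distrib]
      rw [Fin.sum_univ_castSucc] at hsum
      have : ∑ i : Fin 4, x i.castSucc = 1 - x (Fin.last 4) := by linarith
      rw [this]
      simp
      ring
    · simp only [hmU, Fin.snoc_castSucc, PiLp.smul_apply, hmP, smul_eq_mul]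
  let g : EuclideanSpace ℝ (Fin 4) → Fin 5 → ℝ := fun z i => 1 / 5 + hmU z i / (5 * hmN z)
  have hgm : ∀ z, z ≠ 0 → g z ∈ hmB := by
    intro z hz
    have hN := hmN_pos hz
    refine ⟨?_, ?_, ?_⟩
    · obtain ⟨i, hi⟩ := hmN_ex z
      refine ⟨i, ?_⟩
      simp only [g]
      rw [hi]; field_simp; ring
    · intro i
      have := hmN_le z i
      simp only [g]
      have : -(1/5) ≤ hmU z i / (5 * hmN z) := by
        rw [le_div_iff₀ (by linarith)]; linarith
      linarith
    · simp only [g]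
      rw [Finset.sum_add_distrib, ← Finset.sum_div Finset.univ (fun i => hmU z i), hmU_sum]
      simp
  have hgP : ∀ z, hmP (g z) = (5 * hmN z)⁻¹ • z := by
    intro z
    ext i
    simp only [hmP, g, hmU, Fin.snoc_castSucc, PiLp.smul_apply, smul_eq_mul]
    ring
  refine ⟨{
    toFun := fun x => ⟨‖hmP x.1‖⁻¹ • hmP x.1, ?_⟩
    invFun := fun z => ⟨g z.1, hgm z.1 ?_⟩
    left_inv := ?_
    right_inv := ?_
    continuous_toFun := ?_
    continuous_invFun := ?_ }⟩
  · have := hPne x.1 x.2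
    rw [mem_sphere_zero_iff_norm, norm_smul, norm_inv, norm_norm]
    exact inv_mul_cancel₀ (norm_ne_zero_iff.2 this)
  · have := z.2
    rw [mem_sphere_zero_iff_norm] at this
    intro h
    rw [h] at this
    simp at this
  · intro x
    apply Subtype.ext
    have hr : 0 < ‖hmP x.1‖⁻¹ := inv_pos.2 (norm_pos_iff.2 (hPne x.1 x.2))
    set r := ‖hmP x.1‖⁻¹ with hrdef
    have hN : hmN (r • hmP x.1) = r / 5 := by
      obtain ⟨i, hi⟩ := hmN_ex (r • hmP x.1)
      obtain ⟨j, hj⟩ := x.2.1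
      have h1 := hmN_le (r • hmP x.1) j
      rw [hUP x.1 x.2] at hi h1
      rw [hj] at h1
      have h2 := mul_nonneg hr.le (x.2.2.1 i)
      linarith
    funext i
    simp only [g]
    rw [hUP x.1 x.2, hN]
    field_simp
    ring
  · intro z
    apply Subtype.ext
    have hz := z.2
    rw [mem_sphere_zero_iff_norm] at hz
    have hz0 : z.1 ≠ 0 := by intro h; rw [h] at hz; simp at hz
    have hN := hmN_pos hz0
    simp only
    rw [hgP, norm_smul, hz, mul_one, smul_smul]
    rw [Real.norm_of_nonneg (by positivity), inv_inv, mul_inv_cancel₀ (by positivity), one_smul]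
  · refine Continuous.subtype_mk ?_ _
    have h1 := hmP_cont.comp (continuous_subtype_val (p := fun x => x ∈ hmB))
    refine Continuous.smul (Continuous.inv₀ h1.norm ?_) h1
    intro x
    exact norm_ne_zero_iff.2 (hPne x.1 x.2)
  · refine Continuous.subtype_mk ?_ _
    refine continuous_pi (fun i => ?_)
    simp only [g]
    refine continuous_const.add (Continuous.div ?_ ?_ ?_)
    · exact (continuous_apply i).comp (hmU_cont.comp continuous_subtype_val)
    · exact continuous_const.mul (hmN_cont.comp continuous_subtype_val)
    · intro z
      have hz := z.2
      rw [mem_sphere_zero_iff_norm] at hz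
      have hz0 : z.1 ≠ 0 := by intro h; rw [h] at hz; simp at hz
      have := hmN_pos hz0
      positivity

theorem ch_sphere (c : Finset V → ZMod 2) (hc : chMin chCyc c)
    (ht : (chE c).card + 10 = 4 * (chV c).card) :
    Nonempty (chR c ≃ₜ Metric.sphere (0 : EuclideanSpace ℝ (Fin 4)) 1) := by
  induction hn : (chV c).card generalizing c with
  | zero => have := hc.1.five hc.2.1; omega
  | succ n ih =>
    rcases ch_deg4 hc ht with ⟨Δ, hΔ, rfl⟩ | ⟨h6, v, T, hv, hvT, hT4, hnb⟩
    · obtain ⟨e1⟩ := hm_base1 hΔ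
      obtain ⟨e2⟩ := hm_base2
      exact ⟨e1.trans e2⟩
    · obtain ⟨hcT, hiff, hmin, hV, hE⟩ := ch_step hc h6 hv hvT hT4 hnb
      have hVc : (chV (c + chSim (insert v T))).card = n := by
        rw [hV, Finset.card_erase_of_mem hv, hn]; rfl
      obtain ⟨e1⟩ := ih _ hmin (by omega) hVc
      obtain ⟨e2⟩ := hm_step (c := c) (c' := c + chSim (insert v T)) hvT hT4 hc.1.1 hcT
        (fun σ hσ => by rw [hiff σ hσ, chSim_ne]) (by
          rw [Pi.add_apply, hcT, zero_add]
          exact chSim_ne.2 ⟨Finset.subset_insert _ _, hT4⟩)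
        (fun σ hσ => by
          rw [Pi.add_apply]
          by_cases h : c σ = 0
          · have h2 : chSim (insert v T) σ = 0 := by
              by_contra h2; exact (hiff σ hσ).2 h2 h
            rw [h, h2, add_zero]
          · rw [z2_ne h, z2_ne ((hiff σ hσ).1 h)]; exact z2_add_self 1)
        (fun σ hσ hσT => by
          rw [Pi.add_apply]
          have : chSim (insert v T) σ = 0 := by
            by_contra h
            obtain ⟨h1, h2⟩ := chSim_ne.1 h
            apply hσT
            apply Finset.eq_of_subset_of_card_le
            · intro y hy
              rcases Finset.mem_insert.1 (h1 hy) with h | h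
              · exact absurd (h ▸ hy) hσ
              · exact h
            · omega
          rw [this, add_zero])
      exact ⟨e2.trans e1⟩

/-- points on which the sign function `s` is a cocycle -/
def tpX (s : V → V → ℝ) (x : V → ℝ) : Prop :=
  (∀ a, 0 ≤ x a) ∧ (∃ a, 0 < x a) ∧
    ∀ a b d, 0 < x a → 0 < x b → 0 < x d → s a b * s b d = s a d

/-- signed lifts -/
def tpE (s : V → V → ℝ) (y : V → ℝ) : Prop :=
  tpX s (fun a => |y a|) ∧ ∀ a b, y a ≠ 0 → y b ≠ 0 → 0 < y a * y b * s a b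

def tpPi (s : V → V → ℝ) (y : {y : V → ℝ // tpE s y}) : {x : V → ℝ // tpX s x} :=
  ⟨fun a => |y.1 a|, y.2.1⟩

theorem tpPi_cont (s : V → V → ℝ) : Continuous (tpPi s) := by
  refine Continuous.subtype_mk ?_ _
  refine continuous_pi fun a => ?_
  exact ((continuous_apply a).comp continuous_subtype_val).abs

theorem tp_lift_mem (s : V → V → ℝ) (hs : ∀ a b, s a b = 1 ∨ s a b = -1) (x : V → ℝ) (hx : tpX s x)
    (a : V) (ha : 0 < x a) (r : ℝ) (hr : r = 1 ∨ r = -1) :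
    tpE s (fun b => r * s a b * x b) ∧ ∀ b, |r * s a b * x b| = x b := by
  have habs : ∀ b, |r * s a b * x b| = x b := by
    intro b
    rw [abs_mul, abs_mul, abs_of_nonneg (hx.1 b)]
    rcases hr with h | h <;> rcases hs a b with h' | h' <;> simp [h, h']
  refine ⟨⟨?_, ?_⟩, habs⟩
  · simp only [habs]; exact hx
  · intro b d hb hd
    have hb' : 0 < x b := by
      rcases (hx.1 b).lt_or_eq with h | h
      · exact h
      · exfalso; apply hb; simp [← h]
    have hd' : 0 < x d := by
      rcases (hx.1 d).lt_or_eq with h | h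
      · exact h
      · exfalso; apply hd; simp [← h]
    have h1 := hx.2.2 a b d ha hb' hd'
    have hr2 : r * r = 1 := by rcases hr with h | h <;> simp [h]
    have h2 : s a d * s a d = 1 := by rcases hs a d with h | h <;> simp [h]
    have : r * s a b * x b * (r * s a d * x d) * s b d = x b * x d := by
      calc _ = (r * r) * ((s a b * s b d) * s a d) * (x b * x d) := by ring
        _ = _ := by rw [h1, hr2, h2]; ring
    change 0 < r * s a b * x b * (r * s a d * x d) * s b d
    rw [this]; positivity

theorem tp_covering (s : V → V → ℝ) (hs : ∀ a b, s a b = 1 ∨ s a b = -1) :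
    IsCoveringMap (tpPi s) := by
  intro x
  obtain ⟨a, ha⟩ := x.2.2.1
  refine IsEvenlyCovered.to_isEvenlyCovered_preimage (I := ({1, -1} : Set ℝ)) ?_
  refine ⟨inferInstance, {x | 0 < x.1 a}, ha, ?_, ?_, ?_, ?_⟩
  · exact isOpen_lt continuous_const ((continuous_apply a).comp continuous_subtype_val)
  · exact (isOpen_lt continuous_const ((continuous_apply a).comp continuous_subtype_val)).preimage
      (tpPi_cont s)
  · have hpos : ∀ y : (tpPi s ⁻¹' {x | 0 < x.1 a}), y.1.1 a ≠ 0 := by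
      intro y
      have : 0 < |y.1.1 a| := y.2
      exact abs_pos.1 this
    refine
      { toFun := fun y => (⟨tpPi s y.1, y.2⟩, ⟨y.1.1 a / |y.1.1 a|, ?_⟩)
        invFun := fun p => ⟨⟨fun b => p.2.1 * s a b * p.1.1.1 b,
          (tp_lift_mem s hs p.1.1.1 p.1.1.2 a p.1.2 p.2.1 (by have := p.2.2; exact this)).1⟩, ?_⟩
        left_inv := ?_
        right_inv := ?_
        continuous_toFun := ?_
        continuous_invFun := ?_ }
    · rcases lt_or_gt_of_ne (hpos y) with h | h
      · rw [abs_of_neg h, div_neg, div_self h.ne]; simp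
      · rw [abs_of_pos h, div_self h.ne']; simp
    · have := (tp_lift_mem s hs p.1.1.1 p.1.1.2 a p.1.2 p.2.1 (by have := p.2.2; exact this)).2 a
      change 0 < |p.2.1 * s a a * p.1.1.1 a|
      rw [this]; exact p.1.2
    · intro y
      apply Subtype.ext; apply Subtype.ext; funext b
      change y.1.1 a / |y.1.1 a| * s a b * |y.1.1 b| = y.1.1 b
      by_cases hb : y.1.1 b = 0
      · simp [hb]
      have h1 := y.1.2.2 a b (hpos y) hb
      have h0 := hpos y
      rcases lt_or_gt_of_ne h0 with h | h <;> rcases lt_or_gt_of_ne hb with h' | h' <;>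
        rcases hs a b with h2 | h2 <;> rw [h2] at h1 ⊢ <;>
        first
        | (exfalso; nlinarith [mul_pos_of_neg_of_neg h h'])
        | (exfalso; nlinarith [mul_pos h h'])
        | (exfalso; nlinarith [mul_neg_of_neg_of_pos h h'])
        | (exfalso; nlinarith [mul_neg_of_pos_of_neg h h'])
        | (simp only [abs_of_neg, abs_of_pos, h, h']; field_simp)
    · rintro ⟨⟨x, hx⟩, ⟨r, hr⟩⟩
      have hl := tp_lift_mem s hs x.1 x.2 a hx r (by simpa using hr)
      have hxa : (0:ℝ) < x.1 a := hx
      have hsa : s a a = 1 := by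
        have := x.2.2.2 a a a hx hx hx
        rcases hs a a with h | h
        · exact h
        · rw [h] at this; norm_num at this
      apply Prod.ext
      · apply Subtype.ext; apply Subtype.ext; funext b
        exact hl.2 b
      · apply Subtype.ext
        change r * s a a * x.1 a / |r * s a a * x.1 a| = r
        rw [hl.2 a, hsa]; field_simp
    · refine Continuous.prodMk ?_ ?_
      · exact Continuous.subtype_mk ((tpPi_cont s).comp continuous_subtype_val) _
      · refine Continuous.subtype_mk ?_ _
        have hc : Continuous fun y : (tpPi s ⁻¹' {x | 0 < x.1 a}) => y.1.1 a :=
          (continuous_apply a).comp (continuous_subtype_val.comp continuous_subtype_val)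
        exact hc.div hc.abs (fun y => abs_ne_zero.2 (hpos y))
    · refine Continuous.subtype_mk (Continuous.subtype_mk ?_ _) _
      refine continuous_pi fun b => ?_
      have h1 : Continuous fun p : (({x : {x : V → ℝ // tpX s x} | 0 < x.1 a} : Set _) × ({1, -1} : Set ℝ)) => p.1.1.1 b :=
        (continuous_apply b).comp (continuous_subtype_val.comp (continuous_subtype_val.comp continuous_fst))
      have h2 : Continuous fun p : (({x : {x : V → ℝ // tpX s x} | 0 < x.1 a} : Set _) × ({1, -1} : Set ℝ)) => p.2.1 :=
        continuous_subtype_val.comp continuous_snd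
      exact (h2.mul continuous_const).mul h1
  · intro y; rfl

theorem tp_section_star {N : Type*} [NormedAddCommGroup N] [NormedSpace ℝ N] (s : V → V → ℝ)
    (hs : ∀ a b, s a b = 1 ∨ s a b = -1) (A : Set N) (hA : IsOpen A) (p : N) (hp : p ∈ A)
    (hst : StarConvex ℝ p A) (f : N → V → ℝ) (hf : ContinuousOn f A) (hX : ∀ z ∈ A, tpX s (f z)) :
    ∃ S : N → V → ℝ, ContinuousOn S A ∧ ∀ z ∈ A, tpE s (S z) ∧ ∀ a, |S z a| = f z a := by
  haveI : ContractibleSpace A := hst.contractibleSpace ⟨p, hp⟩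
  haveI : LocallyPathConnectedSpace A := hA.locallyPathConnectedSpace
  obtain ⟨a, ha⟩ := (hX p hp).2.1
  have hl := tp_lift_mem s hs (f p) (hX p hp) a ha 1 (Or.inl rfl)
  obtain ⟨F, ⟨-, hF⟩, -⟩ := (tp_covering s hs).existsUnique_continuousMap_lifts
    (A := A) ⟨fun z => (⟨f z.1, hX z.1 z.2⟩ : {x : V → ℝ // tpX s x}),
      Continuous.subtype_mk (continuousOn_iff_continuous_restrict.1 hf) _⟩
    ⟨p, hp⟩ ⟨_, hl.1⟩ (by
      apply Subtype.ext; funext b; exact hl.2 b)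
  refine ⟨fun z => if h : z ∈ A then (F ⟨z, h⟩).1 else 0, ?_, ?_⟩
  · rw [continuousOn_iff_continuous_restrict]
    have : A.domRestrict (fun z => if h : z ∈ A then (F ⟨z, h⟩).1 else 0) = fun z => (F z).1 := by
      funext z
      simp [Set.domRestrict, z.2]
    rw [this]
    exact continuous_subtype_val.comp F.continuous
  · intro z hz
    simp only [hz, dif_pos]
    refine ⟨(F ⟨z, hz⟩).2, fun b => ?_⟩
    have := congrFun hF ⟨z, hz⟩
    have := congrArg Subtype.val this
    exact congrFun this b

theorem tpE.neg {s : V → V → ℝ} {y : V → ℝ} (h : tpE s y) : tpE s (-y) := by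
  refine ⟨?_, ?_⟩
  · have : (fun a => |(-y) a|) = fun a => |y a| := by funext a; simp
    rw [this]; exact h.1
  · intro a b ha hb
    have := h.2 a b (by simpa using ha) (by simpa using hb)
    simpa using this

theorem tpE.eq_or {s : V → V → ℝ} (hs : ∀ a b, s a b = 1 ∨ s a b = -1) {y z : V → ℝ} (hy : tpE s y) (hz : tpE s z)
    (h : ∀ a, |y a| = |z a|) : y = z ∨ y = -z := by
  obtain ⟨a, ha⟩ := hy.1.2.1
  have ha : y a ≠ 0 := abs_pos.1 ha
  have haz : z a ≠ 0 := by rw [← abs_pos, ← h a]; exact abs_pos.2 ha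
  have key : ∀ b, y a * y b = z a * z b := by
    intro b
    by_cases hb : y b = 0
    · have : z b = 0 := by rw [← abs_eq_zero, ← h b, hb]; simp
      rw [hb, this]; simp
    have hbz : z b ≠ 0 := by rw [← abs_pos, ← h b]; exact abs_pos.2 hb
    have h1 := hy.2 a b ha hb
    have h2 := hz.2 a b haz hbz
    have h3 : |y a * y b| = |z a * z b| := by rw [abs_mul, abs_mul, h, h]
    rcases hs a b with h4 | h4 <;> rw [h4] at h1 h2
    · rwa [abs_of_pos (by linarith), abs_of_pos (by linarith)] at h3
    · rw [abs_of_neg (by linarith), abs_of_neg (by linarith)] at h3; linarith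
  rcases abs_eq_abs.1 (h a) with h1 | h1
  · left; funext b
    have := key b
    rw [h1] at this
    exact mul_left_cancel₀ haz this
  · right; funext b
    have := key b
    rw [h1] at this
    apply mul_left_cancel₀ haz
    simp only [Pi.neg_apply]; linarith

theorem tp_section (s : V → V → ℝ)
    (hs : ∀ a b, s a b = 1 ∨ s a b = -1) (f : ℝ × ℂ → V → ℝ) (hf : ContinuousOn f {0}ᶜ)
    (hX : ∀ z, z ≠ 0 → tpX s (f z)) :
    ∃ S : ℝ × ℂ → V → ℝ, ContinuousOn S {0}ᶜ ∧ ∀ z, z ≠ 0 → tpE s (S z) ∧ ∀ a, |S z a| = f z a := by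
  set A : Set (ℝ × ℂ) := {z | 0 < z.1 ∨ z.2 ≠ 0} with hAd
  set B : Set (ℝ × ℂ) := {z | z.1 < 0 ∨ z.2 ≠ 0} with hBd
  have hA : IsOpen A := (isOpen_lt continuous_const continuous_fst).union
    (isOpen_ne_fun continuous_snd continuous_const)
  have hB : IsOpen B := (isOpen_lt continuous_fst continuous_const).union
    (isOpen_ne_fun continuous_snd continuous_const)
  have hA0 : A ⊆ {0}ᶜ := by
    rintro z hz rfl
    rcases hz with h | h <;> simp at h
  have hB0 : B ⊆ {0}ᶜ := by
    rintro z hz rfl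
    rcases hz with h | h <;> simp at h
  have hAB : ∀ z : ℝ × ℂ, z ≠ 0 → z ∈ A ∨ z ∈ B := by
    intro z hz
    by_cases h2 : z.2 = 0
    · have h1 : z.1 ≠ 0 := fun h1 => hz (Prod.ext h1 h2)
      rcases lt_or_gt_of_ne h1 with h | h
      · right; left; exact h
      · left; left; exact h
    · left; right; exact h2
  have hAs : StarConvex ℝ ((1, 0) : ℝ × ℂ) A := by
    rintro z hz a b ha hb hab
    rcases eq_or_lt_of_le hb with h | h
    · left; have : a = 1 := by linarith
      simp [this, ← h]
    · rcases hz with h1 | h1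
      · left; simp; nlinarith [mul_pos h h1]
      · right; simp [h.ne', h1]
  have hBs : StarConvex ℝ ((-1, 0) : ℝ × ℂ) B := by
    rintro z hz a b ha hb hab
    rcases eq_or_lt_of_le hb with h | h
    · left; have : a = 1 := by linarith
      simp [this, ← h]
    · rcases hz with h1 | h1
      · left; simp; nlinarith [mul_pos h (neg_pos.2 h1)]
      · right; simp [h.ne', h1]
  obtain ⟨S, hS, hS'⟩ := tp_section_star s hs A hA (1, 0) (by left; simp) hAs f (hf.mono hA0)
    (fun z hz => hX z (hA0 hz))
  obtain ⟨T, hT, hT'⟩ := tp_section_star s hs B hB (-1, 0) (by left; simp) hBs f (hf.mono hB0)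
    (fun z hz => hX z (hB0 hz))
  have hpre : IsPreconnected (A ∩ B) := by
    have : A ∩ B = Set.univ ×ˢ ({0}ᶜ : Set ℂ) := by
      ext z
      simp only [hAd, hBd, Set.mem_inter_iff, Set.mem_setOf_eq, Set.mem_prod, Set.mem_univ, true_and,
        Set.mem_compl_iff, Set.mem_singleton_iff]
      constructor
      · rintro ⟨h1 | h1, h2 | h2⟩ <;> first | assumption | (exfalso; linarith)
      · intro h; exact ⟨Or.inr h, Or.inr h⟩
    rw [this]
    exact isPreconnected_univ.prod
      (isConnected_compl_singleton_of_one_lt_rank (by simp [Complex.rank_real_complex]) 0).isPreconnected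
  -- choose sign
  have hsign : (∀ z ∈ A ∩ B, S z = T z) ∨ (∀ z ∈ A ∩ B, S z = -T z) := by
    have hg : ContinuousOn (fun z => ∑ a, S z a * T z a) (A ∩ B) := by
      refine continuousOn_finset_sum _ fun a _ => ?_
      refine ContinuousOn.mul ?_ ?_
      · exact (continuous_apply a).comp_continuousOn (hS.mono Set.inter_subset_left)
      · exact (continuous_apply a).comp_continuousOn (hT.mono Set.inter_subset_right)
    have hg2 : ContinuousOn (fun z => ∑ a, T z a * T z a) (A ∩ B) := by
      refine continuousOn_finset_sum _ fun a _ => ?_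
      refine ContinuousOn.mul ?_ ?_
      · exact (continuous_apply a).comp_continuousOn (hT.mono Set.inter_subset_right)
      · exact (continuous_apply a).comp_continuousOn (hT.mono Set.inter_subset_right)
    have hor : ∀ z ∈ A ∩ B, S z = T z ∨ S z = - T z := fun z hz =>
      (hS' z hz.1).1.eq_or hs (hT' z hz.2).1 (fun a => by rw [(hS' z hz.1).2, (hT' z hz.2).2])
    have hpos : ∀ z ∈ A ∩ B, 0 < ∑ a, T z a * T z a := by
      intro z hz
      obtain ⟨a, ha⟩ := (hT' z hz.2).1.1.2.1
      have ha : T z a ≠ 0 := abs_pos.1 ha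
      exact Finset.sum_pos' (fun b _ => mul_self_nonneg _) ⟨a, Finset.mem_univ _, mul_self_pos.2 ha⟩
    rcases hpre.eq_or_eq_neg_of_sq_eq hg hg2 (by
        intro z hz
        rcases hor z hz with h | h <;> simp [h]) (fun hz => (hpos _ hz).ne') with h | h
    · left; intro z hz
      rcases hor z hz with h1 | h1
      · exact h1
      · exfalso
        have h2 := h hz
        have h3 := hpos z hz
        simp only [h1, Pi.neg_apply, neg_mul, Finset.sum_neg_distrib] at h2
        linarith
    · right; intro z hz
      rcases hor z hz with h1 | h1
      · exfalso
        have h2 := h hz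
        have h3 := hpos z hz
        simp only [h1, Pi.neg_apply] at h2
        linarith
      · exact h1
  have main : ∀ T : ℝ × ℂ → V → ℝ, ContinuousOn T B → (∀ z ∈ B, tpE s (T z) ∧ ∀ a, |T z a| = f z a) →
      (∀ z ∈ A ∩ B, S z = T z) → 
      ∃ S : ℝ × ℂ → V → ℝ, ContinuousOn S {0}ᶜ ∧ ∀ z, z ≠ 0 → tpE s (S z) ∧ ∀ a, |S z a| = f z a := by
    intro T hT hT' heq
    have e1 : ∀ z ∈ A, (fun z => if z ∈ A then S z else T z) z = S z := by
      intro z hz; simp [hz]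
    have e2 : ∀ z ∈ B, (fun z => if z ∈ A then S z else T z) z = T z := by
      intro z hz
      by_cases h : z ∈ A
      · simp [h, heq z ⟨h, hz⟩]
      · simp [h]
    refine ⟨fun z => if z ∈ A then S z else T z, ?_, ?_⟩
    · intro z hz
      apply ContinuousAt.continuousWithinAt
      rcases hAB z hz with h | h
      · refine (hS.continuousAt (hA.mem_nhds h)).congr ?_
        filter_upwards [hA.mem_nhds h] with w hw
        exact (e1 w hw).symm
      · refine (hT.continuousAt (hB.mem_nhds h)).congr ?_
        filter_upwards [hB.mem_nhds h] with w hw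
        exact (e2 w hw).symm
    · intro z hz
      rcases hAB z hz with h | h
      · have := e1 z h
        simp only at this ⊢
        rw [this]; exact hS' z h
      · have := e2 z h
        simp only at this ⊢
        rw [this]; exact hT' z h
  rcases hsign with h | h
  · exact main T hT hT' h
  · refine main (fun z => - T z) hT.neg (fun z hz => ⟨(hT' z hz).1.neg, fun a => ?_⟩) h
    simp [(hT' z hz).2 a]

theorem tp_chart {X : Type*} [TopologicalSpace X]
    (e : X ≃ₜ Metric.sphere (0 : EuclideanSpace ℝ (Fin 4)) 1) (q : X) (U : Set X) (hU : IsOpen U)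
    (hq : q ∈ U) :
    ∃ φ : OpenPartialHomeomorph (ℝ × ℂ) X, φ.source = Set.univ ∧ φ 0 = q ∧ φ.target ⊆ U := by
  haveI : Fact (Module.finrank ℝ (EuclideanSpace ℝ (Fin 4)) = 3 + 1) := ⟨by simp⟩
  let st := stereographic' 3 (-(e q))
  have hst1 : st.source = {-(e q)}ᶜ := stereographic'_source _
  have hst2 : st.target = Set.univ := stereographic'_target _
  let ψ : OpenPartialHomeomorph (EuclideanSpace ℝ (Fin 3)) X := st.symm.transHomeomorph e.symm
  have hψ1 : ψ.source = Set.univ := hst2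
  have hq1 : e q ∈ st.source := by
    rw [hst1]
    intro h
    have h : e q = -(e q) := h
    have h2 : ((e q : EuclideanSpace ℝ (Fin 4))) = -(e q : EuclideanSpace ℝ (Fin 4)) :=
      congrArg Subtype.val h
    have h3 : ((e q : EuclideanSpace ℝ (Fin 4))) = 0 := by
      ext i
      have h5 := congrArg (fun z : EuclideanSpace ℝ (Fin 4) => z i) h2
      simp only [PiLp.neg_apply] at h5
      simp only [PiLp.zero_apply]; linarith
    have h4 := (e q).2
    rw [mem_sphere_zero_iff_norm, h3] at h4
    simp at h4
  have hψc : ψ (st (e q)) = q := by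
    change e.symm (st.symm (st (e q))) = q
    rw [st.left_inv hq1]; simp
  have hop : IsOpen (ψ ⁻¹' U) := by
    have hc : Continuous ψ := by
      rw [← continuousOn_univ, ← hψ1]; exact ψ.continuousOn
    exact hU.preimage hc
  obtain ⟨r, hr, hball⟩ := Metric.isOpen_iff.1 hop (st (e q)) (by
    change ψ (st (e q)) ∈ U; rw [hψc]; exact hq)
  let ub := OpenPartialHomeomorph.univBall (st (e q)) r
  let L : (ℝ × ℂ) ≃L[ℝ] EuclideanSpace ℝ (Fin 3) :=
    ContinuousLinearEquiv.ofFinrankEq (by simp [Complex.finrank_real_complex])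
  let φ : OpenPartialHomeomorph (ℝ × ℂ) X :=
    L.toHomeomorph.transOpenPartialHomeomorph (ub.trans ψ)
  have hub : ub.source = Set.univ := OpenPartialHomeomorph.univBall_source _ _
  have hs : φ.source = Set.univ := by
    change L ⁻¹' (ub.trans ψ).source = Set.univ
    rw [OpenPartialHomeomorph.trans_source, hub, hψ1]; simp
  refine ⟨φ, hs, ?_, ?_⟩
  · change ψ (ub (L 0)) = q
    rw [map_zero, OpenPartialHomeomorph.univBall_apply_zero, hψc]
  · intro x hx
    have h1 : φ.symm x ∈ φ.source := φ.map_target hx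
    have h2 : φ (φ.symm x) = x := φ.right_inv hx
    rw [← h2]
    change ψ (ub (L (φ.symm x))) ∈ U
    have : ub (L (φ.symm x)) ∈ ub.target := ub.map_source (by rw [hub]; trivial)
    rw [OpenPartialHomeomorph.univBall_target _ hr] at this
    exact hball this

theorem tp_ivt (g : ℝ → ℝ) (hg : Continuous g) (u v : ℝ) (huv : u ≤ v)
    (h : ∀ t, u ≤ t → t ≤ v → g t ≠ 0) : 0 < g u * g v := by
  by_contra hn
  have hu := h u le_rfl huv
  have hv := h v huv le_rfl
  rcases lt_or_gt_of_ne hu with h1 | h1 <;> rcases lt_or_gt_of_ne hv with h2 | h2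
  · exact hn (mul_pos_of_neg_of_neg h1 h2)
  · obtain ⟨t, ht, h0⟩ := intermediate_value_Icc huv hg.continuousOn ⟨h1.le, h2.le⟩
    exact h t ht.1 ht.2 h0
  · obtain ⟨t, ht, h0⟩ := intermediate_value_Icc' huv hg.continuousOn ⟨h2.le, h1.le⟩
    exact h t ht.1 ht.2 h0
  · exact hn (mul_pos h1 h2)

def tpP (w : V) (δ : ℝ) (a b : V) (t : ℝ) : V → ℝ := fun v =>
  (if v = w then 1 - δ else 0) + ((if v = a then δ * (1 - t) else 0) + (if v = b then δ * t else 0))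

theorem tpP_mem (M : Finset (Finset V)) (w a b : V) (h : ({w, a, b} : Finset V) ∈ M) (δ t : ℝ)
    (hδ : 0 ≤ δ) (hδ1 : δ ≤ 1) (ht : 0 ≤ t) (ht1 : t ≤ 1) : tpP w δ a b t ∈ realization M := by
  refine ⟨⟨_, h, ?_⟩, ?_, ?_⟩
  · intro v hv
    by_contra hn
    simp only [Finset.mem_insert, Finset.mem_singleton, not_or] at hn
    apply hv; simp [tpP, hn]
  · intro v
    have h1 : 0 ≤ 1 - δ := by linarith
    have h2 : 0 ≤ δ * (1 - t) := mul_nonneg hδ (by linarith)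
    have h3 : 0 ≤ δ * t := mul_nonneg hδ ht
    unfold tpP
    refine add_nonneg ?_ (add_nonneg ?_ ?_) <;> split_ifs <;> simp [h1, h2, h3]
  · unfold tpP
    rw [Finset.sum_add_distrib, Finset.sum_add_distrib]
    simp only [Finset.sum_ite_eq', Finset.mem_univ, if_true]
    ring

theorem tp_main (M : Finset (Finset V)) (hM : IsComplex M) (hS : IsTriangulatedSphere 3 M) (w : V)
    (hw : ({w} : Finset V) ∈ M) (s : V → V → ℝ) (hs : ∀ a b, s a b = 1 ∨ s a b = -1)
    (hcoc : ∀ a b d, a ≠ w → b ≠ w → d ≠ w → ({w, a, b, d} : Finset V) ∈ M → s a b * s b d = s a d) :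
    ∃ ε : V → ℝ, (∀ a, ε a = 1 ∨ ε a = -1) ∧
      ∀ a b, a ≠ w → b ≠ w → ({w, a, b} : Finset V) ∈ M → s a b = ε a * ε b := by
  obtain ⟨e⟩ := hS
  have hq : (Pi.single w 1 : V → ℝ) ∈ realization M := by
    refine ⟨⟨_, hw, ?_⟩, ?_, ?_⟩
    · intro v hv
      by_contra hn
      apply hv; simp at hn; simp [hn]
    · intro v; by_cases h : v = w
      · subst h; simp
      · simp [h]
    · simp
  let q : realization M := ⟨_, hq⟩
  have hUo : IsOpen {x : realization M | 0 < x.1 w} :=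
    isOpen_lt continuous_const ((continuous_apply w).comp continuous_subtype_val)
  obtain ⟨φ, hφs, hφ0, hφU⟩ := tp_chart e q {x : realization M | 0 < x.1 w} hUo (by
    change 0 < (Pi.single w 1 : V → ℝ) w; simp)
  have hφc : Continuous φ := by rw [← continuousOn_univ, ← hφs]; exact φ.continuousOn
  have hφt : ∀ z, φ z ∈ φ.target := fun z => φ.map_source (by rw [hφs]; trivial)
  have hφl : ∀ z, φ.symm (φ z) = z := fun z => φ.left_inv (by rw [hφs]; trivial)
  obtain ⟨S, hSc, hS⟩ := tp_section s hs (fun z a => if a = w then 0 else (φ z).1 a) (by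
      apply Continuous.continuousOn
      refine continuous_pi fun a => ?_
      by_cases h : a = w
      · simp only [h, if_true]; exact continuous_const
      · simp only [h, if_false]
        exact (continuous_apply a).comp (continuous_subtype_val.comp hφc)) (by
      intro z hz
      obtain ⟨⟨σ, hσ, hσ'⟩, hn, hsum⟩ := (φ z).2
      refine ⟨?_, ?_, ?_⟩
      · intro a; by_cases h : a = w
        · simp [h]
        · simp [h]; exact hn a
      · by_contra hcon
        push Not at hcon
        have hz0 : ∀ a, a ≠ w → (φ z).1 a = 0 := by
          intro a ha
          have := hcon a
          simp only [ha, if_false] at this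
          exact le_antisymm this (hn a)
        have h1 : (φ z).1 w = 1 := by
          rw [← hsum]; symm
          apply Finset.sum_eq_single w
          · intro b _ hb; exact hz0 b hb
          · simp
        have : φ z = q := by
          apply Subtype.ext; funext a
          change (φ z).1 a = (Pi.single w 1 : V → ℝ) a
          by_cases h : a = w
          · subst h; simp [h1]
          · simp [h, hz0 a h]
        apply hz
        rw [← hφl z, this, ← hφ0, hφl]
      · intro a b d ha hb hd
        have haw : a ≠ w := by rintro rfl; simp at ha
        have hbw : b ≠ w := by rintro rfl; simp at hb
        have hdw : d ≠ w := by rintro rfl; simp at hd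
        simp only [haw, hbw, hdw, if_false] at ha hb hd
        refine hcoc a b d haw hbw hdw (hM σ hσ _ ?_ (by simp))
        have hw' : 0 < (φ z).1 w := hφU (hφt z)
        intro v hv
        simp only [Finset.mem_insert, Finset.mem_singleton] at hv
        apply hσ'
        rcases hv with rfl | rfl | rfl | rfl
        · exact hw'.ne'
        · exact ha.ne'
        · exact hb.ne'
        · exact hd.ne')
  -- small slice
  obtain ⟨r, hr, hball⟩ := Metric.isOpen_iff.1 φ.open_target q (by rw [← hφ0]; exact hφt 0)
  obtain ⟨δ, hδ0, hδr, hδ1⟩ : ∃ δ : ℝ, 0 < δ ∧ δ < r ∧ δ < 1 := by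
    refine ⟨min (r / 2) (1 / 2), by positivity, ?_, ?_⟩
    · exact lt_of_le_of_lt (min_le_left _ _) (by linarith)
    · exact lt_of_le_of_lt (min_le_right _ _) (by norm_num)
  have hslice : ∀ x : realization M, x.1 w = 1 - δ → x ∈ φ.target := by
    intro x hx
    apply hball
    rw [Metric.mem_ball]
    refine lt_of_le_of_lt ?_ hδr
    change dist x.1 (Pi.single w 1 : V → ℝ) ≤ δ
    rw [dist_pi_le_iff hδ0.le]
    intro a
    obtain ⟨-, hn, hsum⟩ := x.2
    by_cases h : a = w
    · subst h; rw [hx]; simp [Real.dist_eq, abs_of_pos hδ0]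
    · have h1 : x.1 a + x.1 w ≤ 1 := by
        rw [← hsum, ← Finset.sum_pair h]
        exact Finset.sum_le_sum_of_subset_of_nonneg (Finset.subset_univ _) (fun i _ _ => hn i)
      simp [h, Real.dist_eq, abs_of_nonneg (hn a)]
      linarith
  -- the lift on slice
  let R : (V → ℝ) → V → ℝ := fun x => if h : x ∈ realization M then S (φ.symm ⟨x, h⟩) else 0
  have hne : ∀ x : realization M, x.1 w = 1 - δ → φ.symm x ≠ 0 := by
    intro x hx h0
    have h1 := φ.right_inv (hslice x hx)
    rw [h0, hφ0] at h1
    have h2 : (Pi.single w 1 : V → ℝ) w = x.1 w := by rw [← h1]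
    rw [hx] at h2
    simp at h2; linarith
  have hR : ∀ x (hx : x ∈ realization M), x w = 1 - δ → tpE s (R x) ∧ ∀ a, a ≠ w → |R x a| = x a := by
    intro x hx hxw
    have h1 := hS _ (hne ⟨x, hx⟩ hxw)
    simp only [R, hx, dif_pos]
    refine ⟨h1.1, fun a ha => ?_⟩
    have h2 := h1.2 a
    rw [φ.right_inv (hslice ⟨x, hx⟩ hxw)] at h2
    simpa [ha] using h2
  have hcont : ∀ (a b c : V), a ≠ w → b ≠ w → ({w, a, b} : Finset V) ∈ M →
      Continuous fun t : ℝ => R (tpP w δ a b (max 0 (min 1 t))) c := by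
    intro a b c ha hb hab
    have hmem : ∀ t : ℝ, tpP w δ a b (max 0 (min 1 t)) ∈ realization M := fun t =>
      tpP_mem M w a b hab δ _ hδ0.le hδ1.le (le_max_left _ _)
        (max_le zero_le_one (min_le_left _ _))
    have hval : ∀ t : ℝ, tpP w δ a b (max 0 (min 1 t)) w = 1 - δ := by
      intro t; simp [tpP, Ne.symm ha, Ne.symm hb]
    have hγ : Continuous fun t : ℝ => (⟨_, hmem t⟩ : realization M) := by
      refine Continuous.subtype_mk ?_ _
      refine continuous_pi fun v => ?_
      have hm : Continuous fun t : ℝ => max 0 (min 1 t) := by fun_prop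
      unfold tpP
      refine continuous_const.add (Continuous.add ?_ ?_)
      · by_cases h : v = a
        · simp only [h, if_true]; fun_prop
        · simp only [h, if_false]; exact continuous_const
      · by_cases h : v = b
        · simp only [h, if_true]; fun_prop
        · simp only [h, if_false]; exact continuous_const
    have h2 : Continuous fun t : ℝ => φ.symm (⟨_, hmem t⟩ : realization M) :=
      φ.continuousOn_symm.comp_continuous hγ (fun t => hslice _ (hval t))
    have h3 : Continuous fun t : ℝ => S (φ.symm (⟨_, hmem t⟩ : realization M)) :=
      hSc.comp_continuous h2 (fun t => hne _ (hval t))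
    have h4 : (fun t : ℝ => R (tpP w δ a b (max 0 (min 1 t))) c) =
        fun t : ℝ => S (φ.symm (⟨_, hmem t⟩ : realization M)) c := by
      funext t; simp only [R, hmem t, dif_pos]
    rw [h4]
    exact (continuous_apply c).comp h3
  have hval : ∀ a b t, a ≠ w → b ≠ w → tpP w δ a b t w = 1 - δ := by
    intro a b t ha hb; simp [tpP, Ne.symm ha, Ne.symm hb]
  refine ⟨fun a => if 0 < R (tpP w δ a a 0) a then 1 else -1, ?_, ?_⟩
  · intro a; dsimp only; split_ifs <;> simp
  · intro a b ha hb hab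
    show s a b = (if 0 < R (tpP w δ a a 0) a then (1 : ℝ) else -1) *
      (if 0 < R (tpP w δ b b 0) b then (1 : ℝ) else -1)
    by_cases heq : a = b
    · subst heq
      have h1 := hcoc a a a ha ha ha (by simpa using hab)
      have h2 : s a a = 1 := by
        rcases hs a a with h | h
        · exact h
        · rw [h] at h1; norm_num at h1
      rw [h2]; split_ifs <;> norm_num
    have hcl : ∀ t : ℝ, 0 ≤ t → t ≤ 1 → max 0 (min 1 t) = t := by
      intro t h0 h1; rw [min_eq_right h1, max_eq_right h0]
    have hm : ∀ t : ℝ, 0 ≤ t → t ≤ 1 → _ := fun t h0 h1 =>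
      hR _ (tpP_mem M w a b hab δ t hδ0.le hδ1.le h0 h1) (hval a b t ha hb)
    have hA : 0 < R (tpP w δ a b 0) a * R (tpP w δ a b (1/2)) a := by
      have := tp_ivt _ (hcont a b a ha hb hab) 0 (1/2) (by norm_num) (by
        intro t h0 h1 hz
        rw [hcl t h0 (by linarith)] at hz
        have h2 := (hm t h0 (by linarith)).2 a ha
        rw [hz] at h2
        simp [tpP, ha, heq] at h2
        rcases h2 with h2 | h2 <;> linarith)
      rw [hcl (1/2) (by norm_num) (by norm_num), hcl 0 (by norm_num) (by norm_num)] at this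
      exact this
    have hB : 0 < R (tpP w δ a b (1/2)) b * R (tpP w δ a b 1) b := by
      have := tp_ivt _ (hcont a b b ha hb hab) (1/2) 1 (by norm_num) (by
        intro t h0 h1 hz
        rw [hcl t (by linarith) h1] at hz
        have h2 := (hm t (by linarith) h1).2 b hb
        rw [hz] at h2
        simp [tpP, hb, Ne.symm heq] at h2
        rcases h2 with h2 | h2 <;> linarith)
      rw [hcl (1/2) (by norm_num) (by norm_num), hcl 1 (by norm_num) (by norm_num)] at this
      exact this
    have eA : tpP w δ a b 0 = tpP w δ a a 0 := by funext v; simp [tpP]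
    have eB : tpP w δ a b 1 = tpP w δ b b 0 := by funext v; simp [tpP]
    rw [eA] at hA
    rw [eB] at hB
    have hmid := (hm (1/2) (by norm_num) (by norm_num)).1.2 a b
      (by rintro h; rw [h] at hA; simp at hA) (by rintro h; rw [h] at hB; simp at hB)
    generalize R (tpP w δ a a 0) a = x at *
    generalize R (tpP w δ b b 0) b = y at *
    generalize R (tpP w δ a b (1/2)) a = u at *
    generalize R (tpP w δ a b (1/2)) b = v at *
    have key : 0 < x * y * s a b := by
      have h1 : 0 < (x * u) * (v * y) * (u * v * s a b) := by positivity
      have h2 : (x * u) * (v * y) * (u * v * s a b) = (u * v) ^ 2 * (x * y * s a b) := by ring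
      rw [h2] at h1
      exact pos_of_mul_pos_right h1 (sq_nonneg _)
    clear * - key hs hA hB
    have hx : x ≠ 0 := by rintro rfl; simp at hA
    have hy : y ≠ 0 := by rintro rfl; simp at hB
    rcases lt_or_gt_of_ne hx with h | h <;> rcases lt_or_gt_of_ne hy with h' | h' <;>
      rcases hs a b with h2 | h2 <;> rw [h2] at key ⊢ <;>
      first
      | (simp [h, h', h.le, h'.le]; done)
      | (simp [not_lt.2 h.le, not_lt.2 h'.le]; done)
      | (simp [not_lt.2 h.le, h']; done)
      | (simp [h, not_lt.2 h'.le]; done)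
      | (exfalso; nlinarith [mul_pos_of_neg_of_neg h h'])
      | (exfalso; nlinarith [mul_pos h h'])
      | (exfalso; nlinarith [mul_neg_of_neg_of_pos h h'])
      | (exfalso; nlinarith [mul_neg_of_pos_of_neg h h'])

theorem sf_sum {ι : Type*} [Fintype ι] [DecidableEq ι] (P Q : ι → Prop) [Fintype {x // P x}]
    (dQ : ∀ p : {x // P x}, Decidable (Q p.1)) (F : ι → ZMod 2) (S : Finset ι)
    (hS : ∀ x, x ∈ S ↔ P x ∧ Q x) :
    ∑ p : {x // P x}, (if Q p.1 then F p.1 else 0) = ∑ x ∈ S, F x := by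
  rw [← Finset.sum_filter]
  apply Finset.sum_bij (fun p _ => p.1)
  · intro p hp
    rw [Finset.mem_filter] at hp
    exact (hS _).2 ⟨p.2, hp.2⟩
  · intro p _ q _ h; exact Subtype.ext h
  · intro x hx
    have := (hS x).1 hx
    exact ⟨⟨x, this.1⟩, by rw [Finset.mem_filter]; exact ⟨Finset.mem_univ _, this.2⟩, rfl⟩
  · intro p _; rfl

def sfM {ι : Type*} {κ : Type*} (P : ι → Prop) (P' : κ → Prop) (R : κ → ι → Prop) [Fintype {x // P x}] :
    ({x // P x} → ZMod 2) →ₗ[ZMod 2] ({y // P' y} → ZMod 2) :=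
  Matrix.mulVecLin (Matrix.of fun y x => if R y.1 x.1 then 1 else 0)

theorem sfM_apply {ι : Type*} {κ : Type*} (P : ι → Prop) (P' : κ → Prop) (R : κ → ι → Prop)
    [Fintype {x // P x}] (g : {x // P x} → ZMod 2) (y : κ) (hy : P' y) :
    sfM P P' R g ⟨y, hy⟩ = ∑ x, @ite _ (R y x.1) (Classical.propDecidable _) (g x) 0 := by
  simp [sfM, Matrix.mulVec, dotProduct]

theorem sf_ker0 (L : Finset (Finset V)) (hL : IsComplex L) (hc : ComplexConnected L) 
    (a0 : V) (ha0 : {a0} ∈ L) :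
    Module.finrank (ZMod 2) (LinearMap.ker (sfM (fun a : V => {a} ∈ L)
      (fun e : Finset V => e ∈ L ∧ e.card = 2) (fun e a => a ∈ e))) = 1 := by
  have : LinearMap.ker (sfM (fun a : V => {a} ∈ L)
      (fun e : Finset V => e ∈ L ∧ e.card = 2) (fun e a => a ∈ e)) = Submodule.span (ZMod 2) {fun _ => 1} := by
    ext g
    rw [LinearMap.mem_ker, Submodule.mem_span_singleton]
    have key : ∀ a b (ha : {a} ∈ L) (hb : {b} ∈ L) (hne : a ≠ b) (hab : ({a, b} : Finset V) ∈ L),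
        sfM (fun a : V => {a} ∈ L) (fun e : Finset V => e ∈ L ∧ e.card = 2) (fun e a => a ∈ e) g
          ⟨{a, b}, hab, Finset.card_pair hne⟩ = g ⟨a, ha⟩ + g ⟨b, hb⟩ := by
      intro a b ha hb hne hab
      rw [sfM_apply]
      have h1 := sf_sum (fun a : V => {a} ∈ L) (fun x => x ∈ ({a, b} : Finset V)) (fun _ => Classical.propDecidable _)
        (fun x => if h : {x} ∈ L then g ⟨x, h⟩ else 0) {a, b} (by
          intro x
          constructor
          · intro hx; refine ⟨?_, hx⟩
            simp only [Finset.mem_insert, Finset.mem_singleton] at hx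
            rcases hx with rfl | rfl <;> assumption
          · exact fun h => h.2)
      rw [Finset.sum_pair hne] at h1
      simp only [ha, hb, dif_pos] at h1
      rw [← h1]
      apply Finset.sum_congr rfl
      rintro ⟨x, hx⟩ _
      simp [hx]
    constructor
    · intro hg
      refine ⟨g ⟨a0, ha0⟩, ?_⟩
      have : ∀ b, Relation.ReflTransGen (fun a b => ({a, b} : Finset V) ∈ L) a0 b →
          ∀ hb : {b} ∈ L, g ⟨b, hb⟩ = g ⟨a0, ha0⟩ := by
        intro b hb
        induction hb with
        | refl => intro _; rfl
        | tail h1 h2 ih =>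
          rename_i x y
          intro hy
          have hx : {x} ∈ L := hL _ h2 _ (by simp) (by simp)
          rw [← ih hx]
          by_cases hxy : x = y
          · subst hxy; rfl
          have h3 := key x y hx hy hxy h2
          rw [hg] at h3
          have h4 : g ⟨x, hx⟩ + g ⟨y, hy⟩ = 0 := h3.symm
          exact (CharTwo.add_eq_zero.1 h4).symm
      funext b
      simp only [Pi.smul_apply, smul_eq_mul, mul_one]
      exact (this b.1 (hc.2 _ _ ha0 b.2) b.2).symm
    · rintro ⟨c, rfl⟩
      rw [map_smul]
      convert smul_zero c
      funext ⟨e, he⟩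
      obtain ⟨a, b, hab, rfl⟩ := Finset.card_eq_two.1 he.2
      have ha : {a} ∈ L := hL _ he.1 _ (by simp) (by simp)
      have hb : {b} ∈ L := hL _ he.1 _ (by simp) (by simp)
      rw [sfM_apply]
      have h1 := sf_sum (fun a : V => {a} ∈ L) (fun x => x ∈ ({a, b} : Finset V)) (fun _ => Classical.propDecidable _)
        (fun x => 1) {a, b} (by
          intro x
          constructor
          · intro hx; refine ⟨?_, hx⟩
            simp only [Finset.mem_insert, Finset.mem_singleton] at hx
            rcases hx with rfl | rfl <;> assumption
          · exact fun h => h.2)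
      rw [h1, Finset.sum_pair hab]; rfl
  rw [this]
  apply finrank_span_singleton
  intro h
  have := congrFun h ⟨a0, ha0⟩
  simp at this

theorem sf_triple (a b d : V) (hab : a ≠ b) (hbd : b ≠ d) (had : a ≠ d) (e : Finset V) :
    e ⊆ {a, b, d} ∧ e.card = 2 ↔ e ∈ ({{a, b}, {b, d}, {a, d}} : Finset (Finset V)) := by
  constructor
  · rintro ⟨h1, h2⟩
    obtain ⟨x, y, hxy, rfl⟩ := Finset.card_eq_two.1 h2
    have hx := h1 (show x ∈ ({x, y} : Finset V) by simp)
    have hy := h1 (show y ∈ ({x, y} : Finset V) by simp)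
    simp only [Finset.mem_insert, Finset.mem_singleton] at hx hy ⊢
    rcases hx with rfl | rfl | rfl <;> rcases hy with rfl | rfl | rfl <;>
      simp_all [Finset.pair_comm]
  · intro h
    simp only [Finset.mem_insert, Finset.mem_singleton] at h
    rcases h with rfl | rfl | rfl
    · exact ⟨by intro x; simp; tauto, Finset.card_pair hab⟩
    · exact ⟨by intro x; simp; tauto, Finset.card_pair hbd⟩
    · exact ⟨by intro x; simp; tauto, Finset.card_pair had⟩

theorem sf_range1 (L : Finset (Finset V)) (hs : StronglyConnected 2 L) (hL : IsComplex L)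
    (h2 : ∀ σ ∈ L, σ.card = 2 → (L.filter (fun τ => σ ⊆ τ ∧ τ.card = 3)).card = 2)
    (T0 : Finset V) (hT0 : T0 ∈ L ∧ T0.card = 3) :
    Module.finrank (ZMod 2) (LinearMap.range (sfM (fun e : Finset V => e ∈ L ∧ e.card = 2)
      (fun T : Finset V => T ∈ L ∧ T.card = 3) (fun T e => e ⊆ T))) + 1 =
    Fintype.card {T : Finset V // T ∈ L ∧ T.card = 3} := by
  set P2 : Finset V → Prop := fun T => T ∈ L ∧ T.card = 3 with hP2
  set P1 : Finset V → Prop := fun e => e ∈ L ∧ e.card = 2 with hP1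
  set D := sfM P1 P2 (fun T e => e ⊆ T) with hD
  let sm : ({T // P2 T} → ZMod 2) →ₗ[ZMod 2] ZMod 2 :=
    { toFun := fun g => ∑ T, g T
      map_add' := fun g h => by simp [Finset.sum_add_distrib]
      map_smul' := fun c g => by simp [Finset.mul_sum] }
  have hsm : ∀ g, sm g = ∑ T, g T := fun g => rfl
  have hrange : LinearMap.range D = LinearMap.ker sm := by
    apply le_antisymm
    · rintro _ ⟨h, rfl⟩
      rw [LinearMap.mem_ker, hsm]
      have : ∀ T : {T // P2 T}, D h T = ∑ x, @ite _ (x.1 ⊆ T.1) (Classical.propDecidable _) (h x) 0 :=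
        fun T => sfM_apply _ _ _ h T.1 T.2
      simp only [this]
      rw [Finset.sum_comm]
      apply Finset.sum_eq_zero
      rintro ⟨e, he⟩ _
      have h1 := sf_sum P2 (fun T => e ⊆ T) (fun _ => Classical.propDecidable _) (fun _ => h ⟨e, he⟩)
        (L.filter (fun τ => e ⊆ τ ∧ τ.card = 3)) (by
          intro x; simp only [Finset.mem_filter, hP2]; tauto)
      refine Eq.trans h1 ?_
      rw [Finset.sum_const, h2 e he.1 he.2]
      rw [two_nsmul]; exact CharTwo.add_self_eq_zero _
    · -- adjacent differences
      have hadj : ∀ T T' (hT : P2 T) (hT' : P2 T'), (T ∩ T').card = 2 →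
          (Pi.single ⟨T, hT⟩ 1 + Pi.single ⟨T', hT'⟩ 1 : {T // P2 T} → ZMod 2) ∈ LinearMap.range D := by
        intro T T' hT hT' hc
        have hne : T ≠ T' := by
          rintro rfl; rw [Finset.inter_self, hT.2] at hc; omega
        have he : P1 (T ∩ T') := ⟨hL _ hT.1 _ Finset.inter_subset_left (by
          rw [← Finset.card_pos]; omega), hc⟩
        refine ⟨Pi.single ⟨T ∩ T', he⟩ 1, ?_⟩
        funext ⟨U, hU⟩
        have hLHS : D (Pi.single ⟨T ∩ T', he⟩ 1) ⟨U, hU⟩ = if T ∩ T' ⊆ U then 1 else 0 := by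
          rw [hD, sfM_apply]
          rw [Finset.sum_eq_single ⟨T ∩ T', he⟩]
          · simp
          · rintro b _ hb; simp [hb]
          · simp
        rw [hLHS]
        have hset : L.filter (fun τ => T ∩ T' ⊆ τ ∧ τ.card = 3) = {T, T'} := by
          symm
          apply Finset.eq_of_subset_of_card_le
          · intro x hx
            simp only [Finset.mem_insert, Finset.mem_singleton] at hx
            rcases hx with rfl | rfl
            · exact Finset.mem_filter.2 ⟨hT.1, Finset.inter_subset_left, hT.2⟩
            · exact Finset.mem_filter.2 ⟨hT'.1, Finset.inter_subset_right, hT'.2⟩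
          · rw [h2 _ he.1 he.2, Finset.card_pair hne]
        have hiff : T ∩ T' ⊆ U ↔ U = T ∨ U = T' := by
          have : U ∈ L.filter (fun τ => T ∩ T' ⊆ τ ∧ τ.card = 3) ↔ U ∈ ({T, T'} : Finset (Finset V)) := by
            rw [hset]
          simp only [Finset.mem_filter, Finset.mem_insert, Finset.mem_singleton] at this
          rw [← this]
          exact ⟨fun h => ⟨hU.1, h, hU.2⟩, fun h => h.2.1⟩
        simp only [Pi.add_apply, Pi.single_apply, Subtype.mk.injEq, hiff]
        by_cases h1 : U = T
        · subst h1; simp [hne]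
        · simp [h1]
      have hall : ∀ T (hT : P2 T), 
          (Pi.single ⟨T, hT⟩ 1 + Pi.single ⟨T0, hT0⟩ 1 : {T // P2 T} → ZMod 2) ∈ LinearMap.range D := by
        intro T hT
        have := hs T0 hT0.1 T hT.1 hT0.2 hT.2
        revert hT
        induction this with
        | refl =>
          intro _
          convert Submodule.zero_mem _
          funext x
          simp only [Pi.add_apply, Pi.zero_apply]
          exact CharTwo.add_self_eq_zero _
        | tail h1 h2 ih =>
          rename_i x y
          intro hT
          have hx : P2 x := ⟨h2.1, h2.2.2.1⟩
          have h3 := Submodule.add_mem _ (ih hx) (hadj x y hx hT h2.2.2.2.2)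
          convert h3 using 1
          funext z
          simp only [Pi.add_apply]
          have := CharTwo.add_self_eq_zero (Pi.single (M := fun _ => ZMod 2) (⟨x, hx⟩ : {T // P2 T}) 1 z)
          linear_combination -this
      intro g hg
      rw [LinearMap.mem_ker, hsm] at hg
      have : g = ∑ T, g T • (Pi.single T 1 + Pi.single ⟨T0, hT0⟩ 1 : {T // P2 T} → ZMod 2) := by
        have e1 : ∑ T, g T • (Pi.single T 1 + Pi.single ⟨T0, hT0⟩ 1 : {T // P2 T} → ZMod 2)
          = ∑ T, g T • (Pi.single T 1 : {T // P2 T} → ZMod 2) + (∑ T, g T) • (Pi.single ⟨T0, hT0⟩ 1) := by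
          simp only [smul_add]
          rw [Finset.sum_add_distrib, Finset.sum_smul]
        rw [e1, hg, zero_smul, add_zero]
        funext U
        simp [Finset.sum_apply, Pi.single_apply]
      rw [this]
      exact Submodule.sum_mem _ fun T _ => Submodule.smul_mem _ _ (hall T.1 T.2)
  rw [hrange]
  have hr : LinearMap.range sm = ⊤ := by
    rw [LinearMap.range_eq_top]
    intro c
    refine ⟨Pi.single ⟨T0, hT0⟩ c, ?_⟩
    rw [hsm]; simp
  have := LinearMap.finrank_range_add_finrank_ker sm
  rw [hr, finrank_top] at this
  rw [Module.finrank_self, Module.finrank_fintype_fun_eq_card] at this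
  rw [add_comm, this]

theorem sf_exact (L : Finset (Finset V)) (hL : IsComplex L)
    (hH : ∀ h : V → V → ZMod 2, (∀ a b d, ({a, b, d} : Finset V) ∈ L → h a b + h b d = h a d) →
      ∃ g : V → ZMod 2, ∀ a b, ({a, b} : Finset V) ∈ L → h a b = g a + g b)
    (hp : IsPure 2 L)
    (h2 : ∀ σ ∈ L, σ.card = 2 → (L.filter (fun τ => σ ⊆ τ ∧ τ.card = 3)).card = 2) :
    LinearMap.range (sfM (fun a : V => {a} ∈ L)
      (fun e : Finset V => e ∈ L ∧ e.card = 2) (fun e a => a ∈ e)) =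
    LinearMap.ker (sfM (fun e : Finset V => e ∈ L ∧ e.card = 2)
      (fun T : Finset V => T ∈ L ∧ T.card = 3) (fun T e => e ⊆ T)) := by
  have hpair : ∀ (F : {a : V // {a} ∈ L} → ZMod 2) (a b : V) (hne : a ≠ b) (hab : ({a, b} : Finset V) ∈ L)
      (ha : {a} ∈ L) (hb : {b} ∈ L),
      (∑ x : {a : V // {a} ∈ L}, @ite _ (x.1 ∈ ({a, b} : Finset V)) (Classical.propDecidable _) (F x) 0) = F ⟨a, ha⟩ + F ⟨b, hb⟩ := by
    intro F a b hne hab ha hb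
    have h1 := sf_sum (fun a : V => {a} ∈ L) (fun x => x ∈ ({a, b} : Finset V)) (fun _ => Classical.propDecidable _)
        (fun x => if h : {x} ∈ L then F ⟨x, h⟩ else 0) {a, b} (by
          intro x
          constructor
          · intro hx; refine ⟨?_, hx⟩
            simp only [Finset.mem_insert, Finset.mem_singleton] at hx
            rcases hx with rfl | rfl <;> assumption
          · exact fun h => h.2)
    rw [Finset.sum_pair hne] at h1
    simp only [ha, hb, dif_pos] at h1
    rw [← h1]
    apply Finset.sum_congr rfl
    rintro ⟨x, hx⟩ _
    simp [hx]
  have htri : ∀ (F : {e : Finset V // e ∈ L ∧ e.card = 2} → ZMod 2) (G : Finset V → ZMod 2)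
      (hG : ∀ e he, F ⟨e, he⟩ = G e) (a b d : V)
      (hab : a ≠ b) (hbd : b ≠ d) (had : a ≠ d) (habd : ({a, b, d} : Finset V) ∈ L),
      (∑ x : {e : Finset V // e ∈ L ∧ e.card = 2}, @ite _ (x.1 ⊆ ({a, b, d} : Finset V)) (Classical.propDecidable _) (F x) 0) =
        G {a, b} + (G {b, d} + G {a, d}) := by
    intro F G hG a b d hab hbd had habd
    have h1 := sf_sum (fun e : Finset V => e ∈ L ∧ e.card = 2) (fun e => e ⊆ ({a, b, d} : Finset V)) (fun _ => Classical.propDecidable _) G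
      {{a, b}, {b, d}, {a, d}} (by
        intro x
        rw [← sf_triple a b d hab hbd had x]
        constructor
        · rintro ⟨h, h'⟩
          exact ⟨⟨hL _ habd _ h (by rw [← Finset.card_pos]; omega), h'⟩, h⟩
        · rintro ⟨⟨h, h'⟩, h''⟩
          exact ⟨h'', h'⟩)
    have n1 : ({a, b} : Finset V) ∉ ({{b, d}, {a, d}} : Finset (Finset V)) := by
      simp only [Finset.mem_insert, Finset.mem_singleton, not_or]
      constructor
      · intro h
        have : a ∈ ({b, d} : Finset V) := by rw [← h]; simp
        simp [hab, had] at this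
      · intro h
        have : b ∈ ({a, d} : Finset V) := by rw [← h]; simp
        simp [hab.symm, hbd] at this
    have n2 : ({b, d} : Finset V) ≠ {a, d} := by
      intro h
      have : b ∈ ({a, d} : Finset V) := by rw [← h]; simp
      simp [hab.symm, hbd] at this
    rw [Finset.sum_insert n1, Finset.sum_pair n2] at h1
    rw [← h1]
    apply Finset.sum_congr rfl
    rintro ⟨x, hx⟩ _
    simp [hG x hx]
  apply le_antisymm
  · rintro _ ⟨g, rfl⟩
    rw [LinearMap.mem_ker]
    funext ⟨T, hT⟩
    obtain ⟨a, b, d, hab, had, hbd, rfl⟩ := Finset.card_eq_three.1 hT.2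
    have ha : {a} ∈ L := hL _ hT.1 _ (by simp) (by simp)
    have hb : {b} ∈ L := hL _ hT.1 _ (by simp) (by simp)
    have hd : {d} ∈ L := hL _ hT.1 _ (by simp) (by simp)
    have e1 : ({a, b} : Finset V) ∈ L := hL _ hT.1 _ (by intro x; simp; tauto) (by simp)
    have e2 : ({b, d} : Finset V) ∈ L := hL _ hT.1 _ (by intro x; simp; tauto) (by simp)
    have e3 : ({a, d} : Finset V) ∈ L := hL _ hT.1 _ (by intro x; simp; tauto) (by simp)
    rw [sfM_apply]
    rw [htri _ (fun e => ∑ x : {a : V // {a} ∈ L}, @ite _ (x.1 ∈ e) (Classical.propDecidable _) (g x) 0)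
      (fun e he => by rw [sfM_apply]) a b d hab hbd had hT.1]
    rw [hpair g a b hab e1 ha hb, hpair g b d hbd e2 hb hd, hpair g a d had e3 ha hd]
    have h1 := CharTwo.add_self_eq_zero (g ⟨a, ha⟩)
    have h2 := CharTwo.add_self_eq_zero (g ⟨b, hb⟩)
    have h3 := CharTwo.add_self_eq_zero (g ⟨d, hd⟩)
    simp only [Pi.zero_apply]
    linear_combination h1 + h2 + h3
  · intro h hh
    rw [LinearMap.mem_ker] at hh
    let G : Finset V → ZMod 2 := fun e => if he : e ∈ L ∧ e.card = 2 then h ⟨e, he⟩ else 0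
    have hG : ∀ e he, h ⟨e, he⟩ = G e := by intro e he; simp only [G, he, and_self, dif_pos]
    have hG1 : ∀ a, G {a, a} = 0 := by
      intro a; simp [G]
    obtain ⟨g, hg⟩ := hH (fun a b => G {a, b}) (by
      intro a b d habd
      by_cases hab : a = b
      · subst hab; simp only [hG1, zero_add]
      by_cases hbd : b = d
      · subst hbd; simp only [hG1, add_zero]
      by_cases had : a = d
      · subst had
        simp only [hG1]
        rw [Finset.pair_comm b a]; exact CharTwo.add_self_eq_zero _
      have h3 : ({a, b, d} : Finset V).card = 3 := by
        rw [Finset.card_eq_three]; exact ⟨a, b, d, hab, had, hbd, rfl⟩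
      have h1 := congrFun hh ⟨{a, b, d}, habd, h3⟩
      rw [sfM_apply, htri h G hG a b d hab hbd had habd] at h1
      simp only [Pi.zero_apply] at h1
      have h4 := CharTwo.add_self_eq_zero (G {a, d})
      linear_combination h1 - h4)
    refine ⟨fun a => g a.1, ?_⟩
    funext ⟨e, he⟩
    obtain ⟨a, b, hab, rfl⟩ := Finset.card_eq_two.1 he.2
    have ha : {a} ∈ L := hL _ he.1 _ (by simp) (by simp)
    have hb : {b} ∈ L := hL _ he.1 _ (by simp) (by simp)
    rw [sfM_apply, hpair (fun a => g a.1) a b hab he.1 ha hb, hG, hg a b he.1]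

theorem sf_euler (L : Finset (Finset V)) (hL : IsComplex L)
    (hH : ∀ h : V → V → ZMod 2, (∀ a b d, ({a, b, d} : Finset V) ∈ L → h a b + h b d = h a d) →
      ∃ g : V → ZMod 2, ∀ a b, ({a, b} : Finset V) ∈ L → h a b = g a + g b)
    (hp : IsPure 2 L) (hc : ComplexConnected L) (hs : StronglyConnected 2 L)
    (h2 : ∀ σ ∈ L, σ.card = 2 → (L.filter (fun τ => σ ⊆ τ ∧ τ.card = 3)).card = 2) :
    fNum 0 L + fNum 2 L = fNum 1 L + 2 := by
  obtain ⟨σ, hσ⟩ := hc.1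
  obtain ⟨T, hT, -, hT3⟩ := hp σ hσ
  obtain ⟨a, ha⟩ : T.Nonempty := by rw [← Finset.card_pos]; omega
  have haL : {a} ∈ L := hL _ hT _ (by simpa using ha) (by simp)
  have r0 := sf_ker0 L hL hc a haL
  have r1 := sf_range1 L hs hL h2 T ⟨hT, hT3⟩
  have n0 := LinearMap.finrank_range_add_finrank_ker (sfM (fun a : V => {a} ∈ L)
      (fun e : Finset V => e ∈ L ∧ e.card = 2) (fun e a => a ∈ e))
  have n1 := LinearMap.finrank_range_add_finrank_ker (sfM (fun e : Finset V => e ∈ L ∧ e.card = 2)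
      (fun T : Finset V => T ∈ L ∧ T.card = 3) (fun T e => e ⊆ T))
  rw [sf_exact L hL hH hp h2, r0, Module.finrank_fintype_fun_eq_card] at n0
  rw [Module.finrank_fintype_fun_eq_card] at n1
  have c0 : (facesOfDim 0 L).card = Fintype.card {a : V // {a} ∈ L} := by
    rw [Fintype.card_subtype]
    symm
    apply Finset.card_bij (fun a _ => {a})
    · intro a ha; simp [facesOfDim] at ha ⊢; exact ha
    · intro a _ b _ h; simpa using h
    · intro e he
      simp only [facesOfDim, Finset.mem_filter] at he
      obtain ⟨a, rfl⟩ := Finset.card_eq_one.1 he.2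
      exact ⟨a, by simp [he.1], rfl⟩
  have c1 : (facesOfDim 1 L).card = Fintype.card {e : Finset V // e ∈ L ∧ e.card = 2} := by
    rw [Fintype.card_subtype]; congr 1; ext e; simp [facesOfDim]
  have c2 : (facesOfDim 2 L).card = Fintype.card {e : Finset V // e ∈ L ∧ e.card = 3} := by
    rw [Fintype.card_subtype]; congr 1; ext e; simp [facesOfDim]
  unfold fNum
  rw [c0, c1, c2]
  omega

/-- the topological input in `ZMod 2` form -/
theorem sf_H1 (M : Finset (Finset V)) (hM : IsComplex M) (hS : IsTriangulatedSphere 3 M) (w : V)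
    (hw : ({w} : Finset V) ∈ M) (h : V → V → ZMod 2)
    (hh : ∀ a b d, a ≠ w → b ≠ w → d ≠ w → ({w, a, b, d} : Finset V) ∈ M → h a b + h b d = h a d) :
    ∃ g : V → ZMod 2, ∀ a b, a ≠ w → b ≠ w → ({w, a, b} : Finset V) ∈ M → h a b = g a + g b := by
  let χ : ZMod 2 → ℝ := fun x => if x = 0 then 1 else -1
  have hχ : ∀ x, χ x = 1 ∨ χ x = -1 := by intro x; simp only [χ]; split_ifs <;> simp
  have hz : ∀ x : ZMod 2, x = 0 ∨ x = 1 := by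
    decide
  have hadd : ∀ x y, χ (x + y) = χ x * χ y := by
    intro x y
    have : (1 : ZMod 2) + 1 = 0 := by rfl
    rcases hz x with rfl | rfl <;> rcases hz y with rfl | rfl <;> simp [χ, this]
  have hinj : ∀ x y, χ x = χ y → x = y := by
    intro x y
    rcases hz x with rfl | rfl <;> rcases hz y with rfl | rfl <;> simp [χ] <;> norm_num
  obtain ⟨ε, hε, hε'⟩ := tp_main M hM hS w hw (fun a b => χ (h a b)) (fun a b => hχ _) (by
    intro a b d ha hb hd habd
    rw [← hadd, hh a b d ha hb hd habd])
  refine ⟨fun a => if ε a = 1 then 0 else 1, fun a b ha hb hab => ?_⟩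
  apply hinj
  rw [hadd]
  have h1 := hε' a b ha hb hab
  rw [h1]
  have h2 : ∀ a, χ (if ε a = 1 then 0 else 1) = ε a := by
    intro a
    rcases hε a with h | h
    · simp [h, χ]
    · rw [if_neg (by rw [h]; norm_num)]; simp [χ, h]
  rw [h2, h2]

theorem mem_vertexLink {K : Finset (Finset V)} {t : V} {γ : Finset V} :
    γ ∈ vertexLink t K ↔ γ ∈ K ∧ t ∉ γ ∧ insert t γ ∈ K := by
  simp [vertexLink]

theorem cn_link {K : Finset (Finset V)} (hK : IsComplex K) {t : V} {γ : Finset V} (hγ : γ.Nonempty) :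
    γ ∈ vertexLink t K ↔ t ∉ γ ∧ insert t γ ∈ K := by
  rw [mem_vertexLink]
  constructor
  · exact fun h => h.2
  · exact fun h => ⟨hK _ h.2 _ (Finset.subset_insert _ _) hγ, h⟩

theorem cn_link_complex {K : Finset (Finset V)} (hK : IsComplex K) (t : V) :
    IsComplex (vertexLink t K) := by
  intro σ hσ τ hτ hne
  rw [mem_vertexLink] at hσ
  rw [cn_link hK hne]
  exact ⟨fun h => hσ.2.1 (hτ h), hK _ hσ.2.2 _ (Finset.insert_subset_insert _ hτ) (by simp)⟩

theorem cn_link_pure {K : Finset (Finset V)} (hK : IsComplex K) (t : V) (d : ℕ) (hp : IsPure (d + 1) K) :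
    IsPure d (vertexLink t K) := by
  intro σ hσ
  rw [mem_vertexLink] at hσ
  obtain ⟨τ, hτ, hs, hc⟩ := hp _ hσ.2.2
  have ht : t ∈ τ := hs (by simp)
  refine ⟨τ.erase t, ?_, ?_, ?_⟩
  · rw [cn_link hK]
    · simp [Finset.insert_erase ht, hτ]
    · rw [← Finset.card_pos, Finset.card_erase_of_mem ht]; omega
  · intro x hx
    rw [Finset.mem_erase]
    exact ⟨fun h => hσ.2.1 (h ▸ hx), hs (by simp [hx])⟩
  · rw [Finset.card_erase_of_mem ht]; omega

theorem cn_strong {K : Finset (Finset V)} (hK : IsNormalPseudomanifold 4 K) (k : ℕ) :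
    ∀ σ ∈ K, σ.card + k = 4 → ∀ τ ∈ K, ∀ τ' ∈ K, τ.card = 5 → τ'.card = 5 → σ ⊆ τ → σ ⊆ τ' →
    Relation.ReflTransGen (fun α β => α ∈ K ∧ β ∈ K ∧ α.card = 5 ∧ β.card = 5 ∧ (α ∩ β).card = 4 ∧
      σ ⊆ α ∧ σ ⊆ β) τ τ' := by
  obtain ⟨hC, hP, -, -, hL⟩ := hK
  induction k with
  | zero =>
    intro σ hσ h4 τ hτ τ' hτ' c c' hs hs'
    by_cases heq : τ = τ'
    · subst heq; exact .refl
    · apply Relation.ReflTransGen.single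
      refine ⟨hτ, hτ', c, c', ?_, hs, hs'⟩
      have h1 : 4 ≤ (τ ∩ τ').card := by
        rw [← show σ.card = 4 by omega]
        exact Finset.card_le_card (Finset.subset_inter hs hs')
      have h2 : (τ ∩ τ').card < τ.card := by
        apply Finset.card_lt_card
        refine ⟨Finset.inter_subset_left, fun h => heq ?_⟩
        apply Finset.eq_of_subset_of_card_le (h.trans Finset.inter_subset_right)
        omega
      omega
  | succ k ih =>
    intro σ hσ h4 τ hτ τ' hτ' c c' hs hs'
    have hconn := hL σ hσ (by omega)
    -- one-vertex extension
    have hstep : ∀ x, x ∉ σ → ∀ τ ∈ K, ∀ τ' ∈ K, τ.card = 5 → τ'.card = 5 → insert x σ ⊆ τ →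
        insert x σ ⊆ τ' →
        Relation.ReflTransGen (fun α β => α ∈ K ∧ β ∈ K ∧ α.card = 5 ∧ β.card = 5 ∧ (α ∩ β).card = 4 ∧
          σ ⊆ α ∧ σ ⊆ β) τ τ' := by
      intro x hx τ hτ τ' hτ' c c' hs hs'
      have := ih (insert x σ) (hC _ hτ _ hs (by simp)) (by rw [Finset.card_insert_of_notMem hx]; omega)
        τ hτ τ' hτ' c c' hs hs'
      refine Relation.ReflTransGen.mono ?_ _ _ this
      rintro α β ⟨h1, h2, h3, h4, h5, h6, h7⟩
      exact ⟨h1, h2, h3, h4, h5, (Finset.subset_insert _ _).trans h6, (Finset.subset_insert _ _).trans h7⟩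
    have hex : ∀ τ : Finset V, τ.card = 5 → σ ⊆ τ → ∃ x ∈ τ, x ∉ σ := by
      intro τ c hs
      by_contra hcon
      push Not at hcon
      have := Finset.card_le_card hcon
      omega
    have hmem : ∀ τ ∈ K, σ ⊆ τ → ∀ x ∈ τ, x ∉ σ → {x} ∈ faceLink σ K := by
      intro τ hτ hs x hx hxs
      simp only [faceLink, Finset.mem_filter]
      refine ⟨hC _ hτ _ (by simpa using hx) (by simp), by simp [hxs], ?_⟩
      refine hC _ hτ _ ?_ ⟨x, by simp⟩
      exact Finset.union_subset (by simpa using hx) hs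
    obtain ⟨x, hx, hxs⟩ := hex τ c hs
    obtain ⟨y, hy, hys⟩ := hex τ' c' hs'
    have path := hconn.2 x y (hmem τ hτ hs x hx hxs) (hmem τ' hτ' hs' y hy hys)
    -- invariant
    have inv : ∀ y, Relation.ReflTransGen (fun a b => ({a, b} : Finset V) ∈ faceLink σ K) x y → y ∉ σ →
        ∀ τ' ∈ K, τ'.card = 5 → insert y σ ⊆ τ' →
        Relation.ReflTransGen (fun α β => α ∈ K ∧ β ∈ K ∧ α.card = 5 ∧ β.card = 5 ∧ (α ∩ β).card = 4 ∧
          σ ⊆ α ∧ σ ⊆ β) τ τ' := by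
      intro y hy
      induction hy with
      | refl =>
        intro _ τ' hτ' c' hs'
        exact hstep x hxs τ hτ τ' hτ' c c' (Finset.insert_subset hx hs) hs'
      | tail h1 h2 ih2 =>
        rename_i a b
        intro hb τ' hτ' c' hs'
        simp only [faceLink, Finset.mem_filter] at h2
        obtain ⟨-, hd, hu⟩ := h2
        have ha : a ∉ σ := by
          intro ha
          have : a ∈ ({a, b} : Finset V) ∩ σ := by simp [ha]
          rw [hd] at this; simp at this
        obtain ⟨ρ, hρ, hρs, hρc⟩ := hP _ hu
        have haρ : insert a σ ⊆ ρ := by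
          intro z hz; apply hρs
          simp only [Finset.mem_insert] at hz
          simp only [Finset.mem_union, Finset.mem_insert, Finset.mem_singleton]
          rcases hz with rfl | hz
          · left; left; rfl
          · right; exact hz
        have hbρ : insert b σ ⊆ ρ := by
          intro z hz; apply hρs
          simp only [Finset.mem_insert] at hz
          simp only [Finset.mem_union, Finset.mem_insert, Finset.mem_singleton]
          rcases hz with rfl | hz
          · left; right; rfl
          · right; exact hz
        exact (ih2 ha ρ hρ hρc haρ).trans (hstep b hb ρ hρ τ' hτ' hρc c' hbρ hs')
    exact inv y path hys τ' hτ' c' (Finset.insert_subset hy hs')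

/-- Strong connectivity of vertex links. -/
theorem cn_link_strong {K : Finset (Finset V)} (hK : IsNormalPseudomanifold 4 K) (v : V) (hv : {v} ∈ K) :
    StronglyConnected 3 (vertexLink v K) := by
  have hC := hK.1
  intro σ hσ τ hτ hσ4 hτ4
  rw [mem_vertexLink] at hσ hτ
  have h := cn_strong hK 3 {v} hv (by simp) (insert v σ) hσ.2.2 (insert v τ) hτ.2.2
    (by rw [Finset.card_insert_of_notMem hσ.2.1]; omega) (by rw [Finset.card_insert_of_notMem hτ.2.1]; omega)
    (by simp) (by simp)
  have h' := h.lift (p := (fun α β => α ∈ vertexLink v K ∧ β ∈ vertexLink v K ∧ α.card = 3 + 1 ∧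
    β.card = 3 + 1 ∧ (α ∩ β).card = 3)) (fun α => α.erase v) (by
      rintro α β ⟨h1, h2, h3, h4, h5, h6, h7⟩
      have hα : v ∈ α := by simpa using h6
      have hβ : v ∈ β := by simpa using h7
      refine ⟨?_, ?_, ?_, ?_, ?_⟩
      · rw [cn_link hC (by rw [← Finset.card_pos, Finset.card_erase_of_mem hα]; omega)]
        simp [Finset.insert_erase hα, h1]
      · rw [cn_link hC (by rw [← Finset.card_pos, Finset.card_erase_of_mem hβ]; omega)]
        simp [Finset.insert_erase hβ, h2]
      · rw [Finset.card_erase_of_mem hα]; omega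
      · rw [Finset.card_erase_of_mem hβ]; omega
      · have : α.erase v ∩ β.erase v = (α ∩ β).erase v := by
          ext x; simp only [Finset.mem_inter, Finset.mem_erase]; tauto
        rw [this, Finset.card_erase_of_mem (by simp [hα, hβ])]; omega)
  change Relation.ReflTransGen _ ((insert v σ).erase v) ((insert v τ).erase v) at h'
  rw [Finset.erase_insert hσ.2.1, Finset.erase_insert hτ.2.1] at h'
  exact h'

theorem cn_link2_strong {K : Finset (Finset V)} (hK : IsNormalPseudomanifold 4 K) (v w : V) (hvw : v ≠ w)
    (hv : {v, w} ∈ K) :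
    StronglyConnected 2 (vertexLink w (vertexLink v K)) := by
  have hC := hK.1
  have hC' := cn_link_complex hC v
  have hmem : ∀ σ : Finset V, σ.card = 3 → (σ ∈ vertexLink w (vertexLink v K) ↔
      w ∉ σ ∧ v ∉ σ ∧ insert v (insert w σ) ∈ K) := by
    intro σ hσ
    rw [cn_link hC' (by rw [← Finset.card_pos]; omega), cn_link hC (by simp)]
    simp [hvw]
  intro σ hσ τ hτ hσ4 hτ4
  rw [hmem _ hσ4] at hσ
  rw [hmem _ hτ4] at hτ
  have card2 : ∀ σ : Finset V, σ.card = 3 → w ∉ σ → v ∉ σ → (insert v (insert w σ)).card = 5 := by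
    intro σ h hw hv
    rw [Finset.card_insert_of_notMem (by simp [hvw, hv]), Finset.card_insert_of_notMem hw, h]
  have h := cn_strong hK 2 {v, w} hv (by rw [Finset.card_pair hvw]) _ hσ.2.2 _ hτ.2.2
    (card2 σ hσ4 hσ.1 hσ.2.1) (card2 τ hτ4 hτ.1 hτ.2.1)
    (by intro x; simp; tauto) (by intro x; simp; tauto)
  have h' := h.lift (p := (fun α β => α ∈ vertexLink w (vertexLink v K) ∧ β ∈ vertexLink w (vertexLink v K) ∧
    α.card = 2 + 1 ∧ β.card = 2 + 1 ∧ (α ∩ β).card = 2)) (fun α => (α.erase v).erase w) (by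
      rintro α β ⟨h1, h2, h3, h4, h5, h6, h7⟩
      have e1 : ∀ α : Finset V, {v, w} ⊆ α → ((α.erase v).erase w).card + 2 = α.card := by
        intro α hα
        have hv : v ∈ α := hα (by simp)
        have hw : w ∈ α := hα (by simp)
        have h0 : 0 < (α.erase v).card := Finset.card_pos.2 ⟨w, by simp [hw, hvw.symm]⟩
        have h00 : 0 < α.card := Finset.card_pos.2 ⟨w, hw⟩
        rw [Finset.card_erase_of_mem (by simp [hw, hvw.symm])]
        rw [Finset.card_erase_of_mem hv] at *
        omega
      have e2 : ∀ α : Finset V, {v, w} ⊆ α → insert v (insert w ((α.erase v).erase w)) = α := by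
        intro α hα
        have hv : v ∈ α := hα (by simp)
        have hw : w ∈ α := hα (by simp)
        rw [Finset.insert_erase (by simp [hw, hvw.symm]), Finset.insert_erase hv]
      have a1 := e1 α h6
      have a2 := e1 β h7
      change (α.erase v).erase w ∈ vertexLink w (vertexLink v K) ∧ (β.erase v).erase w ∈ vertexLink w (vertexLink v K) ∧
        ((α.erase v).erase w).card = 2 + 1 ∧ ((β.erase v).erase w).card = 2 + 1 ∧
        ((α.erase v).erase w ∩ (β.erase v).erase w).card = 2
      refine ⟨?_, ?_, by omega, by omega, ?_⟩
      · rw [hmem _ (by omega)]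
        simp [e2 α h6, h1]
      · rw [hmem _ (by omega)]
        simp [e2 β h7, h2]
      · have : (α.erase v).erase w ∩ (β.erase v).erase w = ((α ∩ β).erase v).erase w := by
          ext x; simp only [Finset.mem_inter, Finset.mem_erase]; tauto
        have a3 := e1 (α ∩ β) (Finset.subset_inter h6 h7)
        rw [this]; omega)
  have e3 : ∀ σ : Finset V, w ∉ σ → v ∉ σ → ((insert v (insert w σ)).erase v).erase w = σ := by
    intro σ hw hv
    rw [Finset.erase_insert (by simp [hvw, hv]), Finset.erase_insert hw]
  change Relation.ReflTransGen _ (((insert v (insert w σ)).erase v).erase w) (((insert v (insert w τ)).erase v).erase w) at h'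
  rw [e3 σ hσ.1 hσ.2.1, e3 τ hτ.1 hτ.2.1] at h'
  exact h'

/-- Ridges of a vertex link lie in two facets. -/
theorem cn_link_two {K : Finset (Finset V)} (hK : IsComplex K) (v : V) (d : ℕ)
    (h2 : ∀ σ ∈ K, σ.card = d + 1 → (K.filter (fun τ => σ ⊆ τ ∧ τ.card = d + 1 + 1)).card = 2) :
    ∀ σ ∈ vertexLink v K, σ.card = d →
      ((vertexLink v K).filter (fun τ => σ ⊆ τ ∧ τ.card = d + 1)).card = 2 := by
  intro σ hσ hd
  rw [mem_vertexLink] at hσ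
  rw [← h2 (insert v σ) hσ.2.2 (by rw [Finset.card_insert_of_notMem hσ.2.1, hd])]
  apply Finset.card_bij (fun τ _ => insert v τ)
  · intro τ hτ
    rw [Finset.mem_filter, mem_vertexLink] at hτ
    rw [Finset.mem_filter]
    exact ⟨hτ.1.2.2, Finset.insert_subset_insert _ hτ.2.1, by
      rw [Finset.card_insert_of_notMem hτ.1.2.1, hτ.2.2]⟩
  · intro a ha b hb hab
    rw [Finset.mem_filter, mem_vertexLink] at ha hb
    have hab : insert v a = insert v b := hab
    rw [← Finset.erase_insert ha.1.2.1, hab, Finset.erase_insert hb.1.2.1]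
  · intro τ hτ
    rw [Finset.mem_filter] at hτ
    have hv : v ∈ τ := hτ.2.1 (by simp)
    refine ⟨τ.erase v, ?_, Finset.insert_erase hv⟩
    have hc : (τ.erase v).card = d + 1 := by rw [Finset.card_erase_of_mem hv]; omega
    rw [Finset.mem_filter, cn_link hK (by rw [← Finset.card_pos]; omega)]
    refine ⟨⟨by simp, by rw [Finset.insert_erase hv]; exact hτ.1⟩, ?_, hc⟩
    intro x hx
    rw [Finset.mem_erase]
    exact ⟨fun h => hσ.2.1 (h ▸ hx), hτ.2.1 (by simp [hx])⟩

/-- The fundamental mod 2 chain of a 3-complex. -/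
def fCh (M : Finset (Finset V)) (σ : Finset V) : ZMod 2 := if σ ∈ M ∧ σ.card = 4 then 1 else 0

theorem fCh_ne {M : Finset (Finset V)} {σ : Finset V} : fCh M σ ≠ 0 ↔ σ ∈ M ∧ σ.card = 4 := by
  unfold fCh; split_ifs with h <;> simp [h]

theorem cn_bd {M : Finset (Finset V)} {b : Finset V → ZMod 2} (hb : chSub b (fCh M)) {τ : Finset V}
    (hτ : τ.card = 3) :
    chBd b τ = ∑ σ ∈ M.filter (fun σ => τ ⊆ σ ∧ σ.card = 4), b σ := by
  have h1 : chBd b τ = ∑ x ∈ Finset.univ.filter (fun x => x ∉ τ), b (insert x τ) := by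
    unfold chBd
    rw [Finset.sum_filter]
    apply Finset.sum_congr rfl
    intro x _
    by_cases hx : x ∈ τ <;> simp [hx]
  rw [h1]
  have hinj : Set.InjOn (fun x => insert x τ) (Finset.univ.filter (fun x => x ∉ τ) : Finset V) := by
    intro x hx y hy hxy
    simp only [Finset.coe_filter, Set.mem_setOf_eq, Finset.mem_univ, true_and] at hx hy
    have hxy : insert x τ = insert y τ := hxy
    have : x ∈ insert y τ := by rw [← hxy]; simp
    simp only [Finset.mem_insert] at this
    exact this.resolve_right hx
  rw [← Finset.sum_image (f := b) (g := fun x => insert x τ) hinj]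
  symm
  apply Finset.sum_subset
  · intro σ hσ
    rw [Finset.mem_filter] at hσ
    obtain ⟨x, hx⟩ : ∃ x, x ∈ σ \ τ := by
      rw [← Finset.Nonempty, ← Finset.card_pos, Finset.card_sdiff_of_subset hσ.2.1]; omega
    rw [Finset.mem_sdiff] at hx
    rw [Finset.mem_image]
    refine ⟨x, by simp [hx.2], ?_⟩
    apply Finset.eq_of_subset_of_card_le (Finset.insert_subset hx.1 hσ.2.1)
    rw [Finset.card_insert_of_notMem hx.2]; omega
  · intro σ hσ hn
    by_contra h0
    apply hn
    rw [Finset.mem_image] at hσ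
    obtain ⟨x, _, rfl⟩ := hσ
    have := fCh_ne.1 (hb _ h0)
    rw [Finset.mem_filter]
    exact ⟨this.1, Finset.subset_insert _ _, this.2⟩

theorem cn_min {M : Finset (Finset V)} (hM : IsComplex M) (hne : M.Nonempty) (hp : IsPure 3 M)
    (hs : StronglyConnected 3 M)
    (h2 : ∀ σ ∈ M, σ.card = 3 → (M.filter (fun τ => σ ⊆ τ ∧ τ.card = 3 + 1)).card = 2) :
    chMin chCyc (fCh M) := by
  have hrefl : chSub (fCh M) (fCh M) := fun _ h => h
  refine ⟨⟨fun σ h => (fCh_ne.1 h).2, ?_⟩, ?_, ?_⟩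
  · intro τ
    by_cases hτ : τ.card = 3
    · rw [cn_bd hrefl hτ]
      by_cases hτM : τ ∈ M
      · have : ∀ σ ∈ M.filter (fun σ => τ ⊆ σ ∧ σ.card = 4), fCh M σ = 1 := by
          intro σ hσ
          rw [Finset.mem_filter] at hσ
          simp [fCh, hσ.1, hσ.2.2]
        rw [Finset.sum_congr rfl this, Finset.sum_const, h2 τ hτM hτ]
        decide
      · rw [Finset.sum_eq_zero]
        intro σ hσ
        rw [Finset.mem_filter] at hσ
        exact absurd (hM _ hσ.1 _ hσ.2.1 (by rw [← Finset.card_pos]; omega)) hτM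
    · unfold chBd
      apply Finset.sum_eq_zero
      intro x _
      split_ifs with hx
      · rfl
      · by_contra h0
        have := (fCh_ne.1 h0).2
        rw [Finset.card_insert_of_notMem hx] at this
        omega
  · obtain ⟨σ, hσ⟩ := hne
    obtain ⟨τ, hτ, -, hc⟩ := hp _ hσ
    intro h
    exact fCh_ne.2 ⟨hτ, hc⟩ (by rw [h]; rfl)
  · intro b hb hb0 hsub
    obtain ⟨σ, hσ⟩ : ∃ σ, b σ ≠ 0 := by
      by_contra hcon; push Not at hcon; exact hb0 (funext hcon)
    have hσ' := fCh_ne.1 (hsub _ hσ)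
    have key : ∀ τ, Relation.ReflTransGen
        (fun α β => α ∈ M ∧ β ∈ M ∧ α.card = 3 + 1 ∧ β.card = 3 + 1 ∧ (α ∩ β).card = 3) σ τ → b τ ≠ 0 := by
      intro τ hτ
      induction hτ with
      | refl => exact hσ
      | tail hh h ih =>
        rename_i α β
        obtain ⟨hα, hβ, cα, cβ, cc⟩ := h
        have hne : α ≠ β := by
          rintro rfl
          rw [Finset.inter_self] at cc; omega
        have hin : α ∩ β ∈ M := hM _ hα _ Finset.inter_subset_left (by rw [← Finset.card_pos]; omega)
        have hset : ({α, β} : Finset (Finset V)) = M.filter (fun σ => α ∩ β ⊆ σ ∧ σ.card = 3 + 1) := by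
          apply Finset.eq_of_subset_of_card_le
          · intro x hx
            rw [Finset.mem_insert, Finset.mem_singleton] at hx
            rw [Finset.mem_filter]
            rcases hx with rfl | rfl
            · exact ⟨hα, Finset.inter_subset_left, cα⟩
            · exact ⟨hβ, Finset.inter_subset_right, cβ⟩
          · rw [h2 _ hin cc, Finset.card_pair hne]
        have h0 := cn_bd hsub cc
        rw [hb.2, ← hset, Finset.sum_pair hne] at h0
        intro hβ0
        rw [hβ0, add_zero] at h0
        exact ih h0.symm
    funext τ
    by_cases hτ : τ ∈ M ∧ τ.card = 4
    · rw [z2_ne (key τ (hs _ hσ'.1 _ hτ.1 hσ'.2 hτ.2)), z2_ne (fCh_ne.2 hτ)]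
    · have h1 : b τ = 0 := by by_contra h; exact hτ (fCh_ne.1 (hsub _ h))
      have h2 : fCh M τ = 0 := by by_contra h; exact hτ (fCh_ne.1 h)
      rw [h1, h2]

theorem cn_chE {M : Finset (Finset V)} (hM : IsComplex M) (hp : IsPure 3 M) :
    chE (fCh M) = facesOfDim 1 M := by
  ext e
  rw [mem_chE, facesOfDim, Finset.mem_filter]
  constructor
  · rintro ⟨h, σ, hσ, hs⟩
    exact ⟨hM _ (fCh_ne.1 hσ).1 _ hs (by rw [← Finset.card_pos]; omega), h⟩
  · rintro ⟨h, hc⟩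
    obtain ⟨τ, hτ, hs, h4⟩ := hp _ h
    exact ⟨hc, τ, fCh_ne.2 ⟨hτ, h4⟩, hs⟩

theorem cn_mem_chV {M : Finset (Finset V)} (hM : IsComplex M) (hp : IsPure 3 M) {x : V} :
    x ∈ chV (fCh M) ↔ {x} ∈ M := by
  rw [mem_chV]
  constructor
  · rintro ⟨σ, hσ, hs⟩
    exact hM _ (fCh_ne.1 hσ).1 _ (by simpa using hs) (by simp)
  · intro h
    obtain ⟨τ, hτ, hs, h4⟩ := hp _ h
    exact ⟨τ, fCh_ne.2 ⟨hτ, h4⟩, by simpa using hs⟩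

theorem cn_f0 {M : Finset (Finset V)} {S : Finset V} (h : ∀ x, x ∈ S ↔ {x} ∈ M) :
    fNum 0 M = S.card := by
  unfold fNum
  congr 1
  symm
  apply Finset.card_bij (fun x _ => {x})
  · intro x hx
    rw [facesOfDim, Finset.mem_filter]
    exact ⟨(h x).1 hx, by simp⟩
  · intro x _ y _ hxy
    simpa using hxy
  · intro e he
    rw [facesOfDim, Finset.mem_filter] at he
    obtain ⟨x, rfl⟩ := Finset.card_eq_one.1 he.2
    exact ⟨x, (h x).2 he.1, rfl⟩

theorem cn_chR {M : Finset (Finset V)} (hp : IsPure 3 M) : chR (fCh M) = realization M := by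
  ext x
  simp only [chR, realization, Set.mem_setOf_eq]
  refine and_congr_left fun _ => ?_
  constructor
  · rintro ⟨σ, hσ, h⟩
    exact ⟨σ, (fCh_ne.1 hσ).1, h⟩
  · rintro ⟨σ, hσ, h⟩
    obtain ⟨τ, hτ, hs, h4⟩ := hp _ hσ
    exact ⟨τ, fCh_ne.2 ⟨hτ, h4⟩, fun v hv => hs (h v hv)⟩

theorem cn_link_min {K : Finset (Finset V)} (hK : IsNormalPseudomanifold 4 K) (v : V) (hv : {v} ∈ K) :
    chMin chCyc (fCh (vertexLink v K)) := by
  apply cn_min (cn_link_complex hK.1 v) _ (cn_link_pure hK.1 v 3 hK.2.1) (cn_link_strong hK v hv)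
    (cn_link_two hK.1 v 3 hK.2.2.2.1)
  obtain ⟨τ, hτ, hs, hc⟩ := hK.2.1 _ hv
  have hvτ : v ∈ τ := by simpa using hs
  refine ⟨τ.erase v, ?_⟩
  rw [cn_link hK.1 (by rw [← Finset.card_pos, Finset.card_erase_of_mem hvτ]; omega)]
  simp [Finset.insert_erase hvτ, hτ]

theorem cn_g2_link {K : Finset (Finset V)} (hK : IsNormalPseudomanifold 4 K) (v : V) :
    g2 3 (vertexLink v K) = (chE (fCh (vertexLink v K))).card - 4 * (chV (fCh (vertexLink v K))).card + 10 := by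
  have hM := cn_link_complex hK.1 v
  have hp := cn_link_pure hK.1 v 3 hK.2.1
  rw [g2, cn_f0 (fun x => cn_mem_chV hM hp), cn_chE hM hp]
  rw [show Nat.choose (3 + 2) 2 = 10 from rfl]
  unfold fNum
  push_cast
  ring

theorem cn_g2_nonneg {K : Finset (Finset V)} (hK : IsNormalPseudomanifold 4 K) (v : V) (hv : {v} ∈ K) :
    0 ≤ g2 3 (vertexLink v K) := by
  rw [cn_g2_link hK]
  have := rg_lower (cn_link_min hK v hv)
  zify at this
  linarith

theorem cn_g2_zero {K : Finset (Finset V)} (hK : IsNormalPseudomanifold 4 K) (v : V) (hv : {v} ∈ K)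
    (h : g2 3 (vertexLink v K) = 0) : IsTriangulatedSphere 3 (vertexLink v K) := by
  rw [cn_g2_link hK] at h
  have := ch_sphere _ (cn_link_min hK v hv) (by zify; linarith)
  rw [cn_chR (cn_link_pure hK.1 v 3 hK.2.1)] at this
  exact this

/-- Number of faces of cardinality `j` containing `σ`. -/
def nK (M : Finset (Finset V)) (σ : Finset V) (j : ℕ) : ℕ :=
  (M.filter (fun τ => σ ⊆ τ ∧ τ.card = j)).card

theorem nK_mid {σ τ : Finset V} (hs : σ ⊆ τ) (b : ℕ) (hb : σ.card ≤ b) :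
    (τ.powerset.filter (fun ρ => σ ⊆ ρ ∧ ρ.card = b)).card = (τ.card - σ.card).choose (b - σ.card) := by
  rw [← Finset.card_sdiff_of_subset hs, ← Finset.card_powersetCard]
  apply Finset.card_bij (fun ρ _ => ρ \ σ)
  · intro ρ hρ
    rw [Finset.mem_filter, Finset.mem_powerset] at hρ
    rw [Finset.mem_powersetCard]
    exact ⟨Finset.sdiff_subset_sdiff hρ.1 (Finset.Subset.refl _), by
      rw [Finset.card_sdiff_of_subset hρ.2.1, hρ.2.2]⟩
  · intro a ha c hc hac
    rw [Finset.mem_filter, Finset.mem_powerset] at ha hc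
    have hac : a \ σ = c \ σ := hac
    rw [← Finset.sdiff_union_of_subset ha.2.1, hac, Finset.sdiff_union_of_subset hc.2.1]
  · intro ρ hρ
    rw [Finset.mem_powersetCard] at hρ
    have hd : Disjoint ρ σ := Finset.disjoint_of_subset_left hρ.1 Finset.sdiff_disjoint
    refine ⟨ρ ∪ σ, ?_, ?_⟩
    · rw [Finset.mem_filter, Finset.mem_powerset]
      refine ⟨Finset.union_subset (hρ.1.trans Finset.sdiff_subset) hs, Finset.subset_union_right, ?_⟩
      rw [Finset.card_union_of_disjoint hd, hρ.2]; omega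
    · exact Finset.union_sdiff_cancel_right hd

theorem nK_double {M : Finset (Finset V)} (hM : IsComplex M) (σ : Finset V) (b j : ℕ) (hb : σ.card ≤ b)
    (hb1 : 1 ≤ b) :
    ∑ ρ ∈ M.filter (fun ρ => σ ⊆ ρ ∧ ρ.card = b), nK M ρ j = (j - σ.card).choose (b - σ.card) * nK M σ j := by
  have h1 := Finset.sum_card_bipartiteAbove_eq_sum_card_bipartiteBelow
    (s := M.filter (fun ρ => σ ⊆ ρ ∧ ρ.card = b)) (t := M.filter (fun τ => σ ⊆ τ ∧ τ.card = j))
    (fun ρ τ => ρ ⊆ τ)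
  have h2 : ∀ ρ ∈ M.filter (fun ρ => σ ⊆ ρ ∧ ρ.card = b),
      nK M ρ j = (Finset.bipartiteAbove (fun ρ τ => ρ ⊆ τ) (M.filter (fun τ => σ ⊆ τ ∧ τ.card = j)) ρ).card := by
    intro ρ hρ
    rw [Finset.mem_filter] at hρ
    unfold nK Finset.bipartiteAbove
    congr 1
    ext τ
    simp only [Finset.mem_filter]
    constructor
    · rintro ⟨a, b, c⟩; exact ⟨⟨a, hρ.2.1.trans b, c⟩, b⟩
    · rintro ⟨⟨a, b, c⟩, d⟩; exact ⟨a, d, c⟩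
  have h3 : ∀ τ ∈ M.filter (fun τ => σ ⊆ τ ∧ τ.card = j),
      (Finset.bipartiteBelow (fun ρ τ => ρ ⊆ τ) (M.filter (fun ρ => σ ⊆ ρ ∧ ρ.card = b)) τ).card
        = (j - σ.card).choose (b - σ.card) := by
    intro τ hτ
    rw [Finset.mem_filter] at hτ
    rw [← hτ.2.2, ← nK_mid hτ.2.1 b hb]
    unfold Finset.bipartiteBelow
    congr 1
    ext ρ
    simp only [Finset.mem_filter, Finset.mem_powerset]
    constructor
    · rintro ⟨⟨a, b, c⟩, d⟩; exact ⟨d, b, c⟩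
    · rintro ⟨a, b, c⟩
      exact ⟨⟨hM _ hτ.1 _ a (by rw [← Finset.card_pos]; omega), b, c⟩, a⟩
  rw [Finset.sum_congr rfl h2, h1, Finset.sum_congr rfl h3, Finset.sum_const, smul_eq_mul, mul_comm]
  rfl

theorem nK_empty (M : Finset (Finset V)) (i : ℕ) : fNum i M = nK M ∅ (i + 1) := by
  unfold fNum nK facesOfDim
  simp

theorem cn_mem_link2 {K : Finset (Finset V)} (hC : IsComplex K) {v w : V} (hvw : v ≠ w) {σ : Finset V}
    (hσ : σ.Nonempty) : σ ∈ vertexLink w (vertexLink v K) ↔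
      w ∉ σ ∧ v ∉ σ ∧ insert v (insert w σ) ∈ K := by
  rw [cn_link (cn_link_complex hC v) hσ, cn_link hC (by simp)]
  simp [hvw]

theorem cn_D_zero {K : Finset (Finset V)} (hK : IsNormalPseudomanifold 4 K) (v w : V) (hvw : v ≠ w)
    (he : {v, w} ∈ K) (hS : IsTriangulatedSphere 3 (vertexLink v K)) :
    fNum 1 (vertexLink w (vertexLink v K)) - 3 * fNum 0 (vertexLink w (vertexLink v K)) + 6 = 0 := by
  have hC := hK.1
  have hM := cn_link_complex hC v
  have hL := cn_link_complex hM w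
  have hpL := cn_link_pure hM w 2 (cn_link_pure hC v 3 hK.2.1)
  have h2 := cn_link_two hM w 2 (cn_link_two hC v 3 hK.2.2.2.1)
  have hwM : {w} ∈ vertexLink v K := by
    rw [cn_link hC (by simp)]
    exact ⟨by simpa using hvw, he⟩
  have hE := sf_euler (vertexLink w (vertexLink v K)) hL ?_ hpL ?_ (cn_link2_strong hK v w hvw he) h2
  · have h3 := nK_double hL ∅ 2 3 (by simp) (by norm_num)
    have h4 : ∀ ρ ∈ (vertexLink w (vertexLink v K)).filter (fun ρ => ∅ ⊆ ρ ∧ ρ.card = 2),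
        nK (vertexLink w (vertexLink v K)) ρ 3 = 2 := by
      intro ρ hρ
      rw [Finset.mem_filter] at hρ
      exact h2 ρ hρ.1 hρ.2.2
    rw [Finset.sum_congr rfl h4, Finset.sum_const, smul_eq_mul] at h3
    have h5 : 2 * fNum 1 (vertexLink w (vertexLink v K)) = 3 * fNum 2 (vertexLink w (vertexLink v K)) := by
      rw [nK_empty, nK_empty]
      have : Nat.choose (3 - 0) (2 - 0) = 3 := rfl
      rw [Finset.card_empty, this] at h3
      change nK (vertexLink w (vertexLink v K)) ∅ 2 * 2 = 3 * nK (vertexLink w (vertexLink v K)) ∅ 3 at h3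
      zify at h3
      norm_num
      linarith
    linarith
  · intro h hh
    obtain ⟨g, hg⟩ := sf_H1 (vertexLink v K) hM hS w hwM h (by
      intro a b d ha hb hd hm
      apply hh
      rw [cn_link hM (by simp)]
      exact ⟨by simp [ha.symm, hb.symm, hd.symm], hm⟩)
    refine ⟨g, fun a b hab => ?_⟩
    rw [cn_link hM (by simp)] at hab
    have hab1 := hab.1
    simp only [Finset.mem_insert, Finset.mem_singleton, not_or] at hab1
    exact hg a b (Ne.symm hab1.1) (Ne.symm hab1.2) hab.2
  · have hc := hK.2.2.2.2 {v, w} he (by rw [Finset.card_pair hvw]; norm_num)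
    have hiff : ∀ γ : Finset V, γ.Nonempty → (γ ∈ faceLink {v, w} K ↔ γ ∈ vertexLink w (vertexLink v K)) := by
      intro γ hγ
      rw [cn_mem_link2 hC hvw hγ, faceLink, Finset.mem_filter]
      have e1 : γ ∪ {v, w} = insert v (insert w γ) := by
        ext x; simp only [Finset.mem_union, Finset.mem_insert, Finset.mem_singleton]; tauto
      rw [e1]
      constructor
      · rintro ⟨-, h1, h2⟩
        refine ⟨fun h => ?_, fun h => ?_, h2⟩
        · have : w ∈ γ ∩ {v, w} := by simp [h]
          rw [h1] at this; simp at this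
        · have : v ∈ γ ∩ {v, w} := by simp [h]
          rw [h1] at this; simp at this
      · rintro ⟨h1, h2, h3⟩
        refine ⟨hC _ h3 _ ((Finset.subset_insert _ _).trans (Finset.subset_insert _ _)) hγ, ?_, h3⟩
        ext x
        simp only [Finset.mem_inter, Finset.mem_insert, Finset.mem_singleton, Finset.notMem_empty, iff_false]
        rintro ⟨hx, rfl | rfl⟩
        · exact h2 hx
        · exact h1 hx
    constructor
    · obtain ⟨τ, hτ, hs, h5⟩ := hK.2.1 _ he
      have hv : v ∈ τ := hs (by simp)
      have hw : w ∈ τ := hs (by simp)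
      have hcard : ((τ.erase v).erase w).card = 3 := by
        rw [Finset.card_erase_of_mem (by simp [hw, hvw.symm]), Finset.card_erase_of_mem hv, h5]
      refine ⟨(τ.erase v).erase w, ?_⟩
      rw [cn_mem_link2 hC hvw (by rw [← Finset.card_pos]; omega),
        Finset.insert_erase (by simp [hw, hvw.symm]), Finset.insert_erase hv]
      simp [hτ]
    · intro a b ha hb
      have := hc.2 a b ((hiff _ (by simp)).2 ha) ((hiff _ (by simp)).2 hb)
      refine Relation.ReflTransGen.mono ?_ _ _ this
      intro x y hxy
      exact (hiff _ (by simp)).1 hxy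

theorem cn_star {K : Finset (Finset V)} (hK : IsNormalPseudomanifold 4 K) (t u : V) (htu : t ≠ u)
    (he : {t, u} ∈ K) :
    fNum 1 (vertexLink u (vertexLink t K)) - 3 * fNum 0 (vertexLink u (vertexLink t K)) + 6
      ≤ g2 3 (vertexLink t K) := by
  have hC := hK.1
  have hM := cn_link_complex hC t
  have hpM := cn_link_pure hC t 3 hK.2.1
  have hL := cn_link_complex hM u
  have hpL := cn_link_pure hM u 2 hpM
  have htK : {t} ∈ K := hC _ he _ (by simp) (by simp)
  have huM : {u} ∈ vertexLink t K := by
    rw [cn_link hC (by simp)]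
    exact ⟨by simpa using htu, he⟩
  have hmin := cn_link_min hK t htK
  rw [cn_g2_link hK]
  obtain ⟨p, hp⟩ := rg_exists_generic (V := V)
  have hrig := rgRk_of_rig hp.1 (by have := hmin.1.five hmin.2.1; omega) (rg_fogelsanger hp _ hmin)
  set c := fCh (vertexLink t K) with hc
  set L := vertexLink u (vertexLink t K) with hLdef
  set S : Finset V := Finset.univ.filter (fun x => {x} ∈ L) with hS
  have huS : u ∉ S := by
    rw [hS, Finset.mem_filter, hLdef, cn_link hM (by simp)]
    simp
  have hf0 : fNum 0 L = S.card := cn_f0 (by intro x; simp [hS])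
  have hS3 : 3 ≤ S.card := by
    obtain ⟨τ, hτ, hs, h4⟩ := hpM _ huM
    have hu : u ∈ τ := by simpa using hs
    have hcard : (τ.erase u).card = 3 := by rw [Finset.card_erase_of_mem hu]; omega
    rw [← hcard]
    apply Finset.card_le_card
    intro x hx
    rw [hS, Finset.mem_filter]
    refine ⟨Finset.mem_univ _, ?_⟩
    rw [hLdef, cn_link hM (by simp)]
    rw [Finset.mem_erase] at hx
    refine ⟨by simpa using hx.1.symm, hM _ hτ _ ?_ (by simp)⟩
    intro y hy
    rw [Finset.mem_insert, Finset.mem_singleton] at hy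
    rcases hy with rfl | rfl
    · exact hu
    · exact hx.2
  have hcomp := rgRk_complete hp.1 (insert u S) (by rw [Finset.card_insert_of_notMem huS]; omega)
  rw [Finset.card_insert_of_notMem huS] at hcomp
  set A : Finset (Finset V) := facesOfDim 1 L with hA
  set B : Finset (Finset V) := S.image (fun x => {u, x}) with hB
  have hBcard : B.card = S.card := by
    apply Finset.card_image_of_injOn
    intro x hx y hy hxy
    have hxy : ({u, x} : Finset V) = {u, y} := hxy
    have hxu : x ≠ u := fun h => huS (h ▸ hx)
    have : x ∈ ({u, y} : Finset V) := by rw [← hxy]; simp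
    simp only [Finset.mem_insert, Finset.mem_singleton] at this
    exact this.resolve_left hxu
  have hAmem : ∀ e, e ∈ A ↔ e ∈ L ∧ e.card = 2 := by
    intro e; rw [hA, facesOfDim, Finset.mem_filter]
  have hdis : Disjoint A B := by
    rw [Finset.disjoint_left]
    intro e he hb
    rw [hB, Finset.mem_image] at hb
    obtain ⟨x, _, rfl⟩ := hb
    rw [hAmem, hLdef, cn_link hM (by simp)] at he
    simp at he
  have hE : chE c = facesOfDim 1 (vertexLink t K) := cn_chE hM hpM
  have hAE : A ⊆ chE c := by
    intro e he
    rw [hAmem, hLdef, mem_vertexLink] at he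
    rw [hE, facesOfDim, Finset.mem_filter]
    exact ⟨he.1.1, he.2⟩
  have hSmem : ∀ x, x ∈ S ↔ {x} ∈ L := by intro x; simp [hS]
  have hBE : B ⊆ chE c := by
    intro e he
    rw [hB, Finset.mem_image] at he
    obtain ⟨x, hx, rfl⟩ := he
    have hxu : x ≠ u := fun h => huS (h ▸ hx)
    rw [hSmem, hLdef, cn_link hM (by simp)] at hx
    rw [hE, facesOfDim, Finset.mem_filter]
    exact ⟨hx.2, by simp [Finset.card_pair hxu.symm]⟩
  set F := chE c \ (A ∪ B) with hF
  have hFc : F.card + (A.card + S.card) = (chE c).card := by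
    rw [← hBcard, ← Finset.card_union_of_disjoint hdis, hF]
    exact Finset.card_sdiff_add_card_eq_card (Finset.union_subset hAE hBE)
  have hsub : (↑(chE c) : Set (Finset V)) ⊆ ↑((insert u S).powersetCard 2) ∪ ↑F := by
    intro e he
    have he : e ∈ chE c := he
    rw [← Finset.coe_union, Finset.mem_coe, Finset.mem_union]
    by_cases hab : e ∈ A ∪ B
    · left
      rw [Finset.mem_powersetCard]
      refine ⟨?_, (mem_chE.1 he).1⟩
      rw [Finset.mem_union] at hab
      rcases hab with ha | hb
      · rw [hAmem] at ha
        intro x hx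
        rw [Finset.mem_insert]; right
        rw [hSmem]
        exact hL _ ha.1 _ (by simpa using hx) (by simp)
      · rw [hB, Finset.mem_image] at hb
        obtain ⟨x, hx, rfl⟩ := hb
        intro y hy
        rw [Finset.mem_insert, Finset.mem_singleton] at hy
        rw [Finset.mem_insert]
        rcases hy with rfl | rfl
        · exact Or.inl rfl
        · exact Or.inr hx
    · right
      rw [hF, Finset.mem_sdiff]
      exact ⟨he, hab⟩
  have h1 := (rgRk_mono p hsub).trans (rgRk_union_le p _ F)
  have hfin : 4 * (chV c).card + A.card + 6 ≤ (chE c).card + 10 + 3 * S.card := by omega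
  have hf1 : fNum 1 L = A.card := rfl
  rw [hf0, hf1]
  zify at hfin
  linarith

theorem nK_link {K : Finset (Finset V)} (hK : IsComplex K) (v : V) (σ : Finset V) (hv : v ∉ σ) (j : ℕ)
    (hj : 1 ≤ j) : nK (vertexLink v K) σ j = nK K (insert v σ) (j + 1) := by
  unfold nK
  apply Finset.card_bij (fun τ _ => insert v τ)
  · intro τ hτ
    rw [Finset.mem_filter, mem_vertexLink] at hτ
    rw [Finset.mem_filter]
    exact ⟨hτ.1.2.2, Finset.insert_subset_insert _ hτ.2.1, by
      rw [Finset.card_insert_of_notMem hτ.1.2.1, hτ.2.2]⟩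
  · intro a ha b hb hab
    rw [Finset.mem_filter, mem_vertexLink] at ha hb
    have hab : insert v a = insert v b := hab
    rw [← Finset.erase_insert ha.1.2.1, hab, Finset.erase_insert hb.1.2.1]
  · intro τ hτ
    rw [Finset.mem_filter] at hτ
    have hvτ : v ∈ τ := hτ.2.1 (by simp)
    refine ⟨τ.erase v, ?_, Finset.insert_erase hvτ⟩
    have hc : (τ.erase v).card = j := by rw [Finset.card_erase_of_mem hvτ]; omega
    rw [Finset.mem_filter, cn_link hK (by rw [← Finset.card_pos]; omega)]
    refine ⟨⟨by simp, by rw [Finset.insert_erase hvτ]; exact hτ.1⟩, ?_, hc⟩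
    intro x hx
    rw [Finset.mem_erase]
    exact ⟨fun h => hv (h ▸ hx), hτ.2.1 (by simp [hx])⟩

theorem fNum_link {K : Finset (Finset V)} (hK : IsComplex K) (v : V) (i : ℕ) :
    fNum i (vertexLink v K) = nK K {v} (i + 2) := by
  rw [nK_empty, nK_link hK v ∅ (by simp) _ (by omega)]
  rfl

theorem fNum_link2 {K : Finset (Finset V)} (hK : IsComplex K) (v w : V) (hvw : v ≠ w) (i : ℕ) :
    fNum i (vertexLink w (vertexLink v K)) = nK K {v, w} (i + 3) := by
  rw [nK_empty, nK_link (cn_link_complex hK v) w ∅ (by simp) _ (by omega),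
    nK_link hK v _ (by simpa using hvw) _ (by omega)]
  rfl

theorem nK_45 {K : Finset (Finset V)} (hK : IsNormalPseudomanifold 4 K) (σ : Finset V) (hσ : σ.card ≤ 4) :
    2 * nK K σ 4 = (5 - σ.card) * nK K σ 5 := by
  have h := nK_double hK.1 σ 4 5 hσ (by norm_num)
  have h4 : ∀ ρ ∈ K.filter (fun ρ => σ ⊆ ρ ∧ ρ.card = 4), nK K ρ 5 = 2 := by
    intro ρ hρ
    rw [Finset.mem_filter] at hρ
    exact hK.2.2.2.1 ρ hρ.1 hρ.2.2
  rw [Finset.sum_congr rfl h4, Finset.sum_const, smul_eq_mul] at h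
  have hch : (5 - σ.card).choose (4 - σ.card) = 5 - σ.card := by
    rw [show 5 - σ.card = (4 - σ.card) + 1 by omega, Nat.choose_succ_self_right]
  rw [hch] at h
  change nK K σ 4 * 2 = _ at h
  omega

/-- The deficiency of an edge. -/
def eD (K : Finset (Finset V)) (e : Finset V) : ℤ := nK K e 4 - 3 * nK K e 3 + 6

theorem eD_sum {K : Finset (Finset V)} (hK : IsComplex K) (σ : Finset V) (hσ : σ.card ≤ 2) :
    ∑ e ∈ K.filter (fun e => σ ⊆ e ∧ e.card = 2), eD K e =
      ((4 - σ.card).choose (2 - σ.card) : ℕ) * (nK K σ 4 : ℤ)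
        - 3 * (((3 - σ.card).choose (2 - σ.card) : ℕ) * (nK K σ 3 : ℤ)) + 6 * nK K σ 2 := by
  have h4 := nK_double hK σ 2 4 hσ (by norm_num)
  have h3 := nK_double hK σ 2 3 hσ (by norm_num)
  replace h4 := congrArg (Nat.cast : ℕ → ℤ) h4
  replace h3 := congrArg (Nat.cast : ℕ → ℤ) h3
  rw [Nat.cast_sum, Nat.cast_mul] at h4 h3
  unfold eD
  rw [Finset.sum_add_distrib, Finset.sum_sub_distrib, ← Finset.mul_sum, h4, h3, Finset.sum_const, nsmul_eq_mul]
  rw [mul_comm (6 : ℤ)]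
  rfl

theorem eD_eq {K : Finset (Finset V)} (hK : IsComplex K) (v w : V) (hvw : v ≠ w) :
    eD K {v, w} = fNum 1 (vertexLink w (vertexLink v K)) - 3 * fNum 0 (vertexLink w (vertexLink v K)) + 6 := by
  rw [fNum_link2 hK v w hvw, fNum_link2 hK v w hvw]
  rfl

theorem g2_vsum {K : Finset (Finset V)} (hK : IsComplex K) :
    ∑ v ∈ Finset.univ.filter (fun v : V => {v} ∈ K), g2 3 (vertexLink v K)
      = 3 * fNum 2 K - 8 * fNum 1 K + 10 * fNum 0 K := by
  have h3 := nK_double hK ∅ 1 3 (by simp) (by norm_num)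
  have h2 := nK_double hK ∅ 1 2 (by simp) (by norm_num)
  have himg : ∀ f : Finset V → ℕ, ∑ ρ ∈ K.filter (fun ρ => ∅ ⊆ ρ ∧ ρ.card = 1), f ρ
      = ∑ v ∈ Finset.univ.filter (fun v : V => {v} ∈ K), f {v} := by
    intro f
    symm
    apply Finset.sum_bij (fun v _ => {v})
    · intro v hv
      rw [Finset.mem_filter] at hv ⊢
      exact ⟨hv.2, by simp, by simp⟩
    · intro a _ b _ hab
      simpa using hab
    · intro ρ hρ
      rw [Finset.mem_filter] at hρ
      obtain ⟨x, rfl⟩ := Finset.card_eq_one.1 hρ.2.2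
      exact ⟨x, by simpa using hρ.1, rfl⟩
    · intro _ _; rfl
  rw [himg] at h3 h2
  have e : ∀ v : V, g2 3 (vertexLink v K) = nK K {v} 3 - 4 * nK K {v} 2 + 10 := by
    intro v
    rw [g2, fNum_link hK, fNum_link hK, show Nat.choose (3 + 2) 2 = 10 from rfl]
    push_cast; ring
  rw [Finset.card_empty, show Nat.choose (3 - 0) (1 - 0) = 3 from rfl] at h3
  rw [Finset.card_empty, show Nat.choose (2 - 0) (1 - 0) = 2 from rfl] at h2
  zify at h3 h2
  rw [Finset.sum_congr rfl (fun v _ => e v), Finset.sum_add_distrib, Finset.sum_sub_distrib, ← Finset.mul_sum,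
    h3, h2, Finset.sum_const, nsmul_eq_mul, nK_empty, nK_empty, cn_f0 (M := K) (S := Finset.univ.filter (fun v : V => {v} ∈ K)) (by simp)]
  push_cast
  ring

theorem main_arith {t2 t3 t4 t5 f0 f1 f2 f3 f4 : ℕ} {D0 G gt G3 gt3 R gu : ℤ}
    (q1 : 3 * (t4 : ℤ) - 3 * (2 * (t3 : ℤ)) + 6 * (t2 : ℤ) = D0)
    (q2 : 2 * t4 = (5 - 1) * t5)
    (q3 : 6 * (f3 : ℤ) - 3 * (3 * (f2 : ℤ)) + 6 * (f1 : ℤ) = D0)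
    (q4 : 2 * f3 = (5 - 0) * f4)
    (q5 : gt + R = 3 * (f2 : ℤ) - 8 * (f1 : ℤ) + 10 * (f0 : ℤ))
    (hule : gu ≤ R) (hupos : gu ≠ 0) (hunn : 0 ≤ gu) (hDle : D0 ≠ 0 → D0 ≤ G)
    (k2 : gt = t3 - 4 * t2 + 10) (k3 : gt3 = t4 - 3 * t3 + 6 * t2 - 10)
    (K2 : G = f1 - 5 * f0 + 15) (K3 : G3 = f2 - 4 * f1 + 10 * f0 - 20)
    (hopt2 : G = gt) (hopt3 : G3 = gt3) :
    ∃ m n : ℕ, 1 ≤ m ∧ G = 6 * m + 10 * n := by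
  obtain ⟨s, hs⟩ : ∃ s : ℤ, s = (t5 : ℤ) - t3 + t2 := ⟨_, rfl⟩
  have q2' : (t4 : ℤ) = 2 * t5 := by omega
  have hDs : D0 = 6 * s := by linarith
  have hRs : R = 6 * s := by linarith
  have hs1 : 1 ≤ s := by
    have : 0 < gu := lt_of_le_of_ne hunn hupos.symm
    have : 0 < 6 * s := by linarith
    omega
  have hle : D0 ≤ G := hDle (by rw [hDs]; intro h; linarith)
  obtain ⟨k, hk⟩ : ∃ k : ℕ, f3 = 5 * k := ⟨f3 / 5, by omega⟩
  have hk' : (f3 : ℤ) = 5 * k := by exact_mod_cast hk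
  have h7 : 7 * G = 10 * k - 8 * s - 20 * f0 + 90 := by linarith
  obtain ⟨n, hn⟩ : ∃ n : ℤ, G - 6 * s = 10 * n := by
    clear q1 q2 q3 q4 q5 k2 k3 K2 K3 hk hk' hDle q2' hs
    exact ⟨(G - 6 * s) / 10, by omega⟩
  have hn0 : 0 ≤ n := by linarith
  refine ⟨s.toNat, n.toNat, by omega, ?_⟩
  rw [Int.toNat_of_nonneg hn0, Int.toNat_of_nonneg (by linarith)]
  linarith

theorem main_aux (K : Finset (Finset V)) (t : V)
    (hK : IsNormalPseudomanifold 4 K)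
    (h2sing : (Finset.univ.filter (fun v : V => IsSingular v K)).card = 2)
    (ht : IsSingular t K)
    (hopt2 : g2 4 K = g2 3 (vertexLink t K))
    (hopt3 : g3 4 K = g3 3 (vertexLink t K)) :
    ∃ m n : ℕ, 1 ≤ m ∧ g2 4 K = 6 * m + 10 * n := by
  have hC := hK.1
  -- the other singular vertex
  obtain ⟨u, htu, hu, hother⟩ : ∃ u, t ≠ u ∧ IsSingular u K ∧ ∀ v, IsSingular v K → v = t ∨ v = u := by
    obtain ⟨a, b, hab, hset⟩ := Finset.card_eq_two.1 h2sing
    have hmem : ∀ v, IsSingular v K ↔ v = a ∨ v = b := by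
      intro v
      have : v ∈ Finset.univ.filter (fun v : V => IsSingular v K) ↔ v ∈ ({a, b} : Finset V) := by rw [hset]
      simpa using this
    rcases (hmem t).1 ht with rfl | rfl
    · exact ⟨b, hab, (hmem b).2 (Or.inr rfl), fun v hv => (hmem v).1 hv⟩
    · exact ⟨a, hab.symm, (hmem a).2 (Or.inl rfl), fun v hv => ((hmem v).1 hv).symm⟩
  have hsph : ∀ v, {v} ∈ K → v ≠ t → v ≠ u → IsTriangulatedSphere 3 (vertexLink v K) := by
    intro v hv h1 h2
    by_contra hn
    rcases hother v ⟨hv, hn⟩ with h | h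
    · exact h1 h
    · exact h2 h
  have hzero : ∀ e ∈ K, e.card = 2 → e ≠ {t, u} → eD K e = 0 := by
    intro e he h2 hne
    obtain ⟨a, b, hab, rfl⟩ := Finset.card_eq_two.1 h2
    have ha : {a} ∈ K := hC _ he _ (by simp) (by simp)
    have hb : {b} ∈ K := hC _ he _ (by simp) (by simp)
    by_cases h : a ≠ t ∧ a ≠ u
    · rw [eD_eq hC a b hab]
      exact cn_D_zero hK a b hab he (hsph a ha h.1 h.2)
    · by_cases h' : b ≠ t ∧ b ≠ u
      · rw [Finset.pair_comm] at he ⊢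
        rw [eD_eq hC b a hab.symm]
        exact cn_D_zero hK b a hab.symm he (hsph b hb h'.1 h'.2)
      · exfalso
        have h1 : a = t ∨ a = u := by by_contra hc; push Not at hc; exact h hc
        have h2 : b = t ∨ b = u := by by_contra hc; push Not at hc; exact h' hc
        rcases h1 with rfl | rfl <;> rcases h2 with rfl | rfl
        · exact hab rfl
        · exact hne rfl
        · exact hne (Finset.pair_comm _ _)
        · exact hab rfl
  have hsumD : ∀ σ : Finset V, σ ⊆ {t, u} → ∑ e ∈ K.filter (fun e => σ ⊆ e ∧ e.card = 2), eD K e =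
      if ({t, u} : Finset V) ∈ K then eD K {t, u} else 0 := by
    intro σ hσ
    by_cases hm : ({t, u} : Finset V) ∈ K
    · rw [if_pos hm]
      apply Finset.sum_eq_single_of_mem
      · rw [Finset.mem_filter]; exact ⟨hm, hσ, Finset.card_pair htu⟩
      · intro e he hne
        rw [Finset.mem_filter] at he
        exact hzero e he.1 he.2.2 hne
    · rw [if_neg hm]
      apply Finset.sum_eq_zero
      intro e he
      rw [Finset.mem_filter] at he
      exact hzero e he.1 he.2.2 (fun h => hm (h ▸ he.1))
  set D0 : ℤ := if ({t, u} : Finset V) ∈ K then eD K {t, u} else 0 with hD0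
  -- equations
  have q1 := hsumD {t} (by simp)
  rw [eD_sum hC {t} (by simp)] at q1
  have q3 := hsumD ∅ (by simp)
  rw [eD_sum hC ∅ (by simp)] at q3
  have q2 := nK_45 hK {t} (by simp)
  have q4 := nK_45 hK ∅ (by simp)
  simp only [Finset.card_singleton, Finset.card_empty] at q1 q2 q3 q4
  rw [show Nat.choose (4 - 1) (2 - 1) = 3 from rfl, show Nat.choose (3 - 1) (2 - 1) = 2 from rfl] at q1
  rw [show Nat.choose (4 - 0) (2 - 0) = 6 from rfl, show Nat.choose (3 - 0) (2 - 0) = 3 from rfl] at q3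
  have q5 := g2_vsum hC
  have htm : t ∈ Finset.univ.filter (fun v : V => {v} ∈ K) := by simpa using ht.1
  rw [← Finset.add_sum_erase _ _ htm] at q5
  have hnn : ∀ v ∈ (Finset.univ.filter (fun v : V => {v} ∈ K)).erase t, 0 ≤ g2 3 (vertexLink v K) := by
    intro v hv
    rw [Finset.mem_erase, Finset.mem_filter] at hv
    exact cn_g2_nonneg hK v hv.2.2
  have hule : g2 3 (vertexLink u K) ≤
      ∑ v ∈ (Finset.univ.filter (fun v : V => {v} ∈ K)).erase t, g2 3 (vertexLink v K) := by
    apply Finset.single_le_sum hnn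
    rw [Finset.mem_erase, Finset.mem_filter]
    exact ⟨htu.symm, Finset.mem_univ _, hu.1⟩
  have hupos : g2 3 (vertexLink u K) ≠ 0 := fun h => hu.2 (cn_g2_zero hK u hu.1 h)
  have hunn := cn_g2_nonneg hK u hu.1
  have hDle : D0 ≠ 0 → D0 ≤ g2 4 K := by
    intro h
    by_cases hm : ({t, u} : Finset V) ∈ K
    · rw [hD0, if_pos hm, eD_eq hC t u htu, hopt2]
      exact cn_star hK t u htu hm
    · rw [hD0, if_neg hm] at h
      exact absurd rfl h
  clear_value D0
  have k2 : g2 3 (vertexLink t K) = nK K {t} 3 - 4 * nK K {t} 2 + 10 := by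
    rw [g2, fNum_link hC, fNum_link hC, show Nat.choose (3 + 2) 2 = 10 from rfl]
    push_cast; ring
  have k3 : g3 3 (vertexLink t K) = nK K {t} 4 - 3 * nK K {t} 3 + 6 * nK K {t} 2 - 10 := by
    rw [g3, fNum_link hC, fNum_link hC, fNum_link hC, show Nat.choose (3 + 2) 3 = 10 from rfl,
      show Nat.choose (3 + 1) 2 = 6 from rfl]
    push_cast; ring
  have K2 : g2 4 K = nK K ∅ 2 - 5 * nK K ∅ 1 + 15 := by
    rw [g2, nK_empty, nK_empty, show Nat.choose (4 + 2) 2 = 15 from rfl]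
    push_cast; ring
  have K3 : g3 4 K = nK K ∅ 3 - 4 * nK K ∅ 2 + 10 * nK K ∅ 1 - 20 := by
    rw [g3, nK_empty, nK_empty, nK_empty, show Nat.choose (4 + 2) 3 = 20 from rfl,
      show Nat.choose (4 + 1) 2 = 10 from rfl]
    push_cast; ring
  rw [nK_empty, nK_empty, nK_empty] at q5
  simp only [Nat.reduceAdd, zero_add] at q5
  push_cast at q1 q3
  exact main_arith q1 q2 q3 q4 q5 hule hupos hunn hDle k2 k3 K2 K3 hopt2 hopt3

/-- if `K` is a normal 4-pseudomanifold with exactly two singular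
vertices, and `K` is g₂- and g₃-optimal with respect to a singular vertex `t`, then
`g₂(K) = 6m + 10n` for some naturals `m ≥ 1`, `n ≥ 0`. -/
theorem g2_eq_of_two_singularities (K : Finset (Finset V)) (t : V)
    (hK : IsNormalPseudomanifold 4 K)
    (h2sing : (Finset.univ.filter (fun v : V => IsSingular v K)).card = 2)
    (ht : IsSingular t K)
    (hopt2 : g2 4 K = g2 3 (vertexLink t K))
    (hopt3 : g3 4 K = g3 3 (vertexLink t K)) :
    ∃ m n : ℕ, 1 ≤ m ∧ g2 4 K = 6 * m + 10 * n := by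
  exact main_aux K t hK h2sing ht hopt2 hopt3

end
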